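/- arXiv:1702.05113 — 2 statements merged into one kernel-verified Lean document; each statement's English description precedes it below -/
import Mathlib

section
/- Fix r ≥ 2 and n ≥ 2r. Suppose D^{(r)}θ* ≠ 0 and θ* satisfies the length condition: n_i ≥ c₁n/(k+1) and n_i ≤ c₂n/(k+1) for every 0 ≤ i ≤ k with 𝔯_i ≠ 𝔯_{i+1}, where 0 < c₁ ≤ 1 ≤ c₂ and k := k_r(θ*). Then there is a constant C_r*(c₁, c₂) depending only on r, c₁, c₂ such that λ* ≤ C_r*(c₁, c₂) · sqrt( n · log(en/(k+1)) ). -/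
open MeasureTheory ProbabilityTheory
open scoped BigOperators

noncomputable section

/-- Zero-padding of a finite vector to a sequence on `ℕ`. -/
def pad {n : ℕ} (θ : Fin n → ℝ) : ℕ → ℝ := fun t => if h : t < n then θ ⟨t, h⟩ else 0

/-- First-order forward difference of a sequence. -/
def dseq (f : ℕ → ℝ) : ℕ → ℝ := fun t => f (t + 1) - f t

/-- `DD r θ t` is the `t`-th entry (0-indexed) of the `r`-th order difference `D^{(r)} θ`
of the vector `θ ∈ ℝ^n`; only the entries `t < n - r` are meaningful. -/
def DD (r : ℕ) {n : ℕ} (θ : Fin n → ℝ) : ℕ → ℝ := dseq^[r] (pad θ)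

/-- The ℓ¹ norm `‖D^{(r)} θ‖₁`. -/
def Dl1 (r : ℕ) {n : ℕ} (θ : Fin n → ℝ) : ℝ := ∑ t ∈ Finset.range (n - r), |DD r θ t|

/-- The number of nonzero entries `‖D^{(r)} θ‖₀`. -/
def Dl0 (r : ℕ) {n : ℕ} (θ : Fin n → ℝ) : ℕ :=
  ((Finset.range (n - r)).filter fun t => DD r θ t ≠ 0).card

/-- Squared Euclidean norm. -/
def sqnorm {n : ℕ} (x : Fin n → ℝ) : ℝ := ∑ i, x i ^ 2

/-- Euclidean norm. -/
def eunorm {n : ℕ} (x : Fin n → ℝ) : ℝ := Real.sqrt (sqnorm x)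

/-- `V^{(r)}(θ) = n^{r-1} ‖D^{(r)} θ‖₁`. -/
def Vr (r : ℕ) {n : ℕ} (θ : Fin n → ℝ) : ℝ := (n : ℝ) ^ ((r : ℤ) - 1) * Dl1 r θ

/-- The constraint set `K^{(r)}(V) = {θ : ‖D^{(r)} θ‖₁ ≤ V n^{1-r}}`. -/
def Kset (r n : ℕ) (V : ℝ) : Set (Fin n → ℝ) := {θ | Dl1 r θ ≤ V * (n : ℝ) ^ (1 - (r : ℤ))}

/-- `est` is a least-squares projection onto the set `K`. -/
def IsProjOn {n : ℕ} (est : (Fin n → ℝ) → Fin n → ℝ) (K : Set (Fin n → ℝ)) : Prop :=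
  ∀ y, est y ∈ K ∧ ∀ θ ∈ K, sqnorm (y - est y) ≤ sqnorm (y - θ)

/-- `est` is the penalized trend filtering estimator of order `r` with noise level `σ`
and tuning parameter `lam`: it minimizes `½‖y - θ‖² + σ n^{r-1} lam ‖D^{(r)} θ‖₁`. -/
def IsPenEst (r : ℕ) {n : ℕ} (σ lam : ℝ) (est : (Fin n → ℝ) → Fin n → ℝ) : Prop :=
  ∀ y θ, 1 / 2 * sqnorm (y - est y) + σ * (n : ℝ) ^ ((r : ℤ) - 1) * lam * Dl1 r (est y) ≤
    1 / 2 * sqnorm (y - θ) + σ * (n : ℝ) ^ ((r : ℤ) - 1) * lam * Dl1 r θ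

/-- The Gaussian measure `N_n(0, σ² I_n)` on `ℝ^n`. -/
def gaussVec (n : ℕ) (σ : ℝ) : Measure (Fin n → ℝ) :=
  Measure.pi fun _ => gaussianReal 0 (σ ^ 2).toNNReal

/-- The risk `R(θ̂, θ*) = (1/n) E ‖θ̂(θ* + ξ) - θ*‖²` for `ξ ∼ N_n(0, σ² I_n)`. -/
def risk {n : ℕ} (σ : ℝ) (est : (Fin n → ℝ) → Fin n → ℝ) (θs : Fin n → ℝ) : ℝ :=
  1 / (n : ℝ) * ∫ ξ, sqnorm (est (θs + ξ) - θs) ∂gaussVec n σ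

/-- `j` (with signs `sg`) enumerates, in increasing order and paper (1-indexed) convention,
exactly the `r`-th order knots of `θ ∈ ℝ^n`; an index `2 ≤ m ≤ n - r + 1` is a knot when
`(D^{(r-1)}θ)_{m-1} ≠ (D^{(r-1)}θ)_m` (1-indexed entries), and its sign is `+1` when
`(D^{(r-1)}θ)_{m-1} < (D^{(r-1)}θ)_m` and `-1` otherwise. -/
def IsKnotSeq (r n : ℕ) (θ : Fin n → ℝ) (k : ℕ) (j : Fin k → ℕ) (sg : Fin k → ℝ) : Prop :=
  StrictMono j ∧ (∀ i, 2 ≤ j i ∧ j i ≤ n - r + 1) ∧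
    (∀ m : ℕ, 2 ≤ m → m ≤ n - r + 1 →
      (DD (r - 1) θ (m - 2) ≠ DD (r - 1) θ (m - 1) ↔ ∃ i, j i = m)) ∧
    ∀ i, sg i = if DD (r - 1) θ (j i - 2) < DD (r - 1) θ (j i - 1) then 1 else -1

/-- Extended knot sequence: `jext 0 = j_0 = 1`, `jext i = j_i` for `1 ≤ i ≤ k`, and
`jext (k+1) = j_{k+1} = n - r + 2`. -/
def jext (n r k : ℕ) (j : Fin k → ℕ) : ℕ → ℕ := fun i =>
  if i = 0 then 1 else if h : i - 1 < k then j ⟨i - 1, h⟩ else n - r + 2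

/-- Extended sign sequence: `sgext i = 𝔯_i` for `1 ≤ i ≤ k` and `0` otherwise. -/
def sgext (k : ℕ) (sg : Fin k → ℝ) : ℕ → ℝ := fun i =>
  if h : 0 < i ∧ i - 1 < k then sg ⟨i - 1, h.2⟩ else 0

/-- The lengths `n_0 = j_1 + r - 2`, `n_i = j_{i+1} - j_i` (`1 ≤ i ≤ k-1`),
`n_k = n - r + 2 - j_k`. -/
def nlen (n r k : ℕ) (j : Fin k → ℕ) : ℕ → ℕ := fun i =>
  if i = 0 then jext n r k j 1 + r - 2 else jext n r k j (i + 1) - jext n r k j i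

/-- `n_{i*} = min(n_i, n/(k+1))`. -/
def nstar (n r k : ℕ) (j : Fin k → ℕ) (i : ℕ) : ℝ :=
  min (nlen n r k j i : ℝ) ((n : ℝ) / ((k : ℝ) + 1))

/-- `δ_r(θ)²` defined from the knot data of `θ`. -/
def deltaSq (n r k : ℕ) (j : Fin k → ℕ) (sg : Fin k → ℝ) : ℝ :=
  nstar n r k j 0 ^ (1 - 2 * (r : ℤ)) + nstar n r k j k ^ (1 - 2 * (r : ℤ)) +
    ∑ i ∈ Finset.Ico 1 k,
      if sgext k sg i ≠ sgext k sg (i + 1) then nstar n r k j i ^ (1 - 2 * (r : ℤ)) else 0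

/-- `Δ_r(θ)` defined from the knot data of `θ`. -/
def DeltaR (n r k : ℕ) (j : Fin k → ℕ) (sg : Fin k → ℝ) : ℝ :=
  ((k : ℝ) + 1) / (n : ℝ) * Real.log (Real.exp 1 * (n : ℝ) / ((k : ℝ) + 1)) +
    deltaSq n r k j sg / (n : ℝ) * ((n : ℝ) / ((k : ℝ) + 1)) ^ (2 * (r : ℤ) - 1) *
      Real.log (Real.exp 1 * (n : ℝ) / ((k : ℝ) + 1)) +
    (Real.sqrt (deltaSq n r k j sg) / Real.sqrt (n : ℝ)) ^ ((1 : ℝ) / (r : ℝ))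

/-- The minimum length condition with constant `c`: `n_i ≥ c n/(k+1)` for every `0 ≤ i ≤ k`
with `𝔯_i ≠ 𝔯_{i+1}` (where `𝔯_0 = 𝔯_{k+1} = 0`). -/
def MinLen (n r k : ℕ) (j : Fin k → ℕ) (sg : Fin k → ℝ) (c : ℝ) : Prop :=
  ∀ i ≤ k, sgext k sg i ≠ sgext k sg (i + 1) →
    c * (n : ℝ) / ((k : ℝ) + 1) ≤ (nlen n r k j i : ℝ)

/-- The subdifferential of `g` at `θ`. -/
def subdiff {n : ℕ} (g : (Fin n → ℝ) → ℝ) (θ : Fin n → ℝ) : Set (Fin n → ℝ) :=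
  {v | ∀ y, g θ + ∑ i, v i * (y i - θ i) ≤ g y}

/-- `v` is the minimum-norm element of `S`. -/
def IsMinNormIn {n : ℕ} (v : Fin n → ℝ) (S : Set (Fin n → ℝ)) : Prop :=
  v ∈ S ∧ ∀ w ∈ S, eunorm v ≤ eunorm w

/-- `c • S`. -/
def scaleSet {n : ℕ} (c : ℝ) (S : Set (Fin n → ℝ)) : Set (Fin n → ℝ) := (c • ·) '' S

/-- The cone generated by `S`: `⋃_{c ≥ 0} c • S`. -/
def coneOf {n : ℕ} (S : Set (Fin n → ℝ)) : Set (Fin n → ℝ) := ⋃ c ∈ Set.Ici (0 : ℝ), scaleSet c S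

/-- Euclidean distance from a point to a set. -/
def distSet {n : ℕ} (z : Fin n → ℝ) (S : Set (Fin n → ℝ)) : ℝ :=
  sInf ((fun v => eunorm (z - v)) '' S)

/-- Gaussian mean squared distance `D(S) = E dist²(Z, S)`, `Z ∼ N_n(0, I_n)`. -/
def gaussMSD {n : ℕ} (S : Set (Fin n → ℝ)) : ℝ := ∫ z, distSet z S ^ 2 ∂gaussVec n 1

/-- `lam z` is, for each `z`, the minimizer over `λ ≥ 0` of `dist(z, λ S)`. -/
def IsLamFun {n : ℕ} (S : Set (Fin n → ℝ)) (lam : (Fin n → ℝ) → ℝ) : Prop :=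
  ∀ z, 0 ≤ lam z ∧ ∀ μ : ℝ, 0 ≤ μ → distSet z (scaleSet (lam z) S) ≤ distSet z (scaleSet μ S)

/-- Euclidean covering number of `K` at scale `ε`. -/
def covN {n : ℕ} (ε : ℝ) (K : Set (Fin n → ℝ)) : ℕ :=
  sInf {m : ℕ | ∃ a : Fin m → Fin n → ℝ, ∀ x ∈ K, ∃ i, eunorm (x - a i) ≤ ε}

/-- `K` `t`-shatters the (finite) index set `A`. -/
def fatShatters {n : ℕ} (K : Set (Fin n → ℝ)) (t : ℝ) (A : Finset (Fin n)) : Prop :=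
  ∃ h : Fin n → ℝ, ∀ S : Finset (Fin n), S ⊆ A →
    ∃ θ ∈ K, (∀ i ∈ S, θ i ≤ h i) ∧ ∀ i ∈ A, i ∉ S → h i + t ≤ θ i

/-- The fat shattering dimension `v(K, t)`. -/
def fatDim {n : ℕ} (K : Set (Fin n → ℝ)) (t : ℝ) : ℕ :=
  sSup {m : ℕ | ∃ A : Finset (Fin n), A.card = m ∧ fatShatters K t A}

/-- The tangent cone of `K` at `θ`. -/
def tanCone {n : ℕ} (K : Set (Fin n → ℝ)) (θ : Fin n → ℝ) : Set (Fin n → ℝ) :=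
  closure {w | ∃ t : ℝ, 0 ≤ t ∧ ∃ η ∈ K, w = t • (η - θ)}

/-- `V_{a,b}(f) = Σ_{m=a+1}^{b} |f_m - f_{m-1}|` for the (paper 1-indexed) sequence whose
`m`-th entry is `f (m-1)`. -/
def Vab (f : ℕ → ℝ) (a b : ℕ) : ℝ := ∑ t ∈ Finset.Ico (a - 1) (b - 1), |f (t + 1) - f t|

/-- `Acoef r n v j = Σ_{i=j}^n C(r+i-j-1, r-1) v_i` (paper 1-indexed). -/
def Acoef (r n : ℕ) (v : Fin n → ℝ) (jj : ℕ) : ℝ :=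
  ∑ i : Fin n, (if jj ≤ i.1 + 1 then ((r + (i.1 + 1) - jj - 1).choose (r - 1) : ℝ) else 0) * v i

/-- The class `C_r({a_i}, {s_i})`. -/
def Cras (r n : ℕ) (a s : ℕ → ℝ) : Set (Fin n → ℝ) :=
  {θ | (∀ i < r - 1, a i ≤ DD i θ 0 ∧ DD i θ 0 ≤ a i + s i) ∧
    a (r - 1) ≤ DD (r - 1) θ 0 ∧
    (∀ t : ℕ, t + 1 ≤ n - r → DD (r - 1) θ t ≤ DD (r - 1) θ (t + 1)) ∧
    DD (r - 1) θ (n - r) ≤ a (r - 1) + s (r - 1)}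

/-- The class `C_r(a, V) = {θ : a ≤ (D^{(r-1)}θ)_1 ≤ ⋯ ≤ (D^{(r-1)}θ)_{n-r+1} ≤ a + V}`. -/
def CrMono (r n : ℕ) (a V : ℝ) : Set (Fin n → ℝ) :=
  {θ | a ≤ DD (r - 1) θ 0 ∧
    (∀ t : ℕ, t + 1 ≤ n - r → DD (r - 1) θ t ≤ DD (r - 1) θ (t + 1)) ∧
    DD (r - 1) θ (n - r) ≤ a + V}


namespace TF

variable {V : Type*} [AddCommGroup V] [Module ℝ V]

/-- Backward shift. -/
def Tsh : Module.End ℝ (ℤ → V) where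
  toFun f := fun t => f (t - 1)
  map_add' _ _ := rfl
  map_smul' _ _ := rfl

lemma Tsh_pow (i : ℕ) (f : ℤ → V) (t : ℤ) : ((Tsh ^ i : Module.End ℝ (ℤ → V)) f) t = f (t - i) := by
  induction i generalizing f t with
  | zero => simp
  | succ i ih =>
    rw [pow_succ, Module.End.mul_apply, ih]
    change f (t - i - 1) = _
    congr 1; push_cast; ring

/-- Averaging operator. -/
def Aop (w : ℕ) : Module.End ℝ (ℤ → V) := (w : ℝ)⁻¹ • ∑ i ∈ Finset.range w, Tsh ^ i

/-- Difference operator (adjoint of the forward difference). -/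
def dop : Module.End ℝ (ℤ → V) := Tsh - 1

/-- Parametrix. -/
def Rop (w : ℕ) : Module.End ℝ (ℤ → V) :=
  (-(w : ℝ)⁻¹) • ∑ i ∈ Finset.range w, ((w : ℝ) - 1 - i) • Tsh ^ i

lemma dop_apply (f : ℤ → V) (t : ℤ) : dop f t = f (t - 1) - f t := rfl

lemma Aop_apply (w : ℕ) (f : ℤ → V) (t : ℤ) :
    Aop w f t = (w : ℝ)⁻¹ • ∑ i ∈ Finset.range w, f (t - i) := by
  simp [Aop, Tsh_pow, LinearMap.sum_apply, Finset.sum_apply]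

lemma Rop_apply (w : ℕ) (f : ℤ → V) (t : ℤ) :
    Rop w f t = (-(w : ℝ)⁻¹) • ∑ i ∈ Finset.range w, ((w : ℝ) - 1 - i) • f (t - i) := by
  simp [Rop, Tsh_pow, LinearMap.sum_apply, Finset.sum_apply]

lemma comm_T_A (w : ℕ) : Commute (Tsh : Module.End ℝ (ℤ → V)) (Aop w) := by
  unfold Aop
  exact Commute.smul_right (Commute.sum_right _ _ _ fun i _ => (Commute.refl _).pow_right i) _

lemma comm_T_R (w : ℕ) : Commute (Tsh : Module.End ℝ (ℤ → V)) (Rop w) := by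
  unfold Rop
  exact Commute.smul_right (Commute.sum_right _ _ _ fun i _ =>
    Commute.smul_right ((Commute.refl _).pow_right i) _) _

lemma comm_d_A (w : ℕ) : Commute (dop : Module.End ℝ (ℤ → V)) (Aop w) :=
  (comm_T_A w).sub_left (Commute.one_left _)

lemma comm_d_R (w : ℕ) : Commute (dop : Module.End ℝ (ℤ → V)) (Rop w) :=
  (comm_T_R w).sub_left (Commute.one_left _)

lemma comm_T_d : Commute (Tsh : Module.End ℝ (ℤ → V)) dop :=
  (Commute.refl _).sub_right (Commute.one_right _)

lemma comm_A_R (w : ℕ) : Commute (Aop w : Module.End ℝ (ℤ → V)) (Rop w) := by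
  unfold Aop
  exact Commute.smul_left (Commute.sum_left _ _ _ fun i _ => (comm_T_R w).pow_left i) _

lemma dop_geom (w : ℕ) :
    (dop : Module.End ℝ (ℤ → V)) * ∑ i ∈ Finset.range w, Tsh ^ i = Tsh ^ w - 1 := by
  exact mul_geom_sum _ _

lemma dop_G (w : ℕ) :
    (dop : Module.End ℝ (ℤ → V)) * ∑ i ∈ Finset.range w, ((w : ℝ) - 1 - i) • Tsh ^ i
      = (∑ i ∈ Finset.range w, Tsh ^ i) - (w : ℝ) • 1 := by
  induction w with
  | zero => simp
  | succ w ih =>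
    have h1 : ∑ i ∈ Finset.range (w+1), (((w+1 : ℕ) : ℝ) - 1 - i) • (Tsh : Module.End ℝ (ℤ → V)) ^ i
        = (∑ i ∈ Finset.range w, ((w : ℝ) - 1 - i) • Tsh ^ i) + ∑ i ∈ Finset.range w, Tsh ^ i := by
      rw [Finset.sum_range_succ]
      have : (((w+1 : ℕ) : ℝ) - 1 - w) = 0 := by push_cast; ring
      rw [this, zero_smul, add_zero, ← Finset.sum_add_distrib]
      refine Finset.sum_congr rfl fun i _ => ?_
      have h2 : (((w+1 : ℕ) : ℝ) - 1 - i) = ((w : ℝ) - 1 - i) + 1 := by push_cast; ring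
      rw [h2, add_smul, one_smul]
    rw [h1, mul_add, ih, dop_geom, Finset.sum_range_succ]
    push_cast
    rw [add_smul, one_smul]
    abel

lemma one_sub_A {w : ℕ} (hw : 0 < w) :
    (dop : Module.End ℝ (ℤ → V)) * Rop w = 1 - Aop w := by
  have hw' : (w : ℝ) ≠ 0 := by positivity
  unfold Rop Aop
  rw [mul_smul_comm, dop_G, smul_sub, smul_smul, neg_mul, inv_mul_cancel₀ hw', neg_smul, neg_smul,
    one_smul]
  abel

lemma dA_apply (w : ℕ) (f : ℤ → V) (t : ℤ) :
    (dop * Aop w : Module.End ℝ (ℤ → V)) f t = (w : ℝ)⁻¹ • (f (t - w) - f t) := by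
  unfold Aop
  rw [mul_smul_comm, dop_geom]
  simp [Tsh_pow]

/-- Size predicates. -/
structure Siz (P : V → ℝ → Prop) : Prop where
  zero : P 0 0
  add : ∀ {x y a b}, P x a → P y b → P (x + y) (a + b)
  smul : ∀ (c : ℝ) {x a}, P x a → P (c • x) (|c| * a)
  mono : ∀ {x a b}, P x a → a ≤ b → P x b
  nonneg : ∀ {x a}, P x a → 0 ≤ a

/-- Uniform size bound. -/
def UB (P : V → ℝ → Prop) (f : ℤ → V) (a : ℝ) : Prop := ∀ t, P (f t) a

namespace Siz

lemma neg {P : V → ℝ → Prop} (hP : Siz P) {x : V} {a : ℝ} (h : P x a) : P (-x) a := by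
  have := hP.smul (-1) h
  simpa using this

lemma sub {P : V → ℝ → Prop} (hP : Siz P) {x y : V} {a b : ℝ} (h : P x a) (h' : P y b) : P (x - y) (a + b) := by
  rw [sub_eq_add_neg]; exact hP.add h (hP.neg h')

lemma sum {P : V → ℝ → Prop} (hP : Siz P) {ι : Type*} (s : Finset ι) {x : ι → V} {a : ι → ℝ} (h : ∀ i ∈ s, P (x i) (a i)) :
    P (∑ i ∈ s, x i) (∑ i ∈ s, a i) := by
  classical
  induction s using Finset.induction_on with
  | empty => simpa using hP.zero
  | insert i s hi ih =>
    rw [Finset.sum_insert hi, Finset.sum_insert hi]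
    exact hP.add (h i (Finset.mem_insert_self _ _))
      (ih fun j hj => h j (Finset.mem_insert_of_mem hj))

lemma ubT {P : V → ℝ → Prop} (_hP : Siz P) {f : ℤ → V} {a : ℝ} (h : UB P f a) : UB P (Tsh f) a := fun t => h (t - 1)

lemma ubd {P : V → ℝ → Prop} (hP : Siz P) {f : ℤ → V} {a : ℝ} (h : UB P f a) : UB P (dop f) (2 * a) := fun t => by
  rw [two_mul]; exact hP.sub (h _) (h _)

lemma ubA {P : V → ℝ → Prop} (hP : Siz P) {w : ℕ} (hw : 0 < w) {f : ℤ → V} {a : ℝ} (h : UB P f a) : UB P (Aop w f) a := fun t => by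
  rw [Aop_apply]
  have h1 := hP.smul (w : ℝ)⁻¹ (hP.sum (Finset.range w) (x := fun i => f (t - i))
    (a := fun _ => a) fun i _ => h _)
  have hw' : (w : ℝ) ≠ 0 := by positivity
  refine hP.mono h1 (le_of_eq ?_)
  rw [Finset.sum_const, Finset.card_range, nsmul_eq_mul, abs_of_nonneg (by positivity)]
  field_simp

lemma ubA_pow {P : V → ℝ → Prop} (hP : Siz P) {w : ℕ} (hw : 0 < w) {f : ℤ → V} {a : ℝ} (h : UB P f a) (j : ℕ) :
    UB P ((Aop w ^ j : Module.End ℝ (ℤ → V)) f) a := by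
  induction j with
  | zero => simpa using h
  | succ j ih => rw [pow_succ', Module.End.mul_apply]; exact hP.ubA hw ih

lemma ubdA {P : V → ℝ → Prop} (hP : Siz P) {w : ℕ} {f : ℤ → V} {a : ℝ} (h : UB P f a) :
    UB P ((dop * Aop w : Module.End ℝ (ℤ → V)) f) (2 / w * a) := fun t => by
  rw [dA_apply]
  refine hP.mono (hP.smul _ (hP.sub (h _) (h _))) (le_of_eq ?_)
  rw [abs_of_nonneg (by positivity)]; ring

lemma ubdA_pow {P : V → ℝ → Prop} (hP : Siz P) {w : ℕ} {f : ℤ → V} {a : ℝ} (h : UB P f a) (j : ℕ) :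
    UB P (((dop * Aop w) ^ j : Module.End ℝ (ℤ → V)) f) ((2 / w) ^ j * a) := by
  induction j with
  | zero => simpa using h
  | succ j ih =>
    rw [pow_succ', Module.End.mul_apply, pow_succ', mul_assoc]; exact hP.ubdA ih

/-- differences of an iterated average -/
lemma ub_d_A {P : V → ℝ → Prop} (hP : Siz P) {w : ℕ} (hw : 0 < w) {f : ℤ → V} {a : ℝ} (h : UB P f a) {j r : ℕ} (hj : j ≤ r) :
    UB P ((dop ^ j : Module.End ℝ (ℤ → V)) ((Aop w ^ r : Module.End ℝ (ℤ → V)) f))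
      ((2 / w) ^ j * a) := by
  have : (dop ^ j : Module.End ℝ (ℤ → V)) ((Aop w ^ r : Module.End ℝ (ℤ → V)) f)
      = ((dop * Aop w) ^ j : Module.End ℝ (ℤ → V)) ((Aop w ^ (r - j) : Module.End ℝ (ℤ → V)) f) := by
    rw [(comm_d_A w).mul_pow, ← Module.End.mul_apply, ← Module.End.mul_apply, mul_assoc, ← pow_add,
      Nat.add_sub_cancel' hj]
  rw [this]
  exact hP.ubdA_pow (hP.ubA_pow hw h _) j

lemma ubR {P : V → ℝ → Prop} (hP : Siz P) {w : ℕ} (hw : 0 < w) {f : ℤ → V} {a : ℝ} (h : UB P f a) : UB P (Rop w f) (w * a) := fun t => by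
  rw [Rop_apply]
  have ha := hP.nonneg (h 0)
  have hw' : (w : ℝ) ≠ 0 := by positivity
  have h1 := (hP.smul (-(w : ℝ)⁻¹) (hP.sum (Finset.range w)
    (x := fun i : ℕ => ((w : ℝ) - 1 - i) • f (t - i))
    (a := fun _ => w * a) fun i hi => by
      refine hP.mono (hP.smul _ (h _)) ?_
      have : (i : ℝ) + 1 ≤ w := by exact_mod_cast Finset.mem_range.1 hi
      refine mul_le_mul_of_nonneg_right ?_ ha
      rw [abs_of_nonneg (by linarith)]
      have : (0 : ℝ) ≤ i := by positivity
      linarith))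
  refine hP.mono h1 (le_of_eq ?_)
  rw [Finset.sum_const, Finset.card_range, nsmul_eq_mul, abs_neg, abs_of_nonneg (by positivity)]
  field_simp

lemma ubR_pow {P : V → ℝ → Prop} (hP : Siz P) {w : ℕ} (hw : 0 < w) {f : ℤ → V} {a : ℝ} (h : UB P f a) (j : ℕ) :
    UB P ((Rop w ^ j : Module.End ℝ (ℤ → V)) f) (w ^ j * a) := by
  induction j with
  | zero => simpa using h
  | succ j ih =>
    rw [pow_succ', Module.End.mul_apply, pow_succ', mul_assoc]; exact hP.ubR hw ih

lemma ub1A_pow {P : V → ℝ → Prop} (hP : Siz P) {w : ℕ} (hw : 0 < w) {f : ℤ → V} {a : ℝ} (h : UB P f a) (j : ℕ) :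
    UB P (((1 - Aop w) ^ j : Module.End ℝ (ℤ → V)) f) (2 ^ j * a) := by
  induction j with
  | zero => simpa using h
  | succ j ih =>
    rw [pow_succ', Module.End.mul_apply, pow_succ', mul_assoc, two_mul]
    exact fun t => hP.sub (ih t) (hP.ubA hw ih t)

/-- remainder of the parametrix -/
lemma ub_rem {P : V → ℝ → Prop} (hP : Siz P) {w : ℕ} (hw : 0 < w) {f : ℤ → V} {a : ℝ} (h : UB P (Aop w f) a) (j : ℕ) :
    UB P (((1 - Aop w) ^ j : Module.End ℝ (ℤ → V)) f - f) (2 ^ j * a) := by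
  have ha := hP.nonneg (h 0)
  induction j with
  | zero => intro t; simp only [pow_zero, Module.End.one_apply, sub_self, Pi.zero_apply]
            exact hP.mono hP.zero (by linarith)
  | succ j ih =>
    have hc : Commute ((1 - Aop w) ^ j : Module.End ℝ (ℤ → V)) (Aop w) :=
      ((Commute.one_left _).sub_left (Commute.refl _)).pow_left _
    have : ((1 - Aop w) ^ (j+1) : Module.End ℝ (ℤ → V)) f - f
        = (((1 - Aop w) ^ j : Module.End ℝ (ℤ → V)) f - f)
          - ((1 - Aop w) ^ j : Module.End ℝ (ℤ → V)) (Aop w f) := by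
      rw [pow_succ, mul_sub, mul_one, LinearMap.sub_apply, Module.End.mul_apply]
      abel
    rw [this]
    intro t
    rw [pow_succ, mul_assoc, mul_comm 2 a, ← mul_assoc, mul_two]
    exact hP.sub (ih t) (hP.ub1A_pow hw h j t)

lemma leibniz {P : V → ℝ → Prop} (hP : Siz P) (r : ℕ) : ∀ (f : ℤ → ℝ) (g : ℤ → V) (t : ℤ) (α β w : ℝ), 0 < w →
    (∀ m ≤ r, |(dop ^ m : Module.End ℝ (ℤ → ℝ)) f t| ≤ α / w ^ m) →
    (∀ m, 1 ≤ m → m ≤ r → UB P ((dop ^ (r - m) : Module.End ℝ (ℤ → V)) g) (β * w ^ m)) →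
    P ((dop ^ r : Module.End ℝ (ℤ → V)) (fun t => f t • g t) t
      - f t • (dop ^ r : Module.End ℝ (ℤ → V)) g t) ((2 ^ r - 1) * (α * β)) := by
  induction r with
  | zero =>
    intro f g t α β w hw hf hg
    simpa using hP.zero
  | succ r ih =>
    intro f g t α β w hw hf hg
    have e1 : (dop (fun t => f t • g t) : ℤ → V)
        = (fun t => (dop f t) • (Tsh g t)) + fun t => f t • dop g t := by
      funext t
      change f (t-1) • g (t-1) - f t • g t = (f (t-1) - f t) • g (t-1) + f t • (g (t-1) - g t)
      rw [sub_smul, smul_sub]; abel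
    have i1 := ih (dop f) (Tsh g) t (α / w) (β * w) w hw (by
        intro m hm
        have := hf (m+1) (by omega)
        rw [pow_succ, Module.End.mul_apply] at this
        refine this.trans (le_of_eq ?_)
        field_simp; ring) (by
        intro m hm hmr
        have := hg (m+1) (by omega) (by omega)
        rw [Nat.add_sub_add_right] at this
        have h2 := hP.ubT this
        rw [← Module.End.mul_apply, (comm_T_d.pow_right (r-m)).eq, Module.End.mul_apply] at h2
        intro t
        exact hP.mono (h2 t) (le_of_eq (by ring)))
    have i2 := ih f (dop g) t α β w hw (fun m hm => hf m (by omega)) (by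
        intro m hm hmr
        have := hg m hm (by omega)
        rw [show r + 1 - m = (r - m) + 1 by omega, pow_succ, Module.End.mul_apply] at this
        exact this)
    have h3 : P (dop f t • (dop ^ r : Module.End ℝ (ℤ → V)) (Tsh g) t) (α * β) := by
      have a1 := hg 1 le_rfl (by omega)
      simp only [Nat.add_sub_cancel, pow_one] at a1
      have h2 := hP.ubT a1
      rw [← Module.End.mul_apply, (comm_T_d.pow_right r).eq, Module.End.mul_apply] at h2
      have a2 := hf 1 (by omega)
      rw [pow_one, pow_one] at a2
      refine hP.mono (hP.smul _ (h2 t)) ?_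
      have := hP.nonneg (h2 t)
      refine (mul_le_mul_of_nonneg_right a2 this).trans (le_of_eq ?_)
      field_simp
    rw [pow_succ, Module.End.mul_apply, e1, map_add, Module.End.mul_apply, Pi.add_apply]
    have h4 := hP.add (hP.add i1 h3) i2
    have hab : α / w * (β * w) = α * β := by field_simp
    rw [hab] at h4
    convert h4 using 1
    · abel
    · ring

end Siz

lemma siz_abs : Siz (fun (x : ℝ) a => |x| ≤ a) where
  zero := by simp
  add := fun h h' => (abs_add_le _ _).trans (add_le_add h h')
  smul := fun c x a h => by
    rw [smul_eq_mul, abs_mul]; exact mul_le_mul_of_nonneg_left h (abs_nonneg _)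
  mono := fun h h' => h.trans h'
  nonneg := fun h => (abs_nonneg _).trans h

/-- locality of iterated averages -/
lemma A_pow_mem {w : ℕ} (hw : 0 < w) (s : Set ℝ) (hs : Convex ℝ s) (j : ℕ) (f : ℤ → ℝ) (t : ℤ)
    (h : ∀ a : ℤ, 0 ≤ a → a ≤ j * ((w : ℤ) - 1) → f (t - a) ∈ s) :
    (Aop w ^ j : Module.End ℝ (ℤ → ℝ)) f t ∈ s := by
  induction j generalizing t with
  | zero => simpa using h 0 le_rfl (by simp)
  | succ j ih =>
    rw [pow_succ', Module.End.mul_apply, Aop_apply, Finset.smul_sum]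
    have hw' : (w : ℝ) ≠ 0 := by positivity
    refine hs.sum_mem (fun _ _ => by positivity) (by simp [hw']) fun i hi => ?_
    refine ih _ fun a ha0 ha => ?_
    have hi' := Finset.mem_range.1 hi
    have := h (i + a) (by positivity) (by push_cast; nlinarith)
    rwa [show t - (i + a) = t - i - a by ring] at this

lemma d_pow_zero (j : ℕ) (f : ℤ → V) (t : ℤ)
    (h : ∀ a : ℤ, 0 ≤ a → a ≤ j → f (t - a) = 0) :
    (dop ^ j : Module.End ℝ (ℤ → V)) f t = 0 := by
  induction j generalizing t with
  | zero => simpa using h 0 le_rfl (by simp)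
  | succ j ih =>
    rw [pow_succ', Module.End.mul_apply, dop_apply, ih (t-1), ih t, sub_zero]
    · intro a h0 h1; exact h a h0 (by push_cast; omega)
    · intro a h0 h1
      have := h (1 + a) (by omega) (by push_cast; omega)
      rwa [show t - (1 + a) = t - 1 - a by ring] at this

end TF

namespace TF

/-- `L²` size predicate. -/
def L2 {Ω : Type*} [MeasurableSpace Ω] (μ : Measure Ω) (x : Ω → ℝ) (a : ℝ) : Prop :=
  0 ≤ a ∧ MemLp x 2 μ ∧ ∫ ω, x ω ^ 2 ∂μ ≤ a ^ 2

lemma eLp_two {Ω : Type*} [MeasurableSpace Ω] {μ : Measure Ω} {x : Ω → ℝ} (h : MemLp x 2 μ) :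
    eLpNorm x 2 μ = ENNReal.ofReal (Real.sqrt (∫ ω, x ω ^ 2 ∂μ)) := by
  rw [h.eLpNorm_eq_integral_rpow_norm (by norm_num) (by norm_num), Real.sqrt_eq_rpow]
  simp

lemma L2_iff {Ω : Type*} [MeasurableSpace Ω] {μ : Measure Ω} {x : Ω → ℝ} {a : ℝ} :
    L2 μ x a ↔ 0 ≤ a ∧ AEStronglyMeasurable x μ ∧ eLpNorm x 2 μ ≤ ENNReal.ofReal a := by
  constructor
  · rintro ⟨h0, h1, h2⟩
    refine ⟨h0, h1.1, ?_⟩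
    rw [eLp_two h1]
    exact ENNReal.ofReal_le_ofReal (Real.sqrt_le_iff.2 ⟨h0, h2⟩)
  · rintro ⟨h0, h1, h2⟩
    have h3 : MemLp x 2 μ := ⟨h1, h2.trans_lt ENNReal.ofReal_lt_top⟩
    refine ⟨h0, h3, ?_⟩
    rw [eLp_two h3, ENNReal.ofReal_le_ofReal_iff h0, Real.sqrt_le_iff] at h2
    exact h2.2

lemma siz_L2 {Ω : Type*} [MeasurableSpace Ω] (μ : Measure Ω) : Siz (L2 μ) where
  zero := ⟨le_rfl, MemLp.zero, by simp⟩
  add := fun {x y a b} h h' => by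
    rw [L2_iff] at *
    refine ⟨add_nonneg h.1 h'.1, h.2.1.add h'.2.1, (eLpNorm_add_le h.2.1 h'.2.1 (by norm_num)).trans ?_⟩
    rw [ENNReal.ofReal_add h.1 h'.1]
    exact add_le_add h.2.2 h'.2.2
  smul := fun c x a h => by
    refine ⟨mul_nonneg (abs_nonneg _) h.1, h.2.1.const_smul c, ?_⟩
    simp only [Pi.smul_apply, smul_eq_mul, mul_pow, integral_const_mul, sq_abs]
    exact mul_le_mul_of_nonneg_left h.2.2 (sq_nonneg _)
  mono := fun {x a b} h hab => ⟨h.1.trans hab, h.2.1, h.2.2.trans (pow_le_pow_left₀ h.1 hab 2)⟩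
  nonneg := fun h => h.1

lemma L2_abs {Ω : Type*} [MeasurableSpace Ω] {μ : Measure Ω} {x : Ω → ℝ} {a : ℝ} (h : L2 μ x a) :
    L2 μ (fun ω => |x ω|) a := ⟨h.1, h.2.1.abs, by simpa [sq_abs] using h.2.2⟩

lemma L2_mean {Ω : Type*} [MeasurableSpace Ω] {μ : Measure Ω} [IsProbabilityMeasure μ]
    {x : Ω → ℝ} {a : ℝ} (h : L2 μ x a) : ∫ ω, x ω ∂μ ≤ a := by
  have h1 := variance_nonneg x μ
  rw [variance_eq_sub h.2.1] at h1
  have h2 := h.2.2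
  simp only [Pi.pow_apply] at h1
  exact le_of_abs_le (abs_le_of_sq_le_sq (by linarith) h.1)

/-- The Gaussian coordinates, extended by zero to `ℤ`. -/
def zz (n : ℕ) : ℤ → (Fin n → ℝ) → ℝ := fun t ω => if 0 ≤ t then pad ω t.toNat else 0

instance (n : ℕ) (σ : ℝ) : IsProbabilityMeasure (gaussVec n σ) := by
  unfold gaussVec; infer_instance

lemma memLp_coord (n : ℕ) (i : Fin n) : MemLp (fun ω : Fin n → ℝ => ω i) 2 (gaussVec n 1) := by
  have := (memLp_id_gaussianReal (μ := 0) (v := ((1:ℝ) ^ 2).toNNReal) 2)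
  have h2 := this.comp_measurePreserving
    (measurePreserving_eval (fun _ : Fin n => gaussianReal 0 ((1:ℝ) ^ 2).toNNReal) i)
  simpa [gaussVec, Function.comp_def] using h2

lemma int_coord (n : ℕ) (i : Fin n) : ∫ ω, ω i ∂gaussVec n 1 = 0 := by
  have h := (measurePreserving_eval (fun _ : Fin n => gaussianReal 0 ((1:ℝ) ^ 2).toNNReal) i)
  have := integral_map (μ := gaussVec n 1) (φ := Function.eval i) (f := fun x : ℝ => x)
    (measurable_pi_apply i).aemeasurable (by fun_prop)
  unfold gaussVec at this ⊢
  rw [h.map_eq, integral_id_gaussianReal] at this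
  exact this.symm

lemma int_coord_sq (n : ℕ) (i : Fin n) : ∫ ω, ω i * ω i ∂gaussVec n 1 = 1 := by
  have h := (measurePreserving_eval (fun _ : Fin n => gaussianReal 0 ((1:ℝ) ^ 2).toNNReal) i)
  have := integral_map (μ := gaussVec n 1) (φ := Function.eval i) (f := fun x : ℝ => x * x)
    (measurable_pi_apply i).aemeasurable (by fun_prop)
  have hv := variance_id_gaussianReal (μ := 0) (v := ((1:ℝ) ^ 2).toNNReal)
  rw [variance_eq_integral aemeasurable_id] at hv
  simp only [id, integral_id_gaussianReal, sub_zero] at hv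
  unfold gaussVec at this ⊢
  rw [h.map_eq] at this
  simp only [Function.eval] at this
  rw [← this]
  simp only [← sq]
  rw [hv]; simp

lemma int_coord_mul (n : ℕ) (i j : Fin n) :
    ∫ ω, ω i * ω j ∂gaussVec n 1 = if i = j then 1 else 0 := by
  split_ifs with h
  · subst h; exact int_coord_sq n i
  · have h1 : iIndepFun (fun (i : Fin n) (ω : Fin n → ℝ) => ω i) (gaussVec n 1) :=
      iIndepFun_pi (X := fun _ x => x) (fun _ => aemeasurable_id)
    have := (h1.indepFun h).integral_mul_eq_mul_integral (memLp_coord n i).1 (memLp_coord n j).1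
    rw [int_coord, zero_mul] at this
    exact this

lemma memLp_zz (n : ℕ) (t : ℤ) : MemLp (zz n t) 2 (gaussVec n 1) := by
  by_cases h : 0 ≤ t ∧ t.toNat < n
  · have : zz n t = fun ω => ω ⟨t.toNat, h.2⟩ := by ext ω; simp [zz, pad, h.1, h.2]
    rw [this]; exact memLp_coord n _
  · have : zz n t = 0 := by
      ext ω; simp only [zz, pad]; split_ifs <;> simp_all
    rw [this]; exact MemLp.zero

lemma int_zz (n : ℕ) (s t : ℤ) :
    ∫ ω, zz n s ω * zz n t ω ∂gaussVec n 1 = if s = t ∧ 0 ≤ t ∧ t.toNat < n then 1 else 0 := by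
  by_cases hs : 0 ≤ s ∧ s.toNat < n
  · by_cases ht : 0 ≤ t ∧ t.toNat < n
    · have h1 : zz n s = fun ω => ω ⟨s.toNat, hs.2⟩ := by ext ω; simp [zz, pad, hs.1, hs.2]
      have h2 : zz n t = fun ω => ω ⟨t.toNat, ht.2⟩ := by ext ω; simp [zz, pad, ht.1, ht.2]
      rw [h1, h2, int_coord_mul]
      refine if_congr ?_ rfl rfl
      simp only [Fin.mk.injEq]
      omega
    · have : zz n t = 0 := by
        ext ω; simp only [zz, pad]; split_ifs <;> simp_all
      rw [this, if_neg (by tauto)]; simp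
  · have : zz n s = 0 := by
      ext ω; simp only [zz, pad]; split_ifs <;> simp_all
    rw [this, if_neg (by rintro ⟨rfl, h⟩; exact hs h)]; simp

lemma L2_lin (n w : ℕ) (t : ℤ) (c : ℕ → ℝ) (a : ℝ) (ha : 0 ≤ a)
    (hc : ∑ i ∈ Finset.range w, c i ^ 2 ≤ a ^ 2) :
    L2 (gaussVec n 1) (∑ i ∈ Finset.range w, c i • zz n (t - i)) a := by
  refine ⟨ha, memLp_finsetSum' _ fun i _ => (memLp_zz n _).const_smul _, ?_⟩
  have h1 : ∀ ω, ((∑ i ∈ Finset.range w, c i • zz n (t - i)) ω) ^ 2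
      = ∑ i ∈ Finset.range w, ∑ j ∈ Finset.range w,
        (c i * c j) * (zz n (t - i) ω * zz n (t - j) ω) := by
    intro ω
    rw [sq, Finset.sum_apply, Finset.sum_mul_sum]
    refine Finset.sum_congr rfl fun i _ => Finset.sum_congr rfl fun j _ => ?_
    simp only [Pi.smul_apply, smul_eq_mul]; ring
  simp only [h1]
  have hi : ∀ i j : ℕ, Integrable (fun ω => (c i * c j) * (zz n (t - i) ω * zz n (t - j) ω))
      (gaussVec n 1) := fun i j => ((memLp_zz n _).integrable_mul (memLp_zz n _)).const_mul _
  rw [integral_finsetSum _ fun i _ => integrable_finsetSum _ fun j _ => hi i j]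
  refine le_trans (Finset.sum_le_sum fun i hi' => ?_) hc
  rw [integral_finsetSum _ fun j _ => hi i j]
  simp only [integral_const_mul, int_zz]
  rw [Finset.sum_eq_single i]
  · split_ifs
    · linarith [sq (c i)]
    · rw [mul_zero]; positivity
  · intro j _ hj
    rw [if_neg (by omega), mul_zero]
  · intro h; exact absurd hi' h

lemma ub_z (n : ℕ) : UB (L2 (gaussVec n 1)) (zz n) 1 := fun t => by
  have := L2_lin n 1 t (fun _ => 1) 1 zero_le_one (by simp)
  simpa using this

lemma ub_Az (n : ℕ) {w : ℕ} (hw : 0 < w) :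
    UB (L2 (gaussVec n 1)) (Aop w (zz n)) (Real.sqrt w)⁻¹ := fun t => by
  have hw' : (0:ℝ) < w := by positivity
  have := L2_lin n w t (fun _ => (w:ℝ)⁻¹) (Real.sqrt w)⁻¹ (by positivity) (by
    simp only [Finset.sum_const, Finset.card_range, nsmul_eq_mul, inv_pow]
    rw [Real.sq_sqrt hw'.le]
    field_simp; rfl)
  rw [Aop_apply, Finset.smul_sum]; exact this

lemma ub_Rz (n : ℕ) {w : ℕ} (hw : 0 < w) :
    UB (L2 (gaussVec n 1)) (Rop w (zz n)) (Real.sqrt w) := fun t => by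
  have hw' : (0:ℝ) < w := by positivity
  have := L2_lin n w t (fun i => -(w:ℝ)⁻¹ * ((w:ℝ) - 1 - i)) (Real.sqrt w) (by positivity) (by
    rw [Real.sq_sqrt hw'.le]
    have : ∀ i ∈ Finset.range w, (-(w:ℝ)⁻¹ * ((w:ℝ) - 1 - i)) ^ 2 ≤ 1 := by
      intro i hi
      have h1 : (i:ℝ) + 1 ≤ w := by exact_mod_cast Finset.mem_range.1 hi
      have h0 : (0:ℝ) ≤ i := by positivity
      rw [mul_pow, neg_sq, inv_pow, inv_mul_le_one₀ (by positivity)]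
      exact pow_le_pow_left₀ (by linarith) (by linarith) 2
    refine (Finset.sum_le_sum this).trans ?_
    simp)
  rw [Rop_apply, Finset.smul_sum]
  simpa only [smul_smul] using this

end TF

namespace TF

lemma A_pow_eval {Ω : Type*} (w j : ℕ) (F : ℤ → Ω → ℝ) (t : ℤ) (ω : Ω) :
    (Aop w ^ j : Module.End ℝ (ℤ → Ω → ℝ)) F t ω
      = (Aop w ^ j : Module.End ℝ (ℤ → ℝ)) (fun t => F t ω) t := by
  induction j generalizing t with
  | zero => simp
  | succ j ih =>
    rw [pow_succ', Module.End.mul_apply, Aop_apply, pow_succ', Module.End.mul_apply, Aop_apply]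
    simp [ih]

lemma d_pow_eval {Ω : Type*} (j : ℕ) (F : ℤ → Ω → ℝ) (t : ℤ) (ω : Ω) :
    (dop ^ j : Module.End ℝ (ℤ → Ω → ℝ)) F t ω
      = (dop ^ j : Module.End ℝ (ℤ → ℝ)) (fun t => F t ω) t := by
  induction j generalizing t with
  | zero => simp
  | succ j ih =>
    rw [pow_succ', Module.End.mul_apply, dop_apply, pow_succ', Module.End.mul_apply, dop_apply]
    simp [ih]

/-- The process `R^{r-1} z`. -/
def yy (r n w : ℕ) : ℤ → (Fin n → ℝ) → ℝ :=
  (Rop w ^ (r - 1) : Module.End ℝ (ℤ → (Fin n → ℝ) → ℝ)) (zz n)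

/-- The process `R^r z`. -/
def ze (r n w : ℕ) : ℤ → (Fin n → ℝ) → ℝ :=
  (Rop w ^ r : Module.End ℝ (ℤ → (Fin n → ℝ) → ℝ)) (zz n)

/-- Local majorant. -/
def YY (r n w : ℕ) : ℤ → (Fin n → ℝ) → ℝ := fun t =>
  ∑ j ∈ Finset.range ((r + 1) * w + 1), fun ω => |yy r n w (t + r * w - j) ω|

/-- Signed smoothed majorant. -/
def MM (r n w : ℕ) (lab : ℤ → ℝ) : ℤ → (Fin n → ℝ) → ℝ :=
  (Aop w ^ r : Module.End ℝ (ℤ → (Fin n → ℝ) → ℝ)) (fun t => lab t • YY r n w t)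

/-- The corrected local primitive of the noise. -/
def gg (r n w : ℕ) (lab : ℤ → ℝ) : ℤ → (Fin n → ℝ) → ℝ := ze r n w - MM r n w lab

lemma ub_Rpow_z (n : ℕ) {w : ℕ} (hw : 0 < w) {m : ℕ} (hm : 1 ≤ m) :
    UB (L2 (gaussVec n 1)) ((Rop w ^ m : Module.End ℝ (ℤ → (Fin n → ℝ) → ℝ)) (zz n))
      (w ^ m / Real.sqrt w) := by
  obtain ⟨m, rfl⟩ : ∃ m', m = m' + 1 := ⟨m - 1, by omega⟩
  have hw' : (0:ℝ) < w := by positivity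
  rw [pow_succ, Module.End.mul_apply]
  have h := (siz_L2 (gaussVec n 1)).ubR_pow hw (ub_Rz n hw) m
  have : (w:ℝ) ^ (m+1) / Real.sqrt w = w ^ m * Real.sqrt w := by
    rw [div_eq_iff (by positivity), mul_assoc, Real.mul_self_sqrt hw'.le, pow_succ]
  rw [this]; exact h

lemma ub_d_ze (r n : ℕ) {w : ℕ} (hw : 0 < w) {m : ℕ} (hm : 1 ≤ m) (hmr : m ≤ r) :
    UB (L2 (gaussVec n 1)) ((dop ^ (r - m) : Module.End ℝ (ℤ → (Fin n → ℝ) → ℝ)) (ze r n w))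
      (2 ^ r * (w ^ m / Real.sqrt w)) := by
  have h0 : (dop ^ (r - m) : Module.End ℝ (ℤ → (Fin n → ℝ) → ℝ)) (ze r n w)
      = ((1 - Aop w) ^ (r - m) : Module.End ℝ (ℤ → (Fin n → ℝ) → ℝ))
        ((Rop w ^ m : Module.End ℝ (ℤ → (Fin n → ℝ) → ℝ)) (zz n)) := by
    rw [← one_sub_A hw, (comm_d_R w).mul_pow, ze, ← Module.End.mul_apply, ← Module.End.mul_apply,
      mul_assoc, ← pow_add, Nat.sub_add_cancel hmr]
  rw [h0]
  have := (siz_L2 (gaussVec n 1)).ub1A_pow hw (ub_Rpow_z n hw hm) (r - m)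
  refine fun t => (siz_L2 _).mono (this t) ?_
  gcongr
  · norm_num
  · omega

lemma ub_d_ze0 (r n : ℕ) {w : ℕ} (hw : 0 < w) :
    UB (L2 (gaussVec n 1)) ((dop ^ r : Module.End ℝ (ℤ → (Fin n → ℝ) → ℝ)) (ze r n w) - zz n)
      (2 ^ r * (Real.sqrt w)⁻¹) := by
  have h0 : (dop ^ r : Module.End ℝ (ℤ → (Fin n → ℝ) → ℝ)) (ze r n w)
      = ((1 - Aop w) ^ r : Module.End ℝ (ℤ → (Fin n → ℝ) → ℝ)) (zz n) := by
    rw [← one_sub_A hw, (comm_d_R w).mul_pow, ze, ← Module.End.mul_apply]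
  rw [h0]
  exact (siz_L2 (gaussVec n 1)).ub_rem hw (ub_Az n hw) r

lemma ub_yy (r n : ℕ) (hr : 2 ≤ r) {w : ℕ} (hw : 0 < w) :
    UB (L2 (gaussVec n 1)) (yy r n w) (w ^ (r - 1) / Real.sqrt w) :=
  ub_Rpow_z n hw (by omega)

lemma ub_YY (r n : ℕ) (hr : 2 ≤ r) {w : ℕ} (hw : 0 < w) :
    UB (L2 (gaussVec n 1)) (YY r n w) ((r + 2) * (w ^ r / Real.sqrt w)) := fun t => by
  have hw' : (1:ℝ) ≤ w := by exact_mod_cast hw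
  have := (siz_L2 (gaussVec n 1)).sum (Finset.range ((r + 1) * w + 1))
    (x := fun j ω => |yy r n w (t + r * w - j) ω|) (a := fun _ => w ^ (r - 1) / Real.sqrt w)
    (fun j _ => L2_abs (ub_yy r n hr hw _))
  refine (siz_L2 _).mono this ?_
  rw [Finset.sum_const, Finset.card_range, nsmul_eq_mul]
  push_cast
  obtain ⟨m, rfl⟩ : ∃ m', r = m' + 1 := ⟨r - 1, by omega⟩
  simp only [Nat.add_sub_cancel]
  have h3 : (w:ℝ) ^ (m+1) / Real.sqrt w = w * (w ^ m / Real.sqrt w) := by ring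
  rw [h3, ← mul_assoc]
  gcongr
  push_cast
  nlinarith

lemma ub_d_MM (r n : ℕ) (hr : 2 ≤ r) {w : ℕ} (hw : 0 < w) (lab : ℤ → ℝ) (hlab : ∀ t, |lab t| ≤ 1)
    {m : ℕ} (hmr : m ≤ r) :
    UB (L2 (gaussVec n 1)) ((dop ^ (r - m) : Module.End ℝ (ℤ → (Fin n → ℝ) → ℝ)) (MM r n w lab))
      (2 ^ r * (r + 2) * (w ^ m / Real.sqrt w)) := by
  have hw' : (1:ℝ) ≤ w := by exact_mod_cast hw
  have h1 : UB (L2 (gaussVec n 1)) (fun t => lab t • YY r n w t)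
      ((r + 2) * (w ^ r / Real.sqrt w)) := fun t =>
    (siz_L2 _).mono ((siz_L2 _).smul (lab t) (ub_YY r n hr hw t))
      (mul_le_of_le_one_left (by positivity) (hlab t))
  have h2 := (siz_L2 (gaussVec n 1)).ub_d_A hw h1 (Nat.sub_le r m)
  refine fun t => (siz_L2 _).mono (h2 t) ?_
  have h3 : (w:ℝ) ^ r = w ^ (r - m) * w ^ m := by rw [← pow_add, Nat.sub_add_cancel hmr]
  rw [h3, div_pow]
  have h4 : (2:ℝ) ^ (r - m) / w ^ (r - m) * ((r + 2) * (w ^ (r - m) * w ^ m / Real.sqrt w))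
     = 2 ^ (r - m) * (r + 2) * (w ^ m / Real.sqrt w) := by
    field_simp
  rw [h4]
  gcongr
  · norm_num
  · omega

lemma main_size (r n : ℕ) (hr : 2 ≤ r) {w : ℕ} (hw : 0 < w) (lab : ℤ → ℝ) (hlab : ∀ t, |lab t| ≤ 1)
    (φ : ℤ → ℝ) (t : ℤ) (α : ℝ)
    (hφ : ∀ m ≤ r, |(dop ^ m : Module.End ℝ (ℤ → ℝ)) φ t| ≤ α / w ^ m) :
    L2 (gaussVec n 1) ((dop ^ r : Module.End ℝ (ℤ → (Fin n → ℝ) → ℝ))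
        (fun t => φ t • gg r n w lab t) t - φ t • zz n t)
      (4 ^ r * (r + 3) * α / Real.sqrt w) := by
  have hw' : (0:ℝ) < w := by positivity
  have S := siz_L2 (gaussVec n 1)
  have hα : |φ t| ≤ α := by simpa using hφ 0 (Nat.zero_le _)
  have hα0 := (abs_nonneg _).trans hα
  have h1 := S.leibniz r φ (gg r n w lab) t α (2 ^ r * (r + 3) / Real.sqrt w) w hw' hφ (by
    intro m hm hmr t
    rw [gg, map_sub]
    refine S.mono (S.sub (ub_d_ze r n hw hm hmr t) (ub_d_MM r n hr hw lab hlab hmr t)) (le_of_eq ?_)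
    ring)
  have h2 : L2 (gaussVec n 1) (φ t • ((dop ^ r : Module.End ℝ (ℤ → (Fin n → ℝ) → ℝ))
      (gg r n w lab) t - zz n t)) (α * (2 ^ r * (r + 3) / Real.sqrt w)) := by
    have h3 := ub_d_MM r n hr hw lab hlab (Nat.zero_le r) t
    rw [Nat.sub_zero] at h3
    have h4 := S.smul (φ t) (S.sub (ub_d_ze0 r n hw t) h3)
    refine S.mono (x := _) ?_ (mul_le_mul_of_nonneg_right hα (by positivity))
    convert h4 using 1
    · rw [gg, map_sub]; congr 1
      simp only [Pi.sub_apply]; abel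
    · ring
  have h3 := S.add h1 h2
  convert h3 using 1
  · rw [smul_sub]; abel
  · rw [show (4:ℝ) = 2 * 2 by norm_num, mul_pow]; ring

lemma ze_le (r n : ℕ) (hr : 1 ≤ r) {w : ℕ} (hw : 0 < w) (t a : ℤ) (ha : 0 ≤ a) (ha' : a ≤ r * w)
    (ω : Fin n → ℝ) : |ze r n w t ω| ≤ YY r n w (t - a) ω := by
  have hw' : (0:ℝ) < w := by positivity
  have h0 : ze r n w = Rop w (yy r n w) := by
    rw [ze, yy, ← Module.End.mul_apply, ← pow_succ', Nat.sub_add_cancel hr]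
  rw [h0, Rop_apply]
  have h1 : |((-(w : ℝ)⁻¹) • ∑ i ∈ Finset.range w, ((w : ℝ) - 1 - i) • yy r n w (t - i)) ω|
      ≤ ∑ i ∈ Finset.range w, |yy r n w (t - i) ω| := by
    rw [Finset.smul_sum, Finset.sum_apply]
    refine (Finset.abs_sum_le_sum_abs _ _).trans (Finset.sum_le_sum fun i hi => ?_)
    have h1 : (i:ℝ) + 1 ≤ w := by exact_mod_cast Finset.mem_range.1 hi
    have h0 : (0:ℝ) ≤ i := by positivity
    rw [smul_smul, Pi.smul_apply, smul_eq_mul, abs_mul]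
    refine mul_le_of_le_one_left (abs_nonneg _) ?_
    rw [abs_mul, abs_neg, abs_of_pos (by positivity : (0:ℝ) < (w:ℝ)⁻¹),
      inv_mul_le_one₀ (by positivity), abs_of_nonneg (by linarith)]
    linarith
  refine h1.trans ?_
  rw [YY, Finset.sum_apply]
  obtain ⟨b, hb⟩ : ∃ b : ℕ, (b:ℤ) = r * w - a := ⟨(r * w - a).toNat, by omega⟩
  have h2 : ∑ i ∈ Finset.range w, |yy r n w (t - i) ω|
      = ∑ j ∈ (Finset.range w).image (fun i => b + i), |yy r n w (t - a + r * w - j) ω| := by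
    rw [Finset.sum_image (by intro x _ y _ h; simpa using h)]
    refine Finset.sum_congr rfl fun i _ => ?_
    rw [show t - (i:ℤ) = t - a + r * w - ((b + i : ℕ) : ℤ) by push_cast; rw [hb]; ring]
  rw [h2]
  refine Finset.sum_le_sum_of_subset_of_nonneg ?_ fun _ _ _ => abs_nonneg _
  intro j hj
  simp only [Finset.mem_image, Finset.mem_range] at hj ⊢
  obtain ⟨i, hi, rfl⟩ := hj
  have : b ≤ r * w := by zify; omega
  nlinarith

lemma YY_nonneg (r n w : ℕ) (t : ℤ) (ω : Fin n → ℝ) : 0 ≤ YY r n w t ω := by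
  rw [YY, Finset.sum_apply]; exact Finset.sum_nonneg fun _ _ => abs_nonneg _

lemma YY_le (r n w : ℕ) (J : Finset ℤ) (t : ℤ)
    (h : Finset.Icc (t - w) (t + r * w) ⊆ J) (ω : Fin n → ℝ) :
    YY r n w t ω ≤ Real.sqrt (((r + 1) * w + 1) * ∑ t' ∈ J, yy r n w t' ω ^ 2) := by
  refine Real.le_sqrt_of_sq_le ?_
  rw [YY, Finset.sum_apply]
  have h1 := sq_sum_le_card_mul_sum_sq (s := Finset.range ((r + 1) * w + 1))
    (f := fun j : ℕ => |yy r n w (t + r * w - j) ω|)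
  refine h1.trans ?_
  rw [Finset.card_range]
  push_cast
  refine mul_le_mul_of_nonneg_left ?_ (by positivity)
  simp only [sq_abs]
  have h2 : ∑ i ∈ Finset.range ((r + 1) * w + 1), yy r n w (t + r * w - i) ω ^ 2
      = ∑ j ∈ (Finset.range ((r + 1) * w + 1)).image (fun i : ℕ => t + r * w - i), yy r n w j ω ^ 2 := by
    rw [Finset.sum_image (by intro x _ y _ h; simpa using h)]
  rw [h2]
  refine Finset.sum_le_sum_of_subset_of_nonneg ?_ fun _ _ _ => sq_nonneg _
  intro j hj
  apply h
  simp only [Finset.mem_image, Finset.mem_range, Finset.mem_Icc] at hj ⊢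
  obtain ⟨i, hi, rfl⟩ := hj
  constructor
  · have : (i:ℤ) ≤ (r + 1) * w := by exact_mod_cast Nat.lt_succ_iff.1 hi
    linarith
  · omega

lemma gg_sign (r n : ℕ) (hr : 1 ≤ r) {w : ℕ} (hw : 0 < w) (lab : ℤ → ℝ) (t : ℤ) (sg : ℝ)
    (hsg : sg = 1 ∨ sg = -1)
    (h : ∀ a : ℤ, 0 ≤ a → a ≤ r * ((w : ℤ) - 1) → lab (t - a) = sg) (ω : Fin n → ℝ) :
    sg * gg r n w lab t ω ≤ 0 := by
  have key : ∀ a : ℤ, 0 ≤ a → a ≤ r * ((w : ℤ) - 1) → |ze r n w t ω| ≤ YY r n w (t - a) ω :=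
    fun a h0 h1 => ze_le r n hr hw t a h0 (h1.trans (by nlinarith)) ω
  have h1 : MM r n w lab t ω ∈ {x : ℝ | |ze r n w t ω| ≤ sg * x} := by
    rw [MM, A_pow_eval]
    refine A_pow_mem hw _ ?_ r _ t ?_
    · exact convex_halfSpace_ge (IsLinearMap.mk (by intros; ring) (by intros; simp; ring)) _
    · intro a h0 h1
      simp only [Set.mem_ofPred_eq, Pi.smul_apply, smul_eq_mul, h a h0 h1]
      have := key a h0 h1
      rcases hsg with rfl | rfl <;> simpa using this
  have h2 : gg r n w lab t ω = ze r n w t ω - MM r n w lab t ω := rfl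
  rw [h2, mul_sub, sub_nonpos]
  refine le_trans ?_ h1
  rcases hsg with rfl | rfl
  · simpa using le_abs_self _
  · simpa using neg_le_abs _

lemma gg_abs (r n : ℕ) (hr : 1 ≤ r) {w : ℕ} (hw : 0 < w) (lab : ℤ → ℝ) (hlab : ∀ t, |lab t| ≤ 1)
    (J : Finset ℤ) (t : ℤ)
    (h : Finset.Icc (t - (r + 1) * w) (t + r * w) ⊆ J) (ω : Fin n → ℝ) :
    |gg r n w lab t ω| ≤ 2 * Real.sqrt (((r + 1) * w + 1) * ∑ t' ∈ J, yy r n w t' ω ^ 2) := by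
  set K := Real.sqrt (((r + 1) * w + 1) * ∑ t' ∈ J, yy r n w t' ω ^ 2)
  have key : ∀ a : ℤ, 0 ≤ a → a ≤ r * ((w : ℤ) - 1) → YY r n w (t - a) ω ≤ K := by
    intro a h0 h1
    refine YY_le r n w J _ (Finset.Subset.trans ?_ h) ω
    refine Finset.Icc_subset_Icc ?_ ?_ <;> nlinarith
  have h1 : MM r n w lab t ω ∈ Set.Icc (-K) K := by
    rw [MM, A_pow_eval]
    refine A_pow_mem hw _ (convex_Icc _ _) r _ t ?_
    intro a h0 h1
    rw [Set.mem_Icc, ← abs_le, Pi.smul_apply, smul_eq_mul, abs_mul, abs_of_nonneg (YY_nonneg _ _ _ _ _)]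
    exact (mul_le_of_le_one_left (YY_nonneg _ _ _ _ _) (hlab _)).trans (key a h0 h1)
  have h2 : gg r n w lab t ω = ze r n w t ω - MM r n w lab t ω := rfl
  have h3 := ze_le r n hr hw t 0 le_rfl (by positivity) ω
  have h4 := key 0 le_rfl (by have : (1:ℤ) ≤ w := by exact_mod_cast hw
                              nlinarith)
  rw [h2]
  refine (abs_sub _ _).trans ?_
  have := abs_le.2 ⟨h1.1, h1.2⟩
  linarith

end TF

namespace TF

open Classical in
/-- Signed label function. -/
def lab (a b : ℤ) (Pos Neg : Finset ℤ) (t : ℤ) : ℝ :=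
  if ∃ l ∈ Pos, t - a ≤ l ∧ l ≤ t + b then 1
  else if ∃ l ∈ Neg, t - a ≤ l ∧ l ≤ t + b then -1 else 0

lemma lab_abs (a b : ℤ) (Pos Neg : Finset ℤ) (t : ℤ) : |lab a b Pos Neg t| ≤ 1 := by
  unfold lab; split_ifs <;> simp

/-- Separation assumptions on the knots. -/
structure Sep (Pos Neg : Finset ℤ) (N : ℕ) (ρ : ℤ) : Prop where
  nonneg : 0 ≤ ρ
  sep : ∀ l ∈ Pos, ∀ l' ∈ Neg, 3 * ρ < |l - l'|
  posl : ∀ l ∈ Pos, ρ ≤ l ∧ l + ρ < N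
  negl : ∀ l ∈ Neg, ρ ≤ l ∧ l + ρ < N

/-- The base function. -/
def u00 (r w : ℕ) (Pos Neg : Finset ℤ) : ℤ → ℝ :=
  (Aop w ^ r : Module.End ℝ (ℤ → ℝ)) (lab 0 (r * ((w:ℤ) - 1)) Pos Neg)

lemma u00_const {r w : ℕ} (hw : 0 < w) {Pos Neg : Finset ℤ} {t : ℤ} {c : ℝ}
    (h : ∀ a : ℤ, 0 ≤ a → a ≤ r * ((w:ℤ) - 1) → lab 0 (r * ((w:ℤ) - 1)) Pos Neg (t - a) = c) :
    u00 r w Pos Neg t = c :=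
  A_pow_mem hw {c} (convex_singleton c) r _ t h

lemma u00_pos {r w N : ℕ} (hw : 0 < w) {Pos Neg : Finset ℤ}
    (_hs : Sep Pos Neg N (r * ((w:ℤ) - 1))) {l : ℤ} (hl : l ∈ Pos) : u00 r w Pos Neg l = 1 := by
  refine u00_const hw fun a h0 h1 => ?_
  unfold lab
  rw [if_pos ⟨l, hl, by omega, by omega⟩]

lemma u00_neg {r w N : ℕ} (hw : 0 < w) {Pos Neg : Finset ℤ}
    (hs : Sep Pos Neg N (r * ((w:ℤ) - 1))) {l : ℤ} (hl : l ∈ Neg) : u00 r w Pos Neg l = -1 := by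
  refine u00_const hw fun a h0 h1 => ?_
  unfold lab
  rw [if_neg, if_pos ⟨l, hl, by omega, by omega⟩]
  rintro ⟨l', hl', h2, h3⟩
  have := hs.sep l' hl' l hl
  have h4 := hs.nonneg
  rcases abs_cases (l' - l) with ⟨h, _⟩ | ⟨h, _⟩ <;> omega

lemma u00_out {r w N : ℕ} (hw : 0 < w) {Pos Neg : Finset ℤ}
    (hs : Sep Pos Neg N (r * ((w:ℤ) - 1))) {t : ℤ} (ht : t < 0 ∨ (N:ℤ) ≤ t) :
    u00 r w Pos Neg t = 0 := by
  refine u00_const hw fun a h0 h1 => ?_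
  unfold lab
  rw [if_neg, if_neg]
  · rintro ⟨l, hl, h2, h3⟩
    have := hs.negl l hl
    omega
  · rintro ⟨l, hl, h2, h3⟩
    have := hs.posl l hl
    omega

lemma u00_cases {r w N : ℕ} (hw : 0 < w) {Pos Neg : Finset ℤ}
    (hs : Sep Pos Neg N (r * ((w:ℤ) - 1))) (t : ℤ) :
    u00 r w Pos Neg t = 0 ∨ ∃ sg : ℝ, (sg = 1 ∨ sg = -1) ∧ 0 ≤ sg * u00 r w Pos Neg t ∧
      sg * u00 r w Pos Neg t ≤ 1 ∧ ∀ a : ℤ, 0 ≤ a → a ≤ r * ((w:ℤ) - 1) →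
        lab (r * ((w:ℤ) - 1)) (2 * (r * ((w:ℤ) - 1))) Pos Neg (t - a) = sg := by
  have hn := hs.nonneg
  by_cases hp : ∃ l ∈ Pos, t - (r * ((w:ℤ) - 1)) ≤ l ∧ l ≤ t + (r * ((w:ℤ) - 1))
  · right
    obtain ⟨l, hl, hl1, hl2⟩ := hp
    have key : u00 r w Pos Neg t ∈ Set.Icc (0:ℝ) 1 := by
      refine A_pow_mem hw _ (convex_Icc _ _) r _ t fun a h0 h1 => ?_
      unfold lab
      split_ifs with h2 h3
      · simp
      · exfalso
        obtain ⟨l', hl', h4, h5⟩ := h3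
        have := hs.sep l hl l' hl'
        rcases abs_cases (l - l') with ⟨h, _⟩ | ⟨h, _⟩ <;> omega
      · simp
    refine ⟨1, Or.inl rfl, by simpa using key.1, by simpa using key.2, fun a h0 h1 => ?_⟩
    unfold lab
    rw [if_pos ⟨l, hl, by omega, by omega⟩]
  · by_cases hq : ∃ l ∈ Neg, t - (r * ((w:ℤ) - 1)) ≤ l ∧ l ≤ t + (r * ((w:ℤ) - 1))
    · right
      obtain ⟨l, hl, hl1, hl2⟩ := hq
      have key : u00 r w Pos Neg t ∈ Set.Icc (-1:ℝ) 0 := by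
        refine A_pow_mem hw _ (convex_Icc _ _) r _ t fun a h0 h1 => ?_
        unfold lab
        split_ifs with h2 h3
        · exfalso
          obtain ⟨l', hl', h4, h5⟩ := h2
          have := hs.sep l' hl' l hl
          rcases abs_cases (l' - l) with ⟨h, _⟩ | ⟨h, _⟩ <;> omega
        · simp
        · simp
      refine ⟨-1, Or.inr rfl, by linarith [key.2], by linarith [key.1], fun a h0 h1 => ?_⟩
      unfold lab
      rw [if_neg, if_pos ⟨l, hl, by omega, by omega⟩]
      rintro ⟨l', hl', h4, h5⟩
      have := hs.sep l' hl' l hl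
      rcases abs_cases (l' - l) with ⟨h, _⟩ | ⟨h, _⟩ <;> omega
    · left
      refine u00_const hw fun a h0 h1 => ?_
      unfold lab
      rw [if_neg, if_neg]
      · rintro ⟨l, hl, h2, h3⟩
        exact hq ⟨l, hl, by omega, by omega⟩
      · rintro ⟨l, hl, h2, h3⟩
        exact hp ⟨l, hl, by omega, by omega⟩

lemma u00_d (r : ℕ) {w : ℕ} (hw : 0 < w) (Pos Neg : Finset ℤ) (t : ℤ) :
    |(dop ^ r : Module.End ℝ (ℤ → ℝ)) (u00 r w Pos Neg) t| ≤ (2 / w) ^ r := by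
  have := siz_abs.ub_d_A hw (f := lab 0 (r * ((w:ℤ) - 1)) Pos Neg) (a := 1)
    (fun t => lab_abs _ _ _ _ t) (le_refl r) t
  simpa [u00] using this

/-! Cutoffs. -/

open Classical in
/-- Indicator of points far from bad points at scale `2^s`. -/
def farI (r : ℕ) (Bad : ℤ → Prop) (s : ℕ) (t : ℤ) : ℝ :=
  if ∀ b, Bad b → 4 * (r * 2 ^ s) < |t - b| then 1 else 0

/-- Smoothed cutoff. -/
def chi (r : ℕ) (Bad : ℤ → Prop) (s : ℕ) : ℤ → ℝ :=
  (Aop (2 ^ s) ^ r : Module.End ℝ (ℤ → ℝ)) (farI r Bad s)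

/-- Partition functions. -/
def phi (r : ℕ) (Bad : ℤ → Prop) (S s : ℕ) : ℤ → ℝ :=
  if s < S then chi r Bad s - chi r Bad (s + 1) else chi r Bad s

/-- Points close to bad points. -/
def near (r : ℕ) (Bad : ℤ → Prop) (s : ℕ) (t : ℤ) : Prop := ∃ b, Bad b ∧ |t - b| ≤ 12 * (r * 2 ^ s)

lemma farI_mem (r : ℕ) (Bad : ℤ → Prop) (s : ℕ) (t : ℤ) : farI r Bad s t ∈ Set.Icc (0:ℝ) 1 := by
  unfold farI; split_ifs <;> simp

lemma chi_mem (r : ℕ) (Bad : ℤ → Prop) (s : ℕ) (t : ℤ) : chi r Bad s t ∈ Set.Icc (0:ℝ) 1 :=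
  A_pow_mem (by positivity) _ (convex_Icc _ _) r _ t fun _ _ _ => farI_mem _ _ _ _

lemma chi_bad {r : ℕ} (hr : 1 ≤ r) {Bad : ℤ → Prop} (s : ℕ) {t : ℤ} (ht : Bad t) :
    chi r Bad s t = 0 := by
  refine A_pow_mem (by positivity) {0} (convex_singleton _) r _ t fun a h0 h1 => ?_
  have h2 : (0:ℤ) < r * 2 ^ s := by positivity
  have h3 : (r:ℤ) * (((2 ^ s : ℕ) : ℤ) - 1) ≤ r * 2 ^ s := by push_cast; nlinarith
  unfold farI
  rw [if_neg]; · rfl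
  intro h
  have := h t ht
  rcases abs_cases (t - a - t) with ⟨h, _⟩ | ⟨h, _⟩ <;> omega

lemma chi_one {r : ℕ} {Bad : ℤ → Prop} (s : ℕ) {t : ℤ}
    (ht : ∀ b, Bad b → 5 * (r * 2 ^ s) < |t - b|) : chi r Bad s t = 1 := by
  refine A_pow_mem (by positivity) {1} (convex_singleton _) r _ t fun a h0 h1 => ?_
  have h2 : (0:ℤ) ≤ r * 2 ^ s := by positivity
  have h3 : (r:ℤ) * (((2 ^ s : ℕ) : ℤ) - 1) ≤ r * 2 ^ s := by push_cast; nlinarith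
  unfold farI
  rw [if_pos]; · rfl
  intro b hb
  have := ht b hb
  rcases abs_cases (t - a - b) with ⟨h, _⟩ | ⟨h, _⟩ <;>
    rcases abs_cases (t - b) with ⟨h', _⟩ | ⟨h', _⟩ <;> omega

lemma chi_succ {r : ℕ} (hr : 1 ≤ r) {Bad : ℤ → Prop} (s : ℕ) {t : ℤ} (ht : chi r Bad (s + 1) t ≠ 0) :
    chi r Bad s t = 1 := by
  refine chi_one s fun b hb => ?_
  by_contra hcon
  refine ht (A_pow_mem (by positivity) {0} (convex_singleton _) r _ t fun a h0 h1 => ?_)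
  have h2 : (0:ℤ) < r * 2 ^ s := by positivity
  have h3 : (r:ℤ) * (((2 ^ (s+1) : ℕ) : ℤ) - 1) ≤ 2 * (r * 2 ^ s) := by
    push_cast; rw [pow_succ]; nlinarith
  have h4 : (r:ℤ) * 2 ^ (s+1) = 2 * (r * 2 ^ s) := by ring
  unfold farI
  rw [if_neg]; · rfl
  intro h
  have := h b hb
  rw [h4] at this
  rcases abs_cases (t - a - b) with ⟨h, _⟩ | ⟨h, _⟩ <;>
    rcases abs_cases (t - b) with ⟨h', _⟩ | ⟨h', _⟩ <;> omega

lemma phi_nonneg {r : ℕ} (hr : 1 ≤ r) (Bad : ℤ → Prop) (S s : ℕ) (t : ℤ) : 0 ≤ phi r Bad S s t := by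
  unfold phi
  split_ifs
  · by_cases h : chi r Bad (s + 1) t = 0
    · simpa [h] using (chi_mem r Bad s t).1
    · simpa [chi_succ hr s h] using (chi_mem r Bad (s+1) t).2
  · exact (chi_mem r Bad s t).1

lemma phi_sum (r : ℕ) (Bad : ℤ → Prop) (S : ℕ) (t : ℤ) :
    ∑ s ∈ Finset.range (S + 1), phi r Bad S s t = chi r Bad 0 t := by
  rw [Finset.sum_range_succ]
  have h1 : ∑ s ∈ Finset.range S, phi r Bad S s t
      = ∑ s ∈ Finset.range S, (chi r Bad s t - chi r Bad (s + 1) t) := by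
    refine Finset.sum_congr rfl fun s hs => ?_
    simp [phi, Finset.mem_range.1 hs]
  rw [h1, Finset.sum_range_sub' (fun s => chi r Bad s t)]
  simp [phi]

lemma phi_bad {r : ℕ} (hr : 1 ≤ r) {Bad : ℤ → Prop} (S s : ℕ) {t : ℤ} (ht : Bad t) :
    phi r Bad S s t = 0 := by
  unfold phi; split_ifs <;> simp [chi_bad hr _ ht]

lemma chi_d (r : ℕ) (Bad : ℤ → Prop) (s : ℕ) (t : ℤ) {m : ℕ} (hm : m ≤ r) :
    |(dop ^ m : Module.End ℝ (ℤ → ℝ)) (chi r Bad s) t| ≤ (2 / 2 ^ s) ^ m := by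
  have := siz_abs.ub_d_A (w := 2 ^ s) (by positivity) (f := farI r Bad s) (a := 1)
    (fun t => by
      have := farI_mem r Bad s t
      show |farI r Bad s t| ≤ 1
      rw [abs_of_nonneg this.1]; exact this.2) hm t
  simpa [chi] using this

lemma phi_d (r : ℕ) (Bad : ℤ → Prop) (S s : ℕ) (t : ℤ) {m : ℕ} (hm : m ≤ r) :
    |(dop ^ m : Module.End ℝ (ℤ → ℝ)) (phi r Bad S s) t| ≤ 2 * 2 ^ r / ((2 ^ s : ℕ) : ℝ) ^ m := by
  have h1 := chi_d r Bad s t hm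
  have h2 := chi_d r Bad (s+1) t hm
  have h3 : ((2:ℝ) / 2 ^ s) ^ m ≤ 2 ^ r / (2 ^ s) ^ m := by
    rw [div_pow]; gcongr; norm_num
  have h4 : ((2:ℝ) / 2 ^ (s+1)) ^ m ≤ ((2:ℝ) / 2 ^ s) ^ m := by
    gcongr
    · norm_num
    · omega
  have h5 : 2 * (2:ℝ) ^ r / ((2 ^ s : ℕ) : ℝ) ^ m = 2 ^ r / (2 ^ s) ^ m + 2 ^ r / (2 ^ s) ^ m := by
    push_cast; ring
  have h6 : (0:ℝ) ≤ 2 ^ r / (2 ^ s) ^ m := by positivity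
  rw [h5]
  unfold phi
  split_ifs
  · rw [map_sub, Pi.sub_apply]
    exact (abs_sub _ _).trans (by linarith)
  · linarith

lemma phi_far {r : ℕ} (Bad : ℤ → Prop) {S s : ℕ} (hs : s < S) {t : ℤ}
    (ht : ¬ near r Bad s t) {m : ℕ} (hm : m ≤ r) :
    (dop ^ m : Module.End ℝ (ℤ → ℝ)) (phi r Bad S s) t = 0 := by
  refine d_pow_zero m _ t fun a h0 h1 => ?_
  have h2 : (r:ℤ) ≤ r * 2 ^ s := by
    have : (1:ℤ) ≤ 2 ^ s := one_le_pow₀ (by norm_num)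
    nlinarith
  have h4 : (r:ℤ) * 2 ^ (s+1) = 2 * (r * 2 ^ s) := by ring
  have key : ∀ b, Bad b → 11 * (r * 2 ^ s) < |t - a - b| := by
    intro b hb
    have : ¬ |t - b| ≤ 12 * (r * 2 ^ s) := fun h => ht ⟨b, hb, h⟩
    rcases abs_cases (t - a - b) with ⟨h, _⟩ | ⟨h, _⟩ <;>
      rcases abs_cases (t - b) with ⟨h', _⟩ | ⟨h', _⟩ <;> omega
  unfold phi
  rw [if_pos hs, Pi.sub_apply, chi_one s, chi_one (s+1), sub_self]
  · intro b hb; have := key b hb; rw [h4]; omega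
  · intro b hb; have := key b hb; omega

lemma chi0_far {r : ℕ} (Bad : ℤ → Prop) {t : ℤ} (ht : ¬ near r Bad 0 t) : chi r Bad 0 t = 1 := by
  refine chi_one 0 fun b hb => ?_
  have : ¬ |t - b| ≤ 12 * (r * 2 ^ 0) := fun h => ht ⟨b, hb, h⟩
  have : (0:ℤ) ≤ r * 2 ^ 0 := by positivity
  omega

/-- Geometric sums over sparse sets. -/
lemma sparse_geom (x : ℝ) (hx0 : 0 ≤ x) (hx : x ≤ 3 / 4) (M : ℕ) : ∀ (a : ℕ → ℝ),
    (∀ s, a s = 0 ∨ a s = 1) →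
    0 ≤ ∑ s ∈ Finset.range M, a s * x ^ s ∧ ∑ s ∈ Finset.range M, a s * x ^ s ≤ 4 ∧
    (∑ s ∈ Finset.range M, a s * x ^ s) ^ 2 ≤ 16 * ∑ s ∈ Finset.range M, a s * (x ^ 2) ^ s := by
  induction M with
  | zero => intro a _; simp
  | succ M ih =>
    intro a ha
    obtain ⟨i0, i1, i2⟩ := ih (fun s => a (s + 1)) (fun s => ha _)
    rw [Finset.sum_range_succ', Finset.sum_range_succ']
    have e1 : ∑ s ∈ Finset.range M, a (s+1) * x ^ (s+1)
        = x * ∑ s ∈ Finset.range M, a (s+1) * x ^ s := by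
      rw [Finset.mul_sum]; exact Finset.sum_congr rfl fun _ _ => by ring
    have e2 : ∑ s ∈ Finset.range M, a (s+1) * (x ^ 2) ^ (s+1)
        = x ^ 2 * ∑ s ∈ Finset.range M, a (s+1) * (x ^ 2) ^ s := by
      rw [Finset.mul_sum]; exact Finset.sum_congr rfl fun _ _ => by ring
    rw [e1, e2]
    set F := ∑ s ∈ Finset.range M, a (s+1) * x ^ s
    set G := ∑ s ∈ Finset.range M, a (s+1) * (x ^ 2) ^ s
    have hF : x * F ≤ 3 := by nlinarith
    have hF0 : 0 ≤ x * F := by positivity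
    have hG : 0 ≤ G := by nlinarith [sq_nonneg F]
    rcases ha 0 with h | h <;> rw [h]
    · refine ⟨by simpa using hF0, by linarith, ?_⟩
      have := mul_le_mul_of_nonneg_left i2 (sq_nonneg x)
      simp only [zero_mul, add_zero]
      nlinarith
    · refine ⟨by simp; linarith, by simp; linarith, ?_⟩
      simp only [pow_zero, mul_one]
      have : 0 ≤ x ^ 2 * G := by positivity
      nlinarith

open Classical in
lemma near_count {r : ℕ} (N : ℕ) (K : Finset ℤ) (s : ℕ) (hr : 1 ≤ r) :
    (((Finset.range (N + r)).filter fun t : ℕ =>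
      near r (fun b => b < 0 ∨ (N:ℤ) ≤ b ∨ b ∈ K) s t).card : ℝ) ≤ 50 * r * (K.card + 1) * 2 ^ s := by
  set ρ : ℕ := 12 * (r * 2 ^ s) with hρ
  have hρr : r ≤ ρ := by
    have : 1 ≤ 2 ^ s := Nat.one_le_two_pow
    nlinarith
  have hρ1 : 1 ≤ r * 2 ^ s := Nat.mul_pos hr (by positivity)
  have hcast : (12 * ((r:ℤ) * 2 ^ s)) = (ρ:ℤ) := by rw [hρ]; push_cast; ring
  have h1 : ((Finset.range (N + r)).filter fun t : ℕ =>
      near r (fun b => b < 0 ∨ (N:ℤ) ≤ b ∨ b ∈ K) s t).image (fun t : ℕ => (t:ℤ)) ⊆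
      (insert (-1) (insert (N:ℤ) K)).biUnion fun b => Finset.Icc (b - ρ) (b + ρ) := by
    intro t ht
    simp only [Finset.mem_image, Finset.mem_filter, Finset.mem_range, Finset.mem_biUnion,
      Finset.mem_insert, Finset.mem_Icc] at ht ⊢
    obtain ⟨t, ⟨ht, b, hb, hd⟩, rfl⟩ := ht
    rw [hcast] at hd
    rw [abs_le] at hd
    rcases hb with hb | hb | hb
    · exact ⟨-1, Or.inl rfl, by omega, by omega⟩
    · exact ⟨N, Or.inr (Or.inl rfl), by omega, by omega⟩
    · exact ⟨b, Or.inr (Or.inr hb), by omega, by omega⟩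
  have h2 := (Finset.card_le_card h1).trans Finset.card_biUnion_le
  rw [Finset.card_image_of_injective _ Nat.cast_injective] at h2
  have h3 : ∀ b : ℤ, (Finset.Icc (b - ρ) (b + ρ)).card = 2 * ρ + 1 := by
    intro b; rw [Int.card_Icc]; omega
  simp only [h3, Finset.sum_const, smul_eq_mul] at h2
  have h4 : (insert (-1) (insert (N:ℤ) K)).card ≤ K.card + 2 := by
    have := Finset.card_insert_le (-1) (insert (N:ℤ) K)
    have := Finset.card_insert_le (N:ℤ) K
    omega
  have h5 : 2 * ρ + 1 ≤ 25 * (r * 2 ^ s) := by omega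
  have h6 := h2.trans (Nat.mul_le_mul (h4.trans (by omega : K.card + 2 ≤ 2 * (K.card + 1))) h5)
  have h7 : 2 * (K.card + 1) * (25 * (r * 2 ^ s)) = 50 * r * (K.card + 1) * 2 ^ s := by ring
  rw [h7] at h6
  exact_mod_cast h6

end TF

namespace TF

/-- Index window. -/
def JJ (r N S : ℕ) : Finset ℤ := Finset.Icc (-((r + 1) * 2 ^ S)) (N + r * 2 ^ S)

/-- Quadratic functional controlling the majorants. -/
def Q0 (r n N S : ℕ) (ω : Fin n → ℝ) : ℝ :=
  ∑ s ∈ Finset.range (S + 1), (((r:ℝ) + 1) * ((2 ^ s : ℕ) : ℝ) + 1) * ∑ t ∈ JJ r N S, yy r n (2 ^ s) t ω ^ 2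

/-- The level. -/
def BB (r n N S : ℕ) (ω : Fin n → ℝ) : ℝ := 1 + 2 * Real.sqrt (Q0 r n N S ω)

/-- Bad points. -/
def BadP (N : ℕ) (K : Finset ℤ) : ℤ → Prop := fun b => b < 0 ∨ (N:ℤ) ≤ b ∨ b ∈ K

/-- Scale-`s` noise primitive. -/
def gs (r n S : ℕ) (Pos Neg : Finset ℤ) (s : ℕ) : ℤ → (Fin n → ℝ) → ℝ :=
  gg r n (2 ^ s) (lab (r * (((2 ^ S : ℕ) : ℤ) - 1)) (2 * (r * (((2 ^ S : ℕ) : ℤ) - 1))) Pos Neg)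

/-- The dual certificate process. -/
def QQ (r n N S : ℕ) (Pos Neg : Finset ℤ) : ℤ → (Fin n → ℝ) → ℝ := fun t =>
  u00 r (2 ^ S) Pos Neg t • BB r n N S +
    ∑ s ∈ Finset.range (S + 1), phi r (BadP N (Pos ∪ Neg)) S s t • gs r n S Pos Neg s t

lemma BB_ge (r n N S : ℕ) (ω : Fin n → ℝ) : 1 ≤ BB r n N S ω := by
  unfold BB; linarith [Real.sqrt_nonneg (Q0 r n N S ω)]

lemma gs_le (r n N S : ℕ) (hr : 1 ≤ r) (Pos Neg : Finset ℤ) {s : ℕ} (hs : s ≤ S) {t : ℤ}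
    (h0 : 0 ≤ t) (h1 : t < N) (ω : Fin n → ℝ) : |gs r n S Pos Neg s t ω| ≤ BB r n N S ω := by
  have h := gg_abs r n hr (w := 2 ^ s) (by positivity)
    (lab (r * (((2 ^ S : ℕ) : ℤ) - 1)) (2 * (r * (((2 ^ S : ℕ) : ℤ) - 1))) Pos Neg)
    (fun t => lab_abs _ _ _ _ t) (JJ r N S) t (by
      have h3 : ((2:ℤ) ^ s) ≤ 2 ^ S := pow_le_pow_right₀ (by norm_num) hs
      have h4 : (0:ℤ) ≤ r := by positivity
      refine Finset.Icc_subset_Icc ?_ ?_ <;> push_cast <;> nlinarith) ω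
  refine h.trans ?_
  unfold BB
  have : Real.sqrt (((r:ℝ) + 1) * ((2 ^ s : ℕ) : ℝ) + 1) ≥ 0 := Real.sqrt_nonneg _
  have h5 : (((r:ℝ) + 1) * ((2 ^ s : ℕ) : ℝ) + 1) * ∑ t' ∈ JJ r N S, yy r n (2 ^ s) t' ω ^ 2
      ≤ Q0 r n N S ω := by
    unfold Q0
    refine Finset.single_le_sum (f := fun s => (((r:ℝ) + 1) * ((2 ^ s : ℕ) : ℝ) + 1) * ∑ t ∈ JJ r N S, yy r n (2 ^ s) t ω ^ 2) (fun i _ => ?_) (Finset.mem_range.2 (by omega))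
    exact mul_nonneg (by positivity) (Finset.sum_nonneg fun _ _ => sq_nonneg _)
  linarith [Real.sqrt_le_sqrt h5]

lemma QQ_apply (r n N S : ℕ) (Pos Neg : Finset ℤ) (t : ℤ) (ω : Fin n → ℝ) :
    QQ r n N S Pos Neg t ω = u00 r (2 ^ S) Pos Neg t * BB r n N S ω +
    ∑ s ∈ Finset.range (S + 1), phi r (BadP N (Pos ∪ Neg)) S s t * gs r n S Pos Neg s t ω := by
  simp [QQ]

lemma QQ_bad (r n N S : ℕ) (hr : 1 ≤ r) (Pos Neg : Finset ℤ) {t : ℤ}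
    (ht : BadP N (Pos ∪ Neg) t) (ω : Fin n → ℝ) :
    QQ r n N S Pos Neg t ω = u00 r (2 ^ S) Pos Neg t * BB r n N S ω := by
  rw [QQ_apply, Finset.sum_eq_zero, add_zero]
  intro s _
  rw [phi_bad hr S s ht, zero_mul]

lemma QQ_pos (r n N S : ℕ) (hr : 1 ≤ r) (Pos Neg : Finset ℤ)
    (hs : Sep Pos Neg N (r * (((2 ^ S : ℕ):ℤ) - 1))) {l : ℤ} (hl : l ∈ Pos) (ω : Fin n → ℝ) :
    QQ r n N S Pos Neg l ω = BB r n N S ω := by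
  rw [QQ_bad r n N S hr Pos Neg (Or.inr (Or.inr (Finset.mem_union_left _ hl))),
    u00_pos (by positivity) hs hl, one_mul]

lemma QQ_neg (r n N S : ℕ) (hr : 1 ≤ r) (Pos Neg : Finset ℤ)
    (hs : Sep Pos Neg N (r * (((2 ^ S : ℕ):ℤ) - 1))) {l : ℤ} (hl : l ∈ Neg) (ω : Fin n → ℝ) :
    QQ r n N S Pos Neg l ω = -BB r n N S ω := by
  rw [QQ_bad r n N S hr Pos Neg (Or.inr (Or.inr (Finset.mem_union_right _ hl))),
    u00_neg (by positivity) hs hl]; ring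

lemma QQ_out (r n N S : ℕ) (hr : 1 ≤ r) (Pos Neg : Finset ℤ)
    (hs : Sep Pos Neg N (r * (((2 ^ S : ℕ):ℤ) - 1))) {t : ℤ} (ht : t < 0 ∨ (N:ℤ) ≤ t)
    (ω : Fin n → ℝ) : QQ r n N S Pos Neg t ω = 0 := by
  rw [QQ_bad r n N S hr Pos Neg (by unfold BadP; tauto),
    u00_out (by positivity) hs ht, zero_mul]

lemma QQ_abs (r n N S : ℕ) (hr : 1 ≤ r) (Pos Neg : Finset ℤ)
    (hs : Sep Pos Neg N (r * (((2 ^ S : ℕ):ℤ) - 1))) (t : ℤ) (ω : Fin n → ℝ) :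
    |QQ r n N S Pos Neg t ω| ≤ BB r n N S ω := by
  have hB := BB_ge r n N S ω
  by_cases ht : t < 0 ∨ (N:ℤ) ≤ t
  · rw [QQ_out r n N S hr Pos Neg hs ht, abs_zero]; linarith
  push Not at ht
  rw [QQ_apply]
  set B := BB r n N S ω
  set Bad := BadP N (Pos ∪ Neg)
  set Sg := ∑ s ∈ Finset.range (S + 1), phi r Bad S s t * gs r n S Pos Neg s t ω with hSg
  have hsum : ∑ s ∈ Finset.range (S + 1), phi r Bad S s t * B ≤ B := by
    rw [← Finset.sum_mul, phi_sum]
    exact mul_le_of_le_one_left (by linarith) (chi_mem r Bad 0 t).2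
  have habs : |Sg| ≤ B := by
    refine (Finset.abs_sum_le_sum_abs _ _).trans (le_trans (Finset.sum_le_sum fun s hs => ?_) hsum)
    rw [abs_mul, abs_of_nonneg (phi_nonneg hr Bad S s t)]
    exact mul_le_mul_of_nonneg_left (gs_le r n N S hr Pos Neg
      (Nat.lt_succ_iff.1 (Finset.mem_range.1 hs)) ht.1 ht.2 ω) (phi_nonneg hr Bad S s t)
  rcases u00_cases (w := 2 ^ S) (by positivity) hs t with h | ⟨sg, hsg, h0, h1, h2⟩
  · rw [h, zero_mul, zero_add]; exact habs
  · have h3 : sg * Sg ≤ 0 := by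
      rw [hSg, Finset.mul_sum]
      refine Finset.sum_nonpos fun s hs => ?_
      have hs' : ((2:ℤ) ^ s) ≤ 2 ^ S :=
        pow_le_pow_right₀ (by norm_num) (Nat.lt_succ_iff.1 (Finset.mem_range.1 hs))
      have h4 := gg_sign r n hr (w := 2 ^ s) (by positivity) _ t sg hsg (fun a h5 h6 => h2 a h5
        (h6.trans (by
          have : (0:ℤ) ≤ r := by positivity
          push_cast; nlinarith))) ω
      have := mul_nonpos_of_nonneg_of_nonpos (phi_nonneg hr Bad S s t) h4
      rw [show sg * (phi r Bad S s t * gs r n S Pos Neg s t ω) =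
        phi r Bad S s t * (sg * gs r n S Pos Neg s t ω) by ring]
      exact this
    rw [abs_le] at habs ⊢
    have h5 : 0 ≤ (sg * u00 r (2 ^ S) Pos Neg t) * B := mul_nonneg h0 (by linarith)
    have h6 : (sg * u00 r (2 ^ S) Pos Neg t) * B ≤ B := mul_le_of_le_one_left (by linarith) h1
    rcases hsg with rfl | rfl <;> constructor <;> nlinarith

lemma sum_two_pow (S : ℕ) : ∑ s ∈ Finset.range (S + 1), (2:ℝ) ^ s ≤ 2 * 2 ^ S := by
  induction S with
  | zero => simp
  | succ S ih =>
    rw [Finset.sum_range_succ]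
    have : (2:ℝ) ^ (S + 1) = 2 * 2 ^ S := by ring
    linarith

lemma L2_BB (r n N S : ℕ) (hr : 2 ≤ r) (hN : N + r = n) (hS : 2 ^ S ≤ n) :
    L2 (gaussVec n 1) (BB r n N S)
      ((1 + 2 * Real.sqrt (2 * (r + 2) * (2 * r + 3))) * (Real.sqrt n * (2 ^ S) ^ (r - 1))) := by
  set S2 := siz_L2 (gaussVec n 1)
  have hn1 : (1:ℝ) ≤ n := by exact_mod_cast (show 1 ≤ n by omega)
  set R : ℝ := Real.sqrt n * (2 ^ S) ^ (r - 1) with hR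
  have hR1 : 1 ≤ R := by
    have h1 : 1 ≤ Real.sqrt n := Real.one_le_sqrt.2 hn1
    have h2 : (1:ℝ) ≤ (2 ^ S) ^ (r - 1) := one_le_pow₀ (one_le_pow₀ (by norm_num))
    exact one_le_mul_of_one_le_of_one_le h1 h2
  have hmem : ∀ s t, MemLp (yy r n (2 ^ s) t) 2 (gaussVec n 1) := fun s t =>
    (ub_yy r n hr (w := 2 ^ s) (by positivity) t).2.1
  have hinteg : ∀ s t, Integrable (fun ω => yy r n (2 ^ s) t ω ^ 2) (gaussVec n 1) := fun s t =>
    (hmem s t).integrable_sq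
  have hQint : Integrable (Q0 r n N S) (gaussVec n 1) := by
    unfold Q0
    exact integrable_finsetSum _ fun s _ => (integrable_finsetSum _ fun t _ => hinteg s t).const_mul _
  have hQ0 : ∀ ω, 0 ≤ Q0 r n N S ω := fun ω => Finset.sum_nonneg fun s _ =>
    mul_nonneg (by positivity) (Finset.sum_nonneg fun _ _ => sq_nonneg _)
  have hJ : ((JJ r N S).card : ℝ) ≤ (2 * r + 3) * n := by
    unfold JJ
    rw [Int.card_Icc]
    have h1 : (0:ℤ) ≤ (N + r * 2 ^ S + 1 - (-((r + 1) * 2 ^ S))) := by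
      rw [sub_neg_eq_add]; positivity
    have h2 : ((N + r * 2 ^ S + 1 - (-((r + 1) * 2 ^ S))) : ℤ) ≤ (2 * r + 3) * n := by
      have : (2:ℤ) ^ S ≤ n := by exact_mod_cast hS
      have h4 : (0:ℤ) ≤ r := by positivity
      have h5 : (N:ℤ) + 1 ≤ n := by omega
      nlinarith
    have h3 : (((N + r * 2 ^ S + 1 - (-((r + 1) * 2 ^ S))) : ℤ).toNat : ℤ) ≤ (2 * r + 3) * n := by
      rw [Int.toNat_of_nonneg h1]; exact h2
    exact_mod_cast h3
  have hQ : ∫ ω, Q0 r n N S ω ∂gaussVec n 1 ≤ 2 * (r + 2) * (2 * r + 3) * R ^ 2 := by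
    unfold Q0
    rw [integral_finsetSum _ fun s _ => (integrable_finsetSum _ fun t _ => hinteg s t).const_mul _]
    have hterm : ∀ s ∈ Finset.range (S + 1),
        ∫ ω, (((r:ℝ) + 1) * ((2 ^ s : ℕ) : ℝ) + 1) * ∑ t ∈ JJ r N S, yy r n (2 ^ s) t ω ^ 2 ∂gaussVec n 1
        ≤ ((r + 2) * (2 * r + 3) * n * (2 ^ S) ^ (2 * r - 3)) * 2 ^ s := by
      intro s hs
      have hsS : s ≤ S := Nat.lt_succ_iff.1 (Finset.mem_range.1 hs)
      rw [integral_const_mul, integral_finsetSum _ fun t _ => hinteg s t]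
      have h1 : ∑ t ∈ JJ r N S, ∫ ω, yy r n (2 ^ s) t ω ^ 2 ∂gaussVec n 1
          ≤ (JJ r N S).card * (2 ^ s) ^ (2 * r - 3) := by
        rw [← nsmul_eq_mul]
        refine Finset.sum_le_card_nsmul _ _ _ fun t _ => ?_
        refine (ub_yy r n hr (w := 2 ^ s) (by positivity) t).2.2.trans (le_of_eq ?_)
        rw [div_pow, Real.sq_sqrt (by positivity), ← pow_mul, div_eq_iff (by positivity)]
        push_cast
        rw [← pow_succ]; congr 1; omega
      have h2 : (((r:ℝ) + 1) * ((2 ^ s : ℕ) : ℝ) + 1) ≤ (r + 2) * 2 ^ s := by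
        have : (1:ℝ) ≤ 2 ^ s := one_le_pow₀ (by norm_num)
        push_cast; nlinarith
      have h3 : ((2:ℝ) ^ s) ^ (2 * r - 3) ≤ (2 ^ S) ^ (2 * r - 3) :=
        pow_le_pow_left₀ (by positivity) (pow_le_pow_right₀ (by norm_num) hsS) _
      refine (mul_le_mul h2 (h1.trans (mul_le_mul hJ h3 (by positivity) (by positivity)))
              (Finset.sum_nonneg fun t _ => integral_nonneg fun ω => sq_nonneg _)
              (by positivity)).trans (le_of_eq ?_)
      ring
    refine (Finset.sum_le_sum hterm).trans ?_
    rw [← Finset.mul_sum]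
    refine (mul_le_mul_of_nonneg_left (sum_two_pow S) (by positivity)).trans (le_of_eq ?_)
    rw [hR, mul_pow, Real.sq_sqrt (by positivity), ← pow_mul (2 ^ S) (r - 1) 2]
    have : ((2:ℝ) ^ S) ^ ((r - 1) * 2) = (2 ^ S) ^ (2 * r - 3) * 2 ^ S := by
      rw [← pow_succ]; congr 1; omega
    rw [this]; ring
  have h1 : L2 (gaussVec n 1) (fun _ => (1:ℝ)) R := by
    refine ⟨by positivity, memLp_const 1, ?_⟩
    have := one_le_pow₀ hR1 (n := 2)
    simp only [one_pow, integral_const, probReal_univ, smul_eq_mul, mul_one]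
    exact this
  have hsq : L2 (gaussVec n 1) (fun ω => Real.sqrt (Q0 r n N S ω))
      (Real.sqrt (2 * (r + 2) * (2 * r + 3)) * R) := by
    refine ⟨by positivity, ?_, ?_⟩
    · rw [memLp_two_iff_integrable_sq (hQint.1.aemeasurable.sqrt.aestronglyMeasurable)]
      refine hQint.congr (Filter.Eventually.of_forall fun ω => ?_)
      simp [Real.sq_sqrt (hQ0 ω)]
    · simp only [Real.sq_sqrt (hQ0 _), mul_pow]
      rw [Real.sq_sqrt (by positivity)]; exact hQ
  have h2 := S2.add h1 (S2.smul 2 hsq)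
  convert h2 using 1
  · ext ω; simp [BB]
  · rw [abs_of_pos (by norm_num : (0:ℝ) < 2)]; ring

end TF

namespace TF

lemma d_pow_smul_const {Ω : Type*} (j : ℕ) (u : ℤ → ℝ) (B : Ω → ℝ) (t : ℤ) :
    (dop ^ j : Module.End ℝ (ℤ → Ω → ℝ)) (fun t => u t • B) t
      = ((dop ^ j : Module.End ℝ (ℤ → ℝ)) u t) • B := by
  induction j generalizing t with
  | zero => simp
  | succ j ih =>
    rw [pow_succ', Module.End.mul_apply, dop_apply, pow_succ', Module.End.mul_apply, dop_apply,
      ih, ih, sub_smul]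

/-- The residual process. -/
def EE (r n N S : ℕ) (Pos Neg : Finset ℤ) : ℤ → (Fin n → ℝ) → ℝ := fun t =>
  zz n t - (dop ^ r : Module.End ℝ (ℤ → (Fin n → ℝ) → ℝ)) (QQ r n N S Pos Neg) t

open Classical in
/-- Activity indicator. -/
def act (r : ℕ) (Bad : ℤ → Prop) (S s : ℕ) (t : ℤ) : ℝ := if s < S ∧ ¬ near r Bad s t then 0 else 1

/-- Constant. -/
def KK (r : ℕ) : ℝ := 4 ^ r * (r + 3) * (2 * 2 ^ r)

lemma KK_ge (r : ℕ) : 1 ≤ KK r := by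
  unfold KK
  have h1 : (1:ℝ) ≤ 4 ^ r := one_le_pow₀ (by norm_num)
  have h2 : (1:ℝ) ≤ 2 ^ r := one_le_pow₀ (by norm_num)
  have h3 : (0:ℝ) ≤ r := by positivity
  exact one_le_mul_of_one_le_of_one_le (one_le_mul_of_one_le_of_one_le h1 (by linarith)) (by linarith)

lemma EE_size (r n N S : ℕ) (hr : 2 ≤ r) (Pos Neg : Finset ℤ) (b : ℝ)
    (hb : L2 (gaussVec n 1) (BB r n N S) b) (t : ℤ) :
    L2 (gaussVec n 1) (EE r n N S Pos Neg t)
      (2 * KK r * ∑ s ∈ Finset.range (S + 1), act r (BadP N (Pos ∪ Neg)) S s t * (Real.sqrt 2)⁻¹ ^ s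
        + (2 / ((2 ^ S : ℕ) : ℝ)) ^ r * b) := by
  set Bad := BadP N (Pos ∪ Neg)
  set x : ℝ := (Real.sqrt 2)⁻¹ with hx
  have P := siz_L2 (gaussVec n 1)
  have hb0 := P.nonneg hb
  have hx0 : 0 ≤ x := by positivity
  have hsqrt : ∀ s : ℕ, (Real.sqrt ((2 ^ s : ℕ) : ℝ))⁻¹ = x ^ s := by
    intro s
    rw [hx, inv_pow]
    congr 1
    push_cast
    rw [Real.sqrt_eq_iff_mul_self_eq (by positivity) (by positivity), ← mul_pow,
      Real.mul_self_sqrt (by norm_num)]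
  have hact : ∀ s, act r Bad S s t = 0 ∨ act r Bad S s t = 1 := by
    intro s; unfold act; split_ifs <;> simp
  have hact0 : ∀ s, 0 ≤ act r Bad S s t := by
    intro s; rcases hact s with h | h <;> rw [h]; norm_num
  set G : ℕ → ℤ → (Fin n → ℝ) → ℝ := fun s t => phi r Bad S s t • gs r n S Pos Neg s t with hG
  -- decomposition
  have hdec : EE r n N S Pos Neg t = (1 - chi r Bad 0 t) • zz n t
      - (∑ s ∈ Finset.range (S + 1), ((dop ^ r : Module.End ℝ (ℤ → (Fin n → ℝ) → ℝ)) (G s) t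
        - phi r Bad S s t • zz n t)
      + ((dop ^ r : Module.End ℝ (ℤ → ℝ)) (u00 r (2 ^ S) Pos Neg) t) • BB r n N S) := by
    have h1 : QQ r n N S Pos Neg = (fun t => u00 r (2 ^ S) Pos Neg t • BB r n N S)
        + ∑ s ∈ Finset.range (S + 1), G s := by
      ext t ω
      simp [QQ, hG, Bad]
    rw [EE, h1, map_add, map_sum, Pi.add_apply, d_pow_smul_const, Finset.sum_apply,
      Finset.sum_sub_distrib, ← Finset.sum_smul, phi_sum, sub_smul, one_smul]
    abel
  have hs1 : ∀ s ∈ Finset.range (S + 1), L2 (gaussVec n 1)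
      ((dop ^ r : Module.End ℝ (ℤ → (Fin n → ℝ) → ℝ)) (G s) t - phi r Bad S s t • zz n t)
      (KK r * (act r Bad S s t * x ^ s)) := by
    intro s _
    have := main_size r n hr (w := 2 ^ s) (by positivity)
      (lab (r * (((2 ^ S : ℕ) : ℤ) - 1)) (2 * (r * (((2 ^ S : ℕ) : ℤ) - 1))) Pos Neg)
      (fun t => lab_abs _ _ _ _ t) (phi r Bad S s) t (2 * 2 ^ r * act r Bad S s t) (by
        intro m hm
        unfold act
        split_ifs with h
        · rw [phi_far Bad h.1 h.2 hm]; simp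
        · rw [mul_one]; exact phi_d r Bad S s t hm)
    convert this using 1
    · rfl
    · rw [div_eq_mul_inv, hsqrt, KK]; ring
  have hs2 : L2 (gaussVec n 1) ((1 - chi r Bad 0 t) • zz n t) (act r Bad S 0 t) := by
    have h := P.smul (1 - chi r Bad 0 t) (ub_z n t)
    refine P.mono h ?_
    rw [mul_one]
    unfold act
    split_ifs with h1
    · rw [chi0_far Bad h1.2]; simp
    · have := chi_mem r Bad 0 t
      rw [abs_le]; constructor <;> linarith [this.1, this.2]
  have hs3 := P.smul ((dop ^ r : Module.End ℝ (ℤ → ℝ)) (u00 r (2 ^ S) Pos Neg) t) hb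
  have h := P.sub hs2 (P.add (P.sum _ hs1) hs3)
  rw [hdec]
  refine P.mono h ?_
  rw [← Finset.mul_sum]
  have h0 : act r Bad S 0 t ≤ ∑ s ∈ Finset.range (S + 1), act r Bad S s t * x ^ s := by
    have := Finset.single_le_sum (f := fun s => act r Bad S s t * x ^ s)
      (fun s _ => mul_nonneg (hact0 s) (by positivity)) (Finset.mem_range.2 (Nat.succ_pos S))
    simpa using this
  have h1 := KK_ge r
  have h2 := mul_le_mul_of_nonneg_right (u00_d r (w := 2 ^ S) (by positivity) Pos Neg t) hb0
  have h3 : 0 ≤ act r Bad S 0 t := hact0 0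
  nlinarith

lemma EE_total (r n N S : ℕ) (hr : 2 ≤ r) (hN : N + r = n) (Pos Neg : Finset ℤ) (b : ℝ)
    (hb : L2 (gaussVec n 1) (BB r n N S) b) :
    ∑ t ∈ Finset.range n, ∫ ω, EE r n N S Pos Neg (t:ℤ) ω ^ 2 ∂gaussVec n 1 ≤
      128 * KK r ^ 2 * (50 * r * ((Pos ∪ Neg).card + 1) * S + n / 2 ^ S)
        + 2 * n * ((2 / 2 ^ S) ^ r * b) ^ 2 := by
  classical
  set Bad := BadP N (Pos ∪ Neg) with hBad
  set x : ℝ := (Real.sqrt 2)⁻¹ with hx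
  have hx2 : x ^ 2 = 1 / 2 := by rw [hx, inv_pow, Real.sq_sqrt (by norm_num)]; norm_num
  have hx0 : 0 ≤ x := by positivity
  have hx34 : x ≤ 3 / 4 := by nlinarith
  set D := (2 / ((2 ^ S : ℕ) : ℝ)) ^ r * b with hD
  have h1 : ∀ t ∈ Finset.range n, ∫ ω, EE r n N S Pos Neg (t:ℤ) ω ^ 2 ∂gaussVec n 1 ≤
      128 * KK r ^ 2 * ∑ s ∈ Finset.range (S + 1), act r Bad S s t * (1 / 2) ^ s + 2 * D ^ 2 := by
    intro t _
    refine (EE_size r n N S hr Pos Neg b hb t).2.2.trans ?_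
    obtain ⟨i0, i1, i2⟩ := sparse_geom x hx0 hx34 (S + 1) (fun s => act r Bad S s t)
      (by intro s; unfold act; split_ifs <;> simp)
    rw [hx2] at i2
    set F := ∑ s ∈ Finset.range (S + 1), act r Bad S s t * x ^ s
    have h3 : (2 * KK r * F + D) ^ 2 ≤ 8 * (KK r ^ 2 * F ^ 2) + 2 * D ^ 2 := by
      nlinarith [sq_nonneg (2 * KK r * F - D)]
    have h4 := mul_le_mul_of_nonneg_left i2 (sq_nonneg (KK r))
    refine h3.trans ?_
    linarith
  refine (Finset.sum_le_sum h1).trans ?_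
  rw [Finset.sum_add_distrib, ← Finset.mul_sum, Finset.sum_comm]
  have h2 : ∑ s ∈ Finset.range (S + 1), ∑ t ∈ Finset.range n, act r Bad S s (t:ℤ) * (1 / 2) ^ s
      ≤ 50 * r * ((Pos ∪ Neg).card + 1) * S + n / 2 ^ S := by
    rw [Finset.sum_range_succ]
    refine add_le_add ?_ ?_
    · have : ∀ s ∈ Finset.range S, ∑ t ∈ Finset.range n, act r Bad S s (t:ℤ) * (1 / 2) ^ s
          ≤ 50 * r * ((Pos ∪ Neg).card + 1) := by
        intro s hs
        rw [← Finset.sum_mul]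
        have h3 := near_count (r := r) N (Pos ∪ Neg) s (by omega)
        have h4 : ∑ t ∈ Finset.range n, act r Bad S s (t:ℤ) =
            (((Finset.range (N + r)).filter fun t : ℕ =>
              near r (fun b => b < 0 ∨ (N:ℤ) ≤ b ∨ b ∈ Pos ∪ Neg) s t).card : ℝ) := by
          rw [hN, Finset.card_filter]
          push_cast
          refine Finset.sum_congr rfl fun t _ => ?_
          unfold act
          simp only [Finset.mem_range.1 hs, true_and]
          rw [ite_not]
          congr
        rw [h4]
        have h5 := mul_le_mul_of_nonneg_right h3 (by positivity : (0:ℝ) ≤ (1 / 2) ^ s)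
        refine h5.trans (le_of_eq ?_)
        rw [mul_assoc, ← mul_pow]; norm_num
      refine (Finset.sum_le_card_nsmul _ _ _ this).trans (le_of_eq ?_)
      rw [Finset.card_range, nsmul_eq_mul]; ring
    · have : ∀ t ∈ Finset.range n, act r Bad S S (t:ℤ) * (1 / 2) ^ S ≤ (1 / 2) ^ S := by
        intro t _; simp [act]
      refine (Finset.sum_le_card_nsmul _ _ _ this).trans (le_of_eq ?_)
      rw [Finset.card_range, nsmul_eq_mul, one_div, inv_pow]; rfl
  have h3 := mul_le_mul_of_nonneg_left h2 (by positivity : (0:ℝ) ≤ 128 * KK r ^ 2)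
  refine add_le_add h3 (le_of_eq ?_)
  rw [Finset.sum_const, Finset.card_range, nsmul_eq_mul, hD]
  push_cast; ring

end TF

namespace TF

lemma d_pow_supp (N r : ℕ) (q : ℤ → ℝ) (hq : ∀ t : ℤ, t < 0 ∨ (N:ℤ) ≤ t → q t = 0) (t : ℤ)
    (ht : t < 0 ∨ (N:ℤ) + r ≤ t) : (dop ^ r : Module.End ℝ (ℤ → ℝ)) q t = 0 :=
  d_pow_zero r q t fun a h0 h1 => hq _ (by omega)

lemma adjoint (N r : ℕ) (q : ℤ → ℝ) (hq : ∀ t : ℤ, t < 0 ∨ (N:ℤ) ≤ t → q t = 0) (f : ℕ → ℝ) :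
    ∑ t ∈ Finset.range N, q t * (dseq^[r] f) t
      = ∑ t ∈ Finset.range (N + r), (dop ^ r : Module.End ℝ (ℤ → ℝ)) q t * f t := by
  induction r generalizing f with
  | zero => simp
  | succ r ih =>
    rw [Function.iterate_succ_apply, ih (dseq f)]
    set p := (dop ^ r : Module.End ℝ (ℤ → ℝ)) q with hp
    have h1 : ∀ t : ℤ, (dop ^ (r + 1) : Module.End ℝ (ℤ → ℝ)) q t = p (t - 1) - p t := by
      intro t; rw [pow_succ', Module.End.mul_apply, dop_apply]
    have h2 : p (-1) = 0 := d_pow_supp N r q hq _ (by omega)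
    have h3 : p (((N + r : ℕ)) : ℤ) = 0 := d_pow_supp N r q hq _ (by push_cast; omega)
    simp only [h1, sub_mul, Finset.sum_sub_distrib, ← add_assoc]
    rw [Finset.sum_range_succ', Finset.sum_range_succ (fun t : ℕ => p t * f t), h3]
    simp only [dseq, mul_sub, Finset.sum_sub_distrib]
    have h4 : p (((0:ℕ):ℤ) - 1) = 0 := by simpa using h2
    rw [h4]
    simp

lemma sum_pad {n : ℕ} (g : ℕ → ℝ) (θ : Fin n → ℝ) :
    ∑ t ∈ Finset.range n, g t * pad θ t = ∑ i : Fin n, g i * θ i := by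
  rw [← Fin.sum_univ_eq_sum_range (fun t => g t * pad θ t) n]
  refine Finset.sum_congr rfl fun i _ => ?_
  simp [pad]

/-- Restriction of an integer sequence to `Fin n`. -/
def res (n : ℕ) (p : ℤ → ℝ) : Fin n → ℝ := fun i => p ((i:ℕ):ℤ)

lemma adjoint_vec {N r n : ℕ} (hN : N + r = n) (q : ℤ → ℝ)
    (hq : ∀ t : ℤ, t < 0 ∨ (N:ℤ) ≤ t → q t = 0) (θ : Fin n → ℝ) :
    ∑ i, res n ((dop ^ r : Module.End ℝ (ℤ → ℝ)) q) i * θ i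
      = ∑ t ∈ Finset.range N, q t * DD r θ t := by
  rw [DD, adjoint N r q hq, hN, sum_pad (fun t => (dop ^ r : Module.End ℝ (ℤ → ℝ)) q t)]
  rfl

lemma feas_mem {N r n : ℕ} (hN : N + r = n) (q : ℤ → ℝ)
    (hq : ∀ t : ℤ, t < 0 ∨ (N:ℤ) ≤ t → q t = 0) (hq1 : ∀ t, |q t| ≤ 1) (θ : Fin n → ℝ)
    (hs : ∀ t : ℕ, t < N → q t * DD r θ t = |DD r θ t|) :
    res n ((dop ^ r : Module.End ℝ (ℤ → ℝ)) q) ∈ subdiff (fun α => Dl1 r α) θ := by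
  intro y
  have hN' : n - r = N := by omega
  simp only [mul_sub, Finset.sum_sub_distrib]
  rw [adjoint_vec hN q hq y, adjoint_vec hN q hq θ]
  simp only [Dl1, hN']
  have h1 : ∑ t ∈ Finset.range N, q t * DD r θ t = ∑ t ∈ Finset.range N, |DD r θ t| :=
    Finset.sum_congr rfl fun t ht => hs t (Finset.mem_range.1 ht)
  have h2 : ∑ t ∈ Finset.range N, q t * DD r y t ≤ ∑ t ∈ Finset.range N, |DD r y t| := by
    refine Finset.sum_le_sum fun t _ => ?_
    refine (le_abs_self _).trans ?_
    rw [abs_mul]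
    exact mul_le_of_le_one_left (abs_nonneg _) (hq1 _)
  linarith

lemma spline (m l : ℕ) : ∃ w : ℕ → ℝ, dseq^[m + 1] w = (fun t => if t = l then 1 else 0) ∧
    (∀ i, l < i → w i = 0) ∧ ∀ i, |w i| ≤ ((l:ℝ) + 1) ^ m := by
  induction m with
  | zero =>
    refine ⟨fun i => if i ≤ l then -1 else 0, ?_, ?_, ?_⟩
    · ext t
      simp only [zero_add, Function.iterate_one, dseq]
      split_ifs <;> first | omega | norm_num
    · intro i hi; simp [hi]
    · intro i; dsimp only; split_ifs <;> simp
  | succ m ih =>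
    obtain ⟨w, h1, h2, h3⟩ := ih
    refine ⟨fun i => -∑ j ∈ Finset.Ico i (l + 1), w j, ?_, ?_, ?_⟩
    · rw [Function.iterate_succ_apply]
      rw [show dseq (fun i => -∑ j ∈ Finset.Ico i (l + 1), w j) = w from ?_, h1]
      ext t
      simp only [dseq]
      by_cases ht : t < l + 1
      · rw [Finset.sum_eq_sum_Ico_succ_bot ht]; ring
      · rw [Finset.Ico_eq_empty (by omega), Finset.Ico_eq_empty (by omega), h2 t (by omega)]; simp
    · intro i hi
      simp only
      rw [Finset.Ico_eq_empty (by omega)]; simp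
    · intro i
      dsimp only
      rw [abs_neg]
      refine (Finset.abs_sum_le_sum_abs _ _).trans ?_
      refine (Finset.sum_le_card_nsmul _ _ _ fun j _ => h3 j).trans ?_
      rw [Nat.card_Ico, nsmul_eq_mul, pow_succ, mul_comm (((l:ℝ) + 1) ^ m)]
      refine mul_le_mul_of_nonneg_right ?_ (by positivity)
      have : l + 1 - i ≤ l + 1 := Nat.sub_le _ _
      exact_mod_cast this

lemma dseq_lin (r : ℕ) (f g : ℕ → ℝ) (c : ℝ) (t : ℕ) :
    dseq^[r] (fun t => f t + c * g t) t = dseq^[r] f t + c * dseq^[r] g t := by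
  induction r generalizing f g t with
  | zero => simp
  | succ r ih =>
    rw [Function.iterate_succ_apply', Function.iterate_succ_apply', Function.iterate_succ_apply']
    simp only [dseq, ih]; ring

lemma exists_test {r n : ℕ} (hr : 1 ≤ r) (hrn : r ≤ n) (θ : Fin n → ℝ) {l : ℕ} (hl : l < n - r)
    (hd : DD r θ l ≠ 0) : ∃ (w : Fin n → ℝ) (σ : ℝ), σ ^ 2 = 1 ∧
      eunorm w ≤ Real.sqrt (((l:ℝ) + 1) ^ (2 * r - 1)) ∧
      ∀ v ∈ subdiff (fun α => Dl1 r α) θ, ∑ i, v i * w i = σ := by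
  obtain ⟨m, rfl⟩ : ∃ m, r = m + 1 := ⟨r - 1, by omega⟩
  obtain ⟨w, h1, h2, h3⟩ := spline m l
  have hpad : pad (fun i : Fin n => w i) = w := by
    ext t; unfold pad; split_ifs with h
    · rfl
    · exact (h2 t (by omega)).symm
  refine ⟨fun i => w i, SignType.sign (DD (m+1) θ l), ?_, ?_, ?_⟩
  · rcases lt_or_gt_of_ne hd with h | h <;> simp [h]
  · refine Real.sqrt_le_sqrt ?_
    unfold sqnorm
    rw [Fin.sum_univ_eq_sum_range (fun t => w t ^ 2) n]
    have h4 : ∑ t ∈ Finset.range n, w t ^ 2 = ∑ t ∈ Finset.range (l + 1), w t ^ 2 := by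
      refine (Finset.sum_subset (Finset.range_subset_range.2 (by omega)) fun t _ ht => ?_).symm
      rw [h2 t (by simpa using ht)]; simp
    rw [h4]
    refine (Finset.sum_le_card_nsmul _ _ (((l:ℝ) + 1) ^ (2 * m)) fun t _ => ?_).trans (le_of_eq ?_)
    · rw [← sq_abs, mul_comm, pow_mul]
      exact pow_le_pow_left₀ (abs_nonneg _) (h3 t) 2
    · rw [Finset.card_range, nsmul_eq_mul]
      rw [show 2 * (m + 1) - 1 = 2 * m + 1 by omega, pow_succ]; push_cast; ring
  · intro v hv
    set d := DD (m+1) θ l with hdd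
    have key : ∀ ε : ℝ, ε * ∑ i, v i * w i ≤ |d + ε| - |d| := by
      intro ε
      have h5 := hv (fun i => θ i + ε * w i)
      have hDD : ∀ t, DD (m+1) (fun i => θ i + ε * w i) t
          = DD (m+1) θ t + ε * (if t = l then 1 else 0) := by
        intro t
        have : pad (fun i => θ i + ε * w i) = fun t => pad θ t + ε * w t := by
          ext t
          conv_rhs => rw [← hpad]
          unfold pad; split_ifs <;> simp
        rw [DD, this, dseq_lin, h1]; rfl
      simp only [Dl1, hDD, add_sub_cancel_left] at h5
      have h6 : ∑ t ∈ Finset.range (n - (m + 1)), |DD (m+1) θ t + ε * (if t = l then 1 else 0)|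
          = ∑ t ∈ Finset.range (n - (m + 1)), |DD (m+1) θ t| + (|d + ε| - |d|) := by
        rw [← sub_eq_iff_eq_add', ← Finset.sum_sub_distrib, Finset.sum_eq_single l]
        · simp [hdd]
        · intro t _ ht; simp [ht]
        · intro h; exact absurd (Finset.mem_range.2 hl) h
      rw [h6] at h5
      have h7 : ∑ i, v i * (ε * w i) = ε * ∑ i, v i * w i := by
        rw [Finset.mul_sum]; exact Finset.sum_congr rfl fun _ _ => by ring
      rw [h7] at h5
      linarith
    have k1 := key d
    have k2 := key (-d)
    rw [← two_mul, abs_mul, abs_of_pos (by norm_num : (0:ℝ) < 2)] at k1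
    rw [add_neg_cancel, abs_zero] at k2
    rcases lt_or_gt_of_ne hd with h | h
    · rw [abs_of_neg h] at k1 k2
      simp only [h, sign_neg, SignType.coe_neg_one]
      nlinarith
    · rw [abs_of_pos h] at k1 k2
      simp only [h, sign_pos, SignType.coe_one]
      nlinarith

lemma cs {n : ℕ} (x w : Fin n → ℝ) : |∑ i, x i * w i| ≤ eunorm x * eunorm w := by
  unfold eunorm sqnorm
  rw [← Real.sqrt_mul (Finset.sum_nonneg fun _ _ => sq_nonneg _)]
  exact Real.abs_le_sqrt (Finset.sum_mul_sq_le_sq_mul_sq _ _ _)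

lemma eunorm_nonneg {n : ℕ} (x : Fin n → ℝ) : 0 ≤ eunorm x := Real.sqrt_nonneg _

lemma abs_one_of_sq {σ : ℝ} (h : σ ^ 2 = 1) : |σ| = 1 := by
  have h1 : |σ| ^ 2 = 1 := by rw [sq_abs, h]
  exact (pow_eq_one_iff_of_nonneg (abs_nonneg σ) two_ne_zero).1 h1

lemma inv_v0 {n : ℕ} {S : Set (Fin n → ℝ)} {w v0 : Fin n → ℝ} {σ : ℝ} (hσ : σ ^ 2 = 1)
    (hw : ∀ v ∈ S, ∑ i, v i * w i = σ) (hv : v0 ∈ (affineSpan ℝ S : Set (Fin n → ℝ))) :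
    1 / eunorm v0 ≤ eunorm w := by
  have h1 : ∑ i, v0 i * w i = σ := by
    refine affineSpan_induction (p := fun v => ∑ i, v i * w i = σ) hv hw ?_
    intro c u v y hu hv hy
    simp only [vsub_eq_sub, vadd_eq_add, Pi.add_apply, Pi.smul_apply, Pi.sub_apply, smul_eq_mul,
      add_mul, sub_mul, mul_sub, mul_assoc, Finset.sum_add_distrib, Finset.sum_sub_distrib,
      ← Finset.mul_sum, hu, hv, hy]
    ring
  have h2 := cs v0 w
  rw [h1, abs_one_of_sq hσ] at h2
  have h3 := eunorm_nonneg v0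
  have h4 : 0 < eunorm v0 := by
    rcases h3.eq_or_lt with h | h
    · rw [← h] at h2; linarith
    · exact h
  rw [div_le_iff₀ h4]; linarith

lemma lam_le {n : ℕ} {S : Set (Fin n → ℝ)} {w : Fin n → ℝ} {σ : ℝ} (hσ : σ ^ 2 = 1)
    (hw : ∀ v ∈ S, ∑ i, v i * w i = σ) {lam : (Fin n → ℝ) → ℝ} (hl : IsLamFun S lam)
    (z v' : Fin n → ℝ) (hv' : v' ∈ S) {B : ℝ} (hB : 0 ≤ B) :
    lam z ≤ B + 2 * eunorm w * eunorm (z - B • v') := by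
  set M := eunorm (z - B • v')
  set W := eunorm w
  have hW : 0 ≤ W := eunorm_nonneg w
  have hbdd : ∀ T : Set (Fin n → ℝ), BddBelow ((fun v => eunorm (z - v)) '' T) := fun T =>
    ⟨0, by rintro _ ⟨x, _, rfl⟩; exact eunorm_nonneg _⟩
  have h1 : distSet z (scaleSet (lam z) S) ≤ M := by
    refine ((hl z).2 B hB).trans (csInf_le (hbdd _) ⟨B • v', ⟨v', hv', rfl⟩, rfl⟩)
  by_contra hcon
  push Not at hcon
  set δ := lam z - (B + 2 * W * M) with hδ
  have hδ0 : 0 < δ := by linarith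
  have hε : 0 < δ / (W + 1) := by positivity
  obtain ⟨_, ⟨_, ⟨v, hv, rfl⟩, rfl⟩, h2⟩ := exists_lt_of_csInf_lt
    (s := (fun v => eunorm (z - v)) '' scaleSet (lam z) S)
    ⟨_, ⟨lam z • v', ⟨v', hv', rfl⟩, rfl⟩⟩ (lt_of_le_of_lt h1 (lt_add_of_pos_right M hε))
  simp only at h2
  have h3 : (lam z - B) * σ = ∑ i, (z - B • v') i * w i - ∑ i, (z - lam z • v) i * w i := by
    simp only [Pi.sub_apply, Pi.smul_apply, smul_eq_mul, sub_mul, Finset.sum_sub_distrib,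
      mul_assoc, ← Finset.mul_sum, hw v hv, hw v' hv']
    ring
  have h4 : |(lam z - B) * σ| ≤ M * W + (M + δ / (W + 1)) * W := by
    rw [h3]
    refine (abs_sub _ _).trans (add_le_add (cs _ _) ((cs _ _).trans ?_))
    exact mul_le_mul_of_nonneg_right h2.le hW
  rw [abs_mul, abs_one_of_sq hσ, mul_one] at h4
  have h5 := (le_abs_self _).trans h4
  have h6 : δ / (W + 1) * W < δ := by
    rw [div_mul_eq_mul_div, div_lt_iff₀ (by linarith)]; nlinarith
  nlinarith

end TF

namespace TF

lemma resid {r n N S : ℕ} (Pos Neg : Finset ℤ) (z : Fin n → ℝ) :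
    eunorm (z - BB r n N S z • res n ((dop ^ r : Module.End ℝ (ℤ → ℝ))
      (fun t => QQ r n N S Pos Neg t z / BB r n N S z)))
      = Real.sqrt (∑ t ∈ Finset.range n, EE r n N S Pos Neg (t:ℤ) z ^ 2) := by
  have hB : BB r n N S z ≠ 0 := by linarith [BB_ge r n N S z] |> fun h : 0 < BB r n N S z => h.ne'
  unfold eunorm sqnorm
  rw [← Fin.sum_univ_eq_sum_range (fun t => EE r n N S Pos Neg (t:ℤ) z ^ 2) n]
  congr 1
  refine Finset.sum_congr rfl fun i _ => ?_
  congr 1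
  have h1 : (fun t => QQ r n N S Pos Neg t z / BB r n N S z)
      = (BB r n N S z)⁻¹ • fun t => QQ r n N S Pos Neg t z := by
    ext t; simp [div_eq_inv_mul]
  rw [h1, map_smul]
  simp only [Pi.sub_apply, Pi.smul_apply, smul_eq_mul, res, EE]
  rw [mul_inv_cancel_left₀ hB, d_pow_eval]
  congr 1
  simp [zz, pad]

lemma lam_bound {r n N S : ℕ} (hr : 2 ≤ r) (hN : N + r = n) (Pos Neg : Finset ℤ)
    (hs : Sep Pos Neg N (r * (((2 ^ S : ℕ):ℤ) - 1))) (θ : Fin n → ℝ)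
    (hP : ∀ t : ℕ, t < N → 0 < DD r θ t → (t:ℤ) ∈ Pos)
    (hM : ∀ t : ℕ, t < N → DD r θ t < 0 → (t:ℤ) ∈ Neg)
    {w : Fin n → ℝ} {σ : ℝ} (hσ : σ ^ 2 = 1)
    (hw : ∀ v ∈ subdiff (fun α => Dl1 r α) θ, ∑ i, v i * w i = σ)
    {lam : (Fin n → ℝ) → ℝ} (hl : IsLamFun (subdiff (fun α => Dl1 r α) θ) lam)
    (z : Fin n → ℝ) :
    lam z ≤ BB r n N S z +
      2 * eunorm w * Real.sqrt (∑ t ∈ Finset.range n, EE r n N S Pos Neg (t:ℤ) z ^ 2) := by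
  have hB : 0 < BB r n N S z := by linarith [BB_ge r n N S z]
  rw [← resid]
  refine lam_le hσ hw hl z _ ?_ hB.le
  refine feas_mem hN _ ?_ ?_ θ ?_
  · intro t ht
    rw [QQ_out r n N S (by omega) Pos Neg hs ht, zero_div]
  · intro t
    rw [abs_div, abs_of_pos hB, div_le_one hB]
    exact QQ_abs r n N S (by omega) Pos Neg hs t z
  · intro t ht
    rcases lt_trichotomy (DD r θ t) 0 with h | h | h
    · rw [QQ_neg r n N S (by omega) Pos Neg hs (hM t ht h), neg_div, div_self hB.ne', abs_of_neg h]
      ring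
    · simp [h]
    · rw [QQ_pos r n N S (by omega) Pos Neg hs (hP t ht h), div_self hB.ne', abs_of_pos h]
      ring

lemma E_bound {r n N S : ℕ} (hr : 2 ≤ r) (hN : N + r = n) (Pos Neg : Finset ℤ)
    (hs : Sep Pos Neg N (r * (((2 ^ S : ℕ):ℤ) - 1))) (θ : Fin n → ℝ)
    (hP : ∀ t : ℕ, t < N → 0 < DD r θ t → (t:ℤ) ∈ Pos)
    (hM : ∀ t : ℕ, t < N → DD r θ t < 0 → (t:ℤ) ∈ Neg)
    {w : Fin n → ℝ} {σ : ℝ} (hσ : σ ^ 2 = 1)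
    (hw : ∀ v ∈ subdiff (fun α => Dl1 r α) θ, ∑ i, v i * w i = σ)
    {lam : (Fin n → ℝ) → ℝ} (hl : IsLamFun (subdiff (fun α => Dl1 r α) θ) lam)
    {b : ℝ} (hb : L2 (gaussVec n 1) (BB r n N S) b) :
    ∫ z, lam z ∂gaussVec n 1 ≤ b + 2 * eunorm w *
      Real.sqrt (128 * KK r ^ 2 * (50 * r * ((Pos ∪ Neg).card + 1) * S + n / 2 ^ S)
        + 2 * n * ((2 / 2 ^ S) ^ r * b) ^ 2) := by
  set T := 128 * KK r ^ 2 * (50 * r * ((Pos ∪ Neg).card + 1) * S + n / 2 ^ S)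
        + 2 * n * ((2 / 2 ^ S) ^ r * b) ^ 2 with hT
  have hT0 : 0 ≤ T := by positivity
  set R : (Fin n → ℝ) → ℝ := fun z =>
    Real.sqrt (∑ t ∈ Finset.range n, EE r n N S Pos Neg (t:ℤ) z ^ 2) with hR
  have hEE : ∀ t : ℤ, MemLp (EE r n N S Pos Neg t) 2 (gaussVec n 1) := fun t =>
    (EE_size r n N S hr Pos Neg b hb t).2.1
  have hRsq : ∀ z, R z ^ 2 = ∑ t ∈ Finset.range n, EE r n N S Pos Neg (t:ℤ) z ^ 2 := fun z =>
    Real.sq_sqrt (Finset.sum_nonneg fun _ _ => sq_nonneg _)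
  have hsum : MemLp (fun z => ∑ t ∈ Finset.range n, |EE r n N S Pos Neg (t:ℤ) z|) 2
      (gaussVec n 1) := memLp_finsetSum _ fun t _ => (hEE t).abs
  have hRm : MemLp R 2 (gaussVec n 1) := by
    refine hsum.mono ?_ (Filter.Eventually.of_forall fun z => ?_)
    · refine Real.continuous_sqrt.comp_aestronglyMeasurable ?_
      exact Finset.aestronglyMeasurable_fun_sum _ fun t _ => (hEE t).1.pow 2
    · have h0 : 0 ≤ ∑ t ∈ Finset.range n, |EE r n N S Pos Neg (t:ℤ) z| :=
        Finset.sum_nonneg fun _ _ => abs_nonneg _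
      rw [Real.norm_eq_abs, Real.norm_eq_abs, abs_of_nonneg (Real.sqrt_nonneg _), abs_of_nonneg h0]
      refine Real.sqrt_le_left h0 |>.2 ?_ 
      have := Finset.sum_sq_le_sq_sum_of_nonneg (s := Finset.range n)
        (f := fun t : ℕ => |EE r n N S Pos Neg (t:ℤ) z|) (fun _ _ => abs_nonneg _)
      simpa [sq_abs] using this
  have hRL : L2 (gaussVec n 1) R (Real.sqrt T) := by
    refine ⟨Real.sqrt_nonneg _, hRm, ?_⟩
    rw [Real.sq_sqrt hT0]
    simp only [hRsq]
    rw [integral_finsetSum (Finset.range n) fun (t : ℕ) _ => (hEE (t:ℤ)).integrable_sq]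
    exact EE_total r n N S hr hN Pos Neg b hb
  have hi1 : Integrable (BB r n N S) (gaussVec n 1) := hb.2.1.integrable (by norm_num)
  have hi2 : Integrable R (gaussVec n 1) := hRm.integrable (by norm_num)
  calc ∫ z, lam z ∂gaussVec n 1
      ≤ ∫ z, (BB r n N S z + 2 * eunorm w * R z) ∂gaussVec n 1 := by
        refine integral_mono_of_nonneg (Filter.Eventually.of_forall fun z => (hl z).1)
          (hi1.add (hi2.const_mul _)) (Filter.Eventually.of_forall fun z => ?_)
        exact lam_bound hr hN Pos Neg hs θ hP hM hσ hw hl z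
    _ = ∫ z, BB r n N S z ∂gaussVec n 1 + 2 * eunorm w * ∫ z, R z ∂gaussVec n 1 := by
        rw [integral_add hi1 (hi2.const_mul _), integral_const_mul]
    _ ≤ _ := by
        refine add_le_add (L2_mean hb) (mul_le_mul_of_nonneg_left (L2_mean hRL) ?_)
        have := eunorm_nonneg w; positivity

end TF

namespace TF

lemma DD_succ {r n : ℕ} (hr : 1 ≤ r) (θ : Fin n → ℝ) (t : ℕ) :
    DD r θ t = DD (r - 1) θ (t + 1) - DD (r - 1) θ t := by
  obtain ⟨m, rfl⟩ : ∃ m, r = m + 1 := ⟨r - 1, by omega⟩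
  unfold DD
  rw [Function.iterate_succ_apply']
  rfl

lemma sgext_succ {k : ℕ} (sg : Fin k → ℝ) (a : ℕ) (ha : a < k) : sgext k sg (a + 1) = sg ⟨a, ha⟩ := by
  simp [sgext, ha]

lemma jext_succ {n r k : ℕ} (j : Fin k → ℕ) (a : ℕ) (ha : a < k) :
    jext n r k j (a + 1) = j ⟨a, ha⟩ := by
  simp [jext, ha]

lemma knot_facts {r n k : ℕ} (hr : 2 ≤ r) (hn : 2 * r ≤ n) (θ : Fin n → ℝ)
    (hd : ∃ t < n - r, DD r θ t ≠ 0) (j : Fin k → ℕ) (sg : Fin k → ℝ)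
    (hk : IsKnotSeq r n θ k j sg) (A A' : ℝ)
    (hA : ∀ i ≤ k, sgext k sg i ≠ sgext k sg (i + 1) →
      A ≤ (nlen n r k j i : ℝ) ∧ (nlen n r k j i : ℝ) ≤ A') :
    ∃ (Pos Neg : Finset ℤ) (l : ℕ), (Pos ∪ Neg).card ≤ k ∧ k + 1 ≤ n ∧ 
      (∀ t : ℕ, t < n - r → 0 < DD r θ t → (t:ℤ) ∈ Pos) ∧
      (∀ t : ℕ, t < n - r → DD r θ t < 0 → (t:ℤ) ∈ Neg) ∧
      (∀ x ∈ Pos, ∀ y ∈ Neg, A ≤ |(x:ℝ) - y| ∧ 0 < |x - y|) ∧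
      (∀ x ∈ Pos ∪ Neg, 0 ≤ x ∧ x < (n - r : ℕ) ∧ A ≤ (x:ℝ) + r ∧ A ≤ ((n - r : ℕ):ℝ) - x) ∧
      l < n - r ∧ DD r θ l ≠ 0 ∧ (l:ℝ) + 1 ≤ A' := by
  classical
  obtain ⟨hmono, hrange, hknot, hsg⟩ := hk
  have hpm : ∀ i, sg i = 1 ∨ sg i = -1 := by
    intro i; rw [hsg i]; split_ifs <;> simp
  have hne : ∀ i, sg i ≠ 0 := by
    intro i; rcases hpm i with h | h <;> rw [h] <;> norm_num
  have hDj : ∀ i, DD r θ (j i - 2) = DD (r - 1) θ (j i - 1) - DD (r - 1) θ (j i - 2) := by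
    intro i
    rw [DD_succ (by omega), show j i - 2 + 1 = j i - 1 by have := (hrange i).1; omega]
  have hkn : ∀ t < n - r, DD r θ t ≠ 0 → ∃ i, j i = t + 2 := by
    intro t ht h
    refine (hknot (t + 2) (by omega) (by omega)).1 ?_
    rw [DD_succ (by omega)] at h
    intro h'
    apply h
    rw [show t + 2 - 2 = t by omega, show t + 2 - 1 = t + 1 by omega] at h'
    rw [h', sub_self]
  have hk0 : 0 < k := by
    obtain ⟨t, ht, h⟩ := hd
    obtain ⟨i, _⟩ := hkn t ht h
    exact i.pos
  have hkcard : k ≤ n - r := by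
    have : (Finset.univ.image fun i : Fin k => j i) ⊆ Finset.Icc 2 (n - r + 1) := by
      intro x hx
      obtain ⟨i, _, rfl⟩ := Finset.mem_image.1 hx
      exact Finset.mem_Icc.2 (hrange i)
    have h2 := Finset.card_le_card this
    rw [Finset.card_image_of_injective _ hmono.injective] at h2
    simp at h2
    omega
  -- lengths
  have hfirst := hA 0 (by omega) (by
    rw [sgext_succ sg 0 hk0]
    have : sgext k sg 0 = 0 := by simp [sgext]
    rw [this]; exact (hne _).symm)
  have hn0 : nlen n r k j 0 = j ⟨0, hk0⟩ + r - 2 := by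
    simp only [nlen, if_true]
    rw [show (1:ℕ) = 0 + 1 from rfl, jext_succ j 0 hk0]
  rw [hn0] at hfirst
  have hlast := (hA k le_rfl (by
    obtain ⟨k', rfl⟩ : ∃ k', k = k' + 1 := ⟨k - 1, by omega⟩
    rw [sgext_succ sg k' (by omega)]
    have : sgext (k' + 1) sg (k' + 1 + 1) = 0 := by simp [sgext]
    rw [this]; exact hne _)).1
  have hnk : nlen n r k j k = n - r + 2 - j ⟨k - 1, by omega⟩ := by
    simp only [nlen, if_neg hk0.ne']
    have h1 : jext n r k j (k + 1) = n - r + 2 := by simp [jext]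
    have h2 : jext n r k j k = j ⟨k - 1, by omega⟩ := by
      simp only [jext, if_neg hk0.ne']
      rw [dif_pos (by omega)]
    rw [h1, h2]
  rw [hnk] at hlast
  have hmid : ∀ a b : ℕ, ∀ (ha : a < k) (hb : b < k), a < b → sg ⟨a, ha⟩ ≠ sg ⟨b, hb⟩ →
      A ≤ (j ⟨b, hb⟩ : ℝ) - j ⟨a, ha⟩ := by
    intro a b
    induction b with
    | zero => intro _ _ h; omega
    | succ b ih =>
      intro ha hb hab hs
      have hbk : b < k := by omega
      by_cases hs' : sg ⟨b, hbk⟩ = sg ⟨b + 1, hb⟩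
      · have hab' : a < b := by
          rcases Nat.lt_succ_iff_lt_or_eq.1 hab with h | h
          · exact h
          · subst h; exact absurd hs' hs
        have h1 := ih ha hbk hab' (by rw [hs']; exact hs)
        have h2 : j ⟨b, hbk⟩ < j ⟨b + 1, hb⟩ := hmono (by simp [Fin.lt_def])
        have h3 : (j ⟨b, hbk⟩ : ℝ) < j ⟨b + 1, hb⟩ := by exact_mod_cast h2
        linarith
      · have h1 := (hA (b + 1) (by omega) (by
          rw [sgext_succ sg b hbk, sgext_succ sg (b + 1) hb]; exact hs')).1
        simp only [nlen, if_neg (Nat.succ_ne_zero b)] at h1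
        rw [jext_succ j (b + 1) hb, jext_succ j b hbk] at h1
        have h2 : j ⟨b, hbk⟩ < j ⟨b + 1, hb⟩ := hmono (by simp [Fin.lt_def])
        rw [Nat.cast_sub h2.le] at h1
        have h3 : j ⟨a, ha⟩ ≤ j ⟨b, hbk⟩ := hmono.monotone (by simp [Fin.le_def]; omega)
        have h4 : (j ⟨a, ha⟩ : ℝ) ≤ j ⟨b, hbk⟩ := by exact_mod_cast h3
        linarith
  set f : Fin k → ℤ := fun i => (j i : ℤ) - 2 with hf
  refine ⟨(Finset.univ.filter fun i => sg i = 1).image f,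
    (Finset.univ.filter fun i => sg i = -1).image f, j ⟨0, hk0⟩ - 2, ?_, by omega,
    ?_, ?_, ?_, ?_, ?_, ?_, ?_⟩
  · rw [← Finset.image_union]
    refine Finset.card_image_le.trans ((Finset.card_le_univ _).trans ?_)
    simp
  · intro t ht h
    obtain ⟨i, hi⟩ := hkn t ht h.ne'
    refine Finset.mem_image.2 ⟨i, Finset.mem_filter.2 ⟨Finset.mem_univ _, ?_⟩, by simp [hf, hi]⟩
    have h1 := hDj i
    rw [show j i - 2 = t by omega] at h1
    rw [hsg i, if_pos]
    rw [show j i - 2 = t by omega]; linarith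
  · intro t ht h
    obtain ⟨i, hi⟩ := hkn t ht h.ne
    refine Finset.mem_image.2 ⟨i, Finset.mem_filter.2 ⟨Finset.mem_univ _, ?_⟩, by simp [hf, hi]⟩
    have h1 := hDj i
    rw [show j i - 2 = t by omega] at h1
    rw [hsg i, if_neg]
    rw [show j i - 2 = t by omega]; linarith
  · intro x hx y hy
    obtain ⟨a, ha, rfl⟩ := Finset.mem_image.1 hx
    obtain ⟨b, hb, rfl⟩ := Finset.mem_image.1 hy
    have ha := (Finset.mem_filter.1 ha).2
    have hb := (Finset.mem_filter.1 hb).2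
    have hab : a ≠ b := by rintro rfl; rw [ha] at hb; norm_num at hb
    have hs : sg a ≠ sg b := by rw [ha, hb]; norm_num
    constructor
    · simp only [hf]; push_cast
      rcases lt_or_gt_of_ne hab with h | h
      · have := hmid a b a.2 b.2 h hs
        rw [abs_sub_comm]
        refine le_trans ?_ (le_abs_self _)
        simp only [Fin.eta] at this; linarith
      · have := hmid b a b.2 a.2 h hs.symm
        refine le_trans ?_ (le_abs_self _)
        simp only [Fin.eta] at this; linarith
    · rw [abs_pos]
      have := hmono.injective.ne hab
      simp only [hf]; omega
  · intro x hx
    rw [← Finset.image_union] at hx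
    obtain ⟨a, _, rfl⟩ := Finset.mem_image.1 hx
    have h1 := hrange a
    have h2 : j ⟨0, hk0⟩ ≤ j a := hmono.monotone (by simp [Fin.le_def])
    have h3 : j a ≤ j ⟨k - 1, by omega⟩ := hmono.monotone (by simp [Fin.le_def]; omega)
    have h4 := hrange ⟨k - 1, by omega⟩
    have h5 := hrange ⟨0, hk0⟩
    refine ⟨by simp only [hf]; omega, by simp only [hf]; omega, ?_, ?_⟩
    · refine hfirst.1.trans ?_
      have : j ⟨0, hk0⟩ + r - 2 + 2 ≤ j a + r := by omega
      have : ((j ⟨0, hk0⟩ + r - 2 : ℕ) : ℝ) + 2 ≤ j a + r := by exact_mod_cast this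
      simp only [hf]; push_cast; linarith
    · refine hlast.trans ?_
      have : n - r + 2 - j ⟨k - 1, by omega⟩ + j a ≤ (n - r) + 2 := by omega
      have : ((n - r + 2 - j ⟨k - 1, by omega⟩ : ℕ):ℝ) + j a ≤ ((n - r : ℕ):ℝ) + 2 := by
        exact_mod_cast this
      simp only [hf]; push_cast; push_cast at this; linarith
  · have := hrange ⟨0, hk0⟩; omega
  · have h1 := hrange ⟨0, hk0⟩
    have h2 := (hknot (j ⟨0, hk0⟩) h1.1 h1.2).2 ⟨_, rfl⟩
    rw [hDj]
    exact sub_ne_zero.2 h2.symm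
  · refine le_trans ?_ hfirst.2
    have h1 := (hrange ⟨0, hk0⟩).1
    have : j ⟨0, hk0⟩ - 2 + 1 ≤ j ⟨0, hk0⟩ + r - 2 := by omega
    exact_mod_cast this

end TF

namespace TF

/-- Constants. -/
def Cb (r : ℕ) : ℝ := 1 + 2 * Real.sqrt (2 * (r + 2) * (2 * r + 3))

/-- Constants. -/
def CT (r : ℕ) (δ : ℝ) : ℝ :=
  128 * KK r ^ 2 * (100 * r + 2 / δ) + 8 * 4 ^ r * Cb r ^ 2 / δ ^ 2

lemma Cb_pos (r : ℕ) : 0 < Cb r := by unfold Cb; positivity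

lemma CT_pos (r : ℕ) {δ : ℝ} (hδ : 0 < δ) : 0 ≤ CT r δ := by unfold CT; positivity

lemma T_bound {r : ℕ} (hr : 2 ≤ r) {n K w δ L s m b : ℝ} (hn : 0 < n) (hK : 1 ≤ K) (hw : 1 ≤ w)
    (hδ : 0 < δ) (hL : 1 ≤ L) (hs : s ≤ 2 * L) (hs0 : 0 ≤ s) (hm : m + 1 ≤ K)
    (hnw : n / w ≤ 2 * K / δ) (hb : b = Cb r * (Real.sqrt n * w ^ (r - 1))) :
    128 * KK r ^ 2 * (50 * r * (m + 1) * s + n / w) + 2 * n * ((2 / w) ^ r * b) ^ 2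
      ≤ CT r δ * (K ^ 2 * L) := by
  have hw0 : 0 < w := by linarith
  have h1 : 50 * r * (m + 1) * s + n / w ≤ (100 * r + 2 / δ) * (K ^ 2 * L) := by
    have hKL : K ≤ K ^ 2 * L := by nlinarith [mul_le_mul hK hL (by norm_num) (by linarith)]
    have hKL2 : K * L ≤ K ^ 2 * L := by nlinarith [mul_nonneg (by linarith : 0 ≤ K) (by linarith : 0 ≤ L)]
    have a1 : (m + 1) * s ≤ K * (2 * L) := mul_le_mul hm hs hs0 (by linarith)
    have a2 : n / w ≤ 2 / δ * (K ^ 2 * L) := by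
      refine hnw.trans ?_
      rw [mul_div_right_comm]
      exact mul_le_mul_of_nonneg_left hKL (by positivity)
    have a3 : 50 * r * ((m + 1) * s) ≤ 50 * r * (2 * (K ^ 2 * L)) :=
      mul_le_mul_of_nonneg_left (by linarith) (by positivity)
    nlinarith
  have h2 : 2 * n * ((2 / w) ^ r * b) ^ 2 = 2 * 4 ^ r * Cb r ^ 2 * (n / w) ^ 2 := by
    obtain ⟨q, rfl⟩ : ∃ q, r = q + 1 := ⟨r - 1, by omega⟩
    rw [hb, Nat.add_sub_cancel]
    have : Real.sqrt n ^ 2 = n := Real.sq_sqrt hn.le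
    have e4 : (4:ℝ) ^ (q + 1) = (2 ^ (q + 1)) ^ 2 := by
      rw [← pow_mul, mul_comm, pow_mul]; norm_num
    rw [e4]
    rw [show (2 * n * ((2 / w) ^ (q + 1) * (Cb (q + 1) * (Real.sqrt n * w ^ q))) ^ 2)
      = 2 * n * ((2 / w) ^ (q + 1) * w ^ q) ^ 2 * Cb (q+1) ^ 2 * Real.sqrt n ^ 2 by ring, this]
    have : (2 / w) ^ (q + 1) * w ^ q = 2 ^ (q + 1) / w := by
      rw [div_pow]; field_simp; ring
    rw [this]; field_simp
  have h3 : (n / w) ^ 2 ≤ 4 / δ ^ 2 * (K ^ 2 * L) := by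
    have : (n / w) ^ 2 ≤ (2 * K / δ) ^ 2 := pow_le_pow_left₀ (by positivity) hnw 2
    refine this.trans ?_
    rw [show (2 * K / δ) ^ 2 = 4 / δ ^ 2 * K ^ 2 by ring]
    refine mul_le_mul_of_nonneg_left ?_ (by positivity)
    nlinarith [sq_nonneg K]
  rw [h2]
  have h4 := mul_le_mul_of_nonneg_left h1 (show 0 ≤ 128 * KK r ^ 2 by positivity)
  have h5 := mul_le_mul_of_nonneg_left h3 (show 0 ≤ 2 * 4 ^ r * Cb r ^ 2 by positivity)
  refine (add_le_add h4 h5).trans (le_of_eq ?_)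
  unfold CT; ring

lemma final_bound {r : ℕ} (hr : 2 ≤ r) {n K w c δ L T W b : ℝ} (hK : 1 ≤ K) (hKn : K ≤ n)
    (hw0 : 0 ≤ w) (hw : w ≤ 2 * (n / K)) (hc : 1 ≤ c) (hδ : 0 < δ) (hL : 1 ≤ L)
    (hb : b = Cb r * (Real.sqrt n * w ^ (r - 1)))
    (hT : T ≤ CT r δ * (K ^ 2 * L)) (hW : W ≤ Real.sqrt ((c * (n / K)) ^ (2 * r - 1))) :
    b + 2 * W * Real.sqrt T + 2 * W ≤
      (Cb r * 2 ^ (r - 1) + 2 * Real.sqrt (c ^ (2 * r - 1) * CT r δ)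
        + 2 * Real.sqrt (c ^ (2 * r - 1))) * (n ^ (r - 1) * Real.sqrt (n * L)) := by
  have hK0 : 0 < K := by linarith
  have hn : 1 ≤ n := hK.trans hKn
  have hn0 : 0 < n := by linarith
  obtain ⟨q, rfl⟩ : ∃ q, r = q + 2 := ⟨r - 2, by omega⟩
  have e1 : q + 2 - 1 = q + 1 := by omega
  have e2 : 2 * (q + 2) - 1 = 2 * q + 3 := by omega
  rw [e2] at hW ⊢
  rw [e1] at hb ⊢
  have hCT := CT_pos (q + 2) hδ
  have hX : n / K ≤ n := div_le_self hn0.le hK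
  have hX0 : 0 < n / K := by positivity
  have hD : n ^ (q + 1) * Real.sqrt (n * L) = Real.sqrt (n ^ (2 * q + 3) * L) := by
    rw [show n ^ (2 * q + 3) * L = (n ^ (q + 1)) ^ 2 * (n * L) by ring,
      Real.sqrt_mul (sq_nonneg (n ^ (q + 1))), Real.sqrt_sq (by positivity)]
  have hb' : b ≤ Cb (q + 2) * 2 ^ (q + 1) * (n ^ (q + 1) * Real.sqrt (n * L)) := by
    have h1 : w ^ (q + 1) ≤ 2 ^ (q + 1) * n ^ (q + 1) := by
      rw [← mul_pow]; exact pow_le_pow_left₀ hw0 (by linarith) _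
    have h2 : Real.sqrt n ≤ Real.sqrt (n * L) := Real.sqrt_le_sqrt (by nlinarith)
    rw [hb, mul_assoc]
    refine mul_le_mul_of_nonneg_left ?_ (Cb_pos _).le
    refine (mul_le_mul h2 h1 (by positivity) (by positivity)).trans (le_of_eq ?_)
    ring
  have hWT : W * Real.sqrt T ≤ Real.sqrt (c ^ (2 * q + 3) * CT (q + 2) δ) *
      (n ^ (q + 1) * Real.sqrt (n * L)) := by
    refine (mul_le_mul_of_nonneg_right hW (Real.sqrt_nonneg _)).trans ?_
    rw [hD, ← Real.sqrt_mul (by positivity), ← Real.sqrt_mul (by positivity)]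
    refine Real.sqrt_le_sqrt ?_
    refine (mul_le_mul_of_nonneg_left hT (by positivity)).trans ?_
    have h1 : (n / K) ^ (2 * q + 3) * K ^ 2 ≤ n ^ (2 * q + 3) := by
      rw [div_pow, div_mul_eq_mul_div, div_le_iff₀ (by positivity)]
      exact mul_le_mul_of_nonneg_left (pow_le_pow_right₀ hK (by omega)) (by positivity)
    calc (c * (n / K)) ^ (2 * q + 3) * (CT (q + 2) δ * (K ^ 2 * L))
        = c ^ (2 * q + 3) * CT (q + 2) δ * (((n / K) ^ (2 * q + 3) * K ^ 2) * L) := by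
          rw [mul_pow]; ring
      _ ≤ _ := by
          refine mul_le_mul_of_nonneg_left (mul_le_mul_of_nonneg_right h1 (by linarith)) (by positivity)
  have hW' : W ≤ Real.sqrt (c ^ (2 * q + 3)) * (n ^ (q + 1) * Real.sqrt (n * L)) := by
    refine hW.trans ?_
    rw [hD, ← Real.sqrt_mul (by positivity)]
    refine Real.sqrt_le_sqrt ?_
    rw [mul_pow]
    refine mul_le_mul_of_nonneg_left ?_ (by positivity)
    refine (pow_le_pow_left₀ hX0.le hX _).trans ?_
    exact le_mul_of_one_le_right (by positivity) hL
  nlinarith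

lemma scale {r : ℕ} (hr : 2 ≤ r) {c X : ℝ} (hc : 0 < c) (hc1 : c ≤ 1) (hX : 1 ≤ X) :
    ∃ S : ℕ, (2:ℝ) ^ S ≤ 2 * X ∧ c / (4 * r) * X ≤ 2 * 2 ^ S ∧ 4 * (r * ((2:ℝ) ^ S - 1)) ≤ c * X ∧
      (S:ℝ) ≤ 2 * (1 + Real.log X) := by
  set Y := c / (4 * r) * X with hY
  have hr0 : (2:ℝ) ≤ r := by exact_mod_cast hr
  have hY0 : 0 ≤ Y := by positivity
  have hYc : 4 * r * Y = c * X := by rw [hY]; field_simp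
  have hYX : Y ≤ X := by
    have : c * X ≤ X := by nlinarith
    nlinarith
  set m := ⌊Y⌋₊ + 1
  have h1 : (2:ℝ) ^ Nat.log 2 m ≤ m := by exact_mod_cast Nat.pow_log_le_self 2 (Nat.succ_ne_zero _)
  have h2 : (m:ℝ) < 2 ^ (Nat.log 2 m + 1) := by
    exact_mod_cast Nat.lt_pow_succ_log_self (by norm_num) m
  have h3 : (⌊Y⌋₊:ℝ) ≤ Y := Nat.floor_le hY0
  have h4 : Y < ⌊Y⌋₊ + 1 := Nat.lt_floor_add_one Y
  have hm : (m:ℝ) = ⌊Y⌋₊ + 1 := by simp [m]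
  have h5 : (2:ℝ) ^ Nat.log 2 m ≤ 2 * X := by linarith
  refine ⟨Nat.log 2 m, h5, by rw [pow_succ] at h2; linarith, ?_, ?_⟩
  · rw [← hYc]
    have : (r:ℝ) * ((2:ℝ) ^ Nat.log 2 m - 1) ≤ r * Y :=
      mul_le_mul_of_nonneg_left (by linarith) (by linarith)
    linarith
  · have h6 := Real.log_le_log (by positivity) h5
    rw [Real.log_pow, Real.log_mul (by norm_num) (by linarith)] at h6
    have h7 := Real.log_two_gt_d9
    have h8 := Real.log_nonneg hX
    by_contra hcon
    push Not at hcon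
    nlinarith

end TF
open TF

/-- Lemma: explicit bound on `λ*` for `r ≥ 2` under the two-sided
length condition. -/
theorem stmt10 (r : ℕ) (hr : 2 ≤ r) (c₁ c₂ : ℝ) (hc₁0 : 0 < c₁) (hc₁1 : c₁ ≤ 1)
    (hc₂ : 1 ≤ c₂) :
    ∃ C : ℝ, 0 < C ∧
      ∀ (n : ℕ), 2 * r ≤ n → ∀ θstar : Fin n → ℝ, (∃ t < n - r, DD r θstar t ≠ 0) →
        ∀ (k : ℕ) (j : Fin k → ℕ) (sg : Fin k → ℝ), IsKnotSeq r n θstar k j sg →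
        (∀ i ≤ k, sgext k sg i ≠ sgext k sg (i + 1) →
          c₁ * (n : ℝ) / ((k : ℝ) + 1) ≤ (nlen n r k j i : ℝ) ∧
            (nlen n r k j i : ℝ) ≤ c₂ * (n : ℝ) / ((k : ℝ) + 1)) →
        ∀ v0 : Fin n → ℝ,
          IsMinNormIn v0
            ((affineSpan ℝ (subdiff (fun α => Dl1 r α) θstar) : Set (Fin n → ℝ))) →
        ∀ lamfun : (Fin n → ℝ) → ℝ, IsLamFun (subdiff (fun α => Dl1 r α) θstar) lamfun →
          (n : ℝ) ^ (1 - (r : ℤ)) * ((∫ z, lamfun z ∂gaussVec n 1) + 2 / eunorm v0) ≤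
            C * Real.sqrt ((n : ℝ) * Real.log (Real.exp 1 * (n : ℝ) / ((k : ℝ) + 1))) := by
  have hr0 : (2:ℝ) ≤ r := by exact_mod_cast hr
  set δ := c₁ / (4 * (r:ℝ)) with hδdef
  have hδ : 0 < δ := by positivity
  have hCb := Cb_pos r
  refine ⟨Cb r * 2 ^ (r - 1) + 2 * Real.sqrt (c₂ ^ (2 * r - 1) * CT r δ)
        + 2 * Real.sqrt (c₂ ^ (2 * r - 1)), by positivity, ?_⟩
  intro n hn θ hd k j sg hk hA v0 hv0 lam hlam
  obtain ⟨Pos, Neg, l, hcard, hkn, hP, hM, hPM, hx, hl, hdl, hlA⟩ :=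
    knot_facts hr hn θ hd j sg hk _ _ hA
  obtain ⟨N, hN⟩ : ∃ N, N + r = n := ⟨n - r, by omega⟩
  have hN' : n - r = N := by omega
  obtain ⟨W, σ, hσ, hWn, hW⟩ := exists_test (by omega) (by omega : r ≤ n) θ hl hdl
  rw [hN'] at hP hM hx
  set K : ℝ := (k:ℝ) + 1 with hKdef
  have hK : 1 ≤ K := by rw [hKdef]; linarith [(Nat.cast_nonneg k : (0:ℝ) ≤ k)]
  have hKn : K ≤ n := by rw [hKdef]; exact_mod_cast hkn
  have hK0 : 0 < K := by linarith
  have hn0 : (0:ℝ) < n := by linarith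
  have hX : 1 ≤ (n:ℝ) / K := by rwa [le_div_iff₀ hK0, one_mul]
  have hL : Real.log (Real.exp 1 * n / K) = 1 + Real.log (n / K) := by
    rw [mul_div_assoc, Real.log_mul (Real.exp_pos 1).ne' (by positivity), Real.log_exp]
  rw [hL]
  have hL1 : 1 ≤ 1 + Real.log (n / K) := by linarith [Real.log_nonneg hX]
  obtain ⟨S, hS1, hS2, hS3, hS4⟩ := scale hr hc₁0 hc₁1 hX
  rw [← mul_div_assoc] at hS3
  set w : ℝ := 2 ^ S with hw
  have hw1 : 1 ≤ w := one_le_pow₀ (by norm_num)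
  set ρ : ℤ := (r:ℤ) * (((2 ^ S : ℕ):ℤ) - 1) with hρ
  have hρw : (ρ:ℝ) = r * (w - 1) := by rw [hρ, hw]; push_cast; ring
  have hρA : 4 * (ρ:ℝ) ≤ c₁ * n / K := by rw [hρw]; exact hS3
  have hρ0 : 0 ≤ ρ := by
    have : (1:ℤ) ≤ ((2 ^ S : ℕ):ℤ) := by exact_mod_cast Nat.one_le_two_pow
    rw [hρ]; exact mul_nonneg (by positivity) (by linarith)
  have hρr : ρ = 0 ∨ (r:ℤ) ≤ ρ := by
    rcases Nat.eq_zero_or_pos S with h | h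
    · left; rw [hρ, h]; simp
    · right
      have : (2:ℤ) ≤ ((2 ^ S : ℕ):ℤ) := by
        have : 2 ^ 1 ≤ 2 ^ S := Nat.pow_le_pow_right (by norm_num) h
        exact_mod_cast this
      rw [hρ]; nlinarith
  have hloc : ∀ x ∈ Pos ∪ Neg, ρ ≤ x ∧ x + ρ < N := by
    intro x hxx
    obtain ⟨h1, h2, h3, h4⟩ := hx x hxx
    have h5 : (4 * ρ : ℤ) ≤ x + r := by
      have : (4 * (ρ:ℝ)) ≤ x + r := hρA.trans h3
      exact_mod_cast this
    have h6 : (4 * ρ : ℤ) ≤ N - x := by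
      have : (4 * (ρ:ℝ)) ≤ N - x := hρA.trans h4
      exact_mod_cast this
    rcases hρr with h | h <;> constructor <;> omega
  have hsep : Sep Pos Neg N ρ := by
    refine ⟨hρ0, ?_, fun x h => hloc x (Finset.mem_union_left _ h),
      fun x h => hloc x (Finset.mem_union_right _ h)⟩
    intro x hx y hy
    obtain ⟨h1, h2⟩ := hPM x hx y hy
    have h3 : (4 * ρ : ℤ) ≤ |x - y| := by
      have : (4 * (ρ:ℝ)) ≤ |(x:ℝ) - y| := hρA.trans h1
      exact_mod_cast this
    omega
  have hSn : 2 ^ S ≤ n := by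
    have h1 : w ≤ n := by
      have h3 : c₁ * n / K ≤ n := by
        rw [div_le_iff₀ hK0]; nlinarith
      have h4 : (4:ℝ) ≤ n := by
        have : 4 ≤ n := by omega
        exact_mod_cast this
      nlinarith
    rw [hw] at h1
    exact_mod_cast h1
  have hb := L2_BB r n N S hr hN hSn
  have hE := E_bound hr hN Pos Neg hsep θ hP hM hσ hW hlam hb
  rw [← hw] at hE
  set b := (1 + 2 * Real.sqrt (2 * (r + 2) * (2 * r + 3))) * (Real.sqrt n * w ^ (r - 1)) with hbdef
  have hbeq : b = Cb r * (Real.sqrt n * w ^ (r - 1)) := rfl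
  have hm : ((Pos ∪ Neg).card : ℝ) + 1 ≤ K := by
    rw [hKdef]
    have : ((Pos ∪ Neg).card : ℝ) ≤ k := by exact_mod_cast hcard
    linarith
  have hnw : (n:ℝ) / w ≤ 2 * K / δ := by
    rw [div_le_div_iff₀ (by linarith) hδ]
    have : δ * (n / K) * K ≤ 2 * w * K := mul_le_mul_of_nonneg_right hS2 hK0.le
    rw [mul_assoc, div_mul_cancel₀ _ hK0.ne'] at this
    linarith
  have hT := T_bound hr hn0 hK hw1 hδ hL1 hS4 (Nat.cast_nonneg S) hm hnw hbeq
  have hWn' : eunorm W ≤ Real.sqrt ((c₂ * (n / K)) ^ (2 * r - 1)) := by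
    refine hWn.trans (Real.sqrt_le_sqrt (pow_le_pow_left₀ (by positivity) ?_ _))
    rw [← mul_div_assoc]; exact hlA
  have hfin := final_bound hr hK hKn (by linarith) hS1 hc₂ hδ hL1 hbeq hT hWn'
  have hv := inv_v0 hσ hW hv0.1
  have hv2 : 2 / eunorm v0 ≤ 2 * eunorm W := by
    rw [show 2 / eunorm v0 = 2 * (1 / eunorm v0) by ring]; linarith
  have htot := (add_le_add hE hv2).trans hfin
  have hpow : (n:ℝ) ^ (1 - (r:ℤ)) * (n:ℝ) ^ (r - 1) = 1 := by
    rw [← zpow_natCast, ← zpow_add₀ hn0.ne', Nat.cast_sub (by omega)]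
    simp
  refine (mul_le_mul_of_nonneg_left htot (by positivity)).trans (le_of_eq ?_)
  rw [mul_left_comm, ← mul_assoc ((n:ℝ) ^ (1 - (r:ℤ))), hpow, one_mul]

end
end

section
/- Fix r ≥ 1, n ≥ 2r and σ > 0, and suppose θ* ∈ ℝ^n satisfies D^{(r)}θ* = 0. Then there is a constant C_r depending only on r such that for every λ ≥ sqrt(6 n log(en)), the penalized trend filtering estimator satisfies R(θ̂^{(r)}_λ, θ*) ≤ C_r σ²/n. -/
open MeasureTheory ProbabilityTheory
open scoped BigOperators

noncomputable section

lemma taylor_aux (q : ℕ) : ∀ (f : ℕ → ℝ) (t : ℕ),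
    f t = ∑ k ∈ Finset.range (q + 1), (t.choose k : ℝ) * dseq^[k] f 0
      + ∑ j ∈ Finset.range t, ((t - 1 - j).choose q : ℝ) * dseq^[q + 1] f j := by
  induction q with
  | zero =>
    intro f t
    have := Finset.sum_range_sub f t
    simp only [dseq, zero_add, Finset.sum_range_one, Nat.choose_zero_right, Nat.cast_one, one_mul,
      Function.iterate_zero, id, Function.iterate_one]
    linarith
  | succ q ih =>
    intro f t
    induction t with
    | zero =>
      rw [Finset.sum_range_succ']
      simp
    | succ t iht =>
      have h1 : f (t + 1) = f t + dseq f t := by simp [dseq]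
      rw [h1, ih (dseq f) t]
      nth_rw 1 [iht]
      rw [Finset.sum_range_succ' _ (q + 1), Finset.sum_range_succ' _ (q + 1),
        Finset.sum_range_succ _ t]
      have h2 : ∀ k ∈ Finset.range (q + 1),
          ((t + 1).choose (k + 1) : ℝ) * dseq^[k + 1] f 0 =
          (t.choose k : ℝ) * dseq^[k] (dseq f) 0 + (t.choose (k + 1) : ℝ) * dseq^[k + 1] f 0 := by
        intro k _
        rw [Nat.choose_succ_succ, Function.iterate_succ_apply]
        push_cast
        ring
      have h3 : ∀ j ∈ Finset.range t,
          ((t + 1 - 1 - j).choose (q + 1) : ℝ) * dseq^[q + 1 + 1] f j =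
          ((t - 1 - j).choose q : ℝ) * dseq^[q + 1] (dseq f) j +
            ((t - 1 - j).choose (q + 1) : ℝ) * dseq^[q + 1 + 1] f j := by
        intro j hj
        have hj' := Finset.mem_range.1 hj
        have : t + 1 - 1 - j = (t - 1 - j) + 1 := by omega
        rw [this, Nat.choose_succ_succ, Function.iterate_succ_apply dseq (q + 1)]
        push_cast
        ring
      rw [Finset.sum_congr rfl h2, Finset.sum_congr rfl h3, Finset.sum_add_distrib,
        Finset.sum_add_distrib]
      simp
      ring

lemma dseq_iter_sub (r : ℕ) : ∀ (f g : ℕ → ℝ) (t : ℕ),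
    dseq^[r] (f - g) t = dseq^[r] f t - dseq^[r] g t := by
  induction r with
  | zero => intro f g t; simp
  | succ r ih =>
    intro f g t
    rw [Function.iterate_succ_apply, Function.iterate_succ_apply, Function.iterate_succ_apply,
      ← ih]
    refine congrFun (congrArg _ ?_) t
    funext s
    simp [dseq]
    ring

lemma DD_sub (r : ℕ) {n : ℕ} (x y : Fin n → ℝ) (t : ℕ) :
    DD r (x - y) t = DD r x t - DD r y t := by
  unfold DD
  rw [← dseq_iter_sub]
  refine congrFun (congrArg _ ?_) t
  funext s
  simp only [pad, Pi.sub_apply]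
  split_ifs <;> simp

/-- the polynomial basis vectors -/
def polyv (r n : ℕ) (k : Fin r) : Fin n → ℝ := fun t => (t.1.choose k.1 : ℝ)

/-- truncated power vectors -/
def truncv (r n : ℕ) (j : ℕ) : Fin n → ℝ := fun t =>
  if j < t.1 then ((t.1 - 1 - j).choose (r - 1) : ℝ) else 0

lemma taylor_vec (r : ℕ) (hr : 1 ≤ r) {n : ℕ} (x : Fin n → ℝ) :
    x = ∑ k : Fin r, DD k.1 x 0 • polyv r n k
      + ∑ j ∈ Finset.range (n - r), DD r x j • truncv r n j := by
  obtain ⟨q, rfl⟩ : ∃ q, r = q + 1 := ⟨r - 1, by omega⟩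
  funext t
  have h := taylor_aux q (pad x) t.1
  have h0 : pad x t.1 = x t := by simp [pad]
  rw [h0] at h
  rw [h]
  simp only [Pi.add_apply, Finset.sum_apply, Pi.smul_apply, smul_eq_mul, polyv, truncv, DD]
  congr 1
  · rw [Finset.sum_range]
    exact Finset.sum_congr rfl fun k _ => mul_comm _ _
  · simp only [mul_ite, mul_zero, Nat.add_sub_cancel]
    rw [← Finset.sum_filter]
    have hs : (Finset.range (n - (q + 1))).filter (fun j => j < t.1) ⊆ Finset.range t.1 := by
      intro j hj
      simp at hj ⊢
      exact hj.2
    rw [← Finset.sum_subset hs]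
    · exact Finset.sum_congr rfl fun k _ => mul_comm _ _
    · intro j hj hj'
      simp at hj hj'
      have : (t.1 - 1 - j).choose q = 0 := by
        apply Nat.choose_eq_zero_of_lt
        have := t.2
        by_contra hc
        have := hj' (by omega)
        omega
      simp [this]

lemma truncv_sq (r : ℕ) (hr : 1 ≤ r) {n : ℕ} (j : ℕ) :
    sqnorm (truncv r n j) ≤ (n : ℝ) ^ (2 * r - 1) := by
  obtain ⟨q, rfl⟩ : ∃ q, r = q + 1 := ⟨r - 1, by omega⟩
  have h : ∀ t : Fin n, (truncv (q + 1) n j t) ^ 2 ≤ (n : ℝ) ^ (2 * q) := by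
    intro t
    have h1 : |truncv (q + 1) n j t| ≤ (n : ℝ) ^ q := by
      unfold truncv
      split_ifs
      · rw [Nat.abs_cast]
        have := Nat.choose_le_pow (t.1 - 1 - j) q
        have h2 : (t.1 - 1 - j) ^ q ≤ n ^ q := Nat.pow_le_pow_left (by omega) q
        exact_mod_cast this.trans h2
      · simp
    calc _ = |truncv (q + 1) n j t| ^ 2 := (sq_abs _).symm
      _ ≤ ((n : ℝ) ^ q) ^ 2 := by gcongr
      _ = _ := by rw [← pow_mul, mul_comm]
  calc sqnorm (truncv (q + 1) n j) ≤ ∑ _t : Fin n, (n : ℝ) ^ (2 * q) :=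
        Finset.sum_le_sum fun t _ => h t
    _ = _ := by
      simp
      rw [← pow_succ']
      congr 1

lemma exists_proj (r n : ℕ) (v : Fin r → Fin n → ℝ) :
    ∃ m : ℕ, m ≤ r ∧ ∃ b : Fin m → Fin n → ℝ, (∀ k, sqnorm (b k) = 1) ∧
      ∃ P : (Fin n → ℝ) →ₗ[ℝ] (Fin n → ℝ), (∀ k, P (v k) = v k) ∧
        (∀ x y, P x ⬝ᵥ y = x ⬝ᵥ P y) ∧ (∀ x, sqnorm (x - P x) ≤ sqnorm x) ∧
        (∀ x, sqnorm (P x) = ∑ k, (b k ⬝ᵥ x) ^ 2) := by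
  let e := WithLp.linearEquiv 2 ℝ (Fin n → ℝ)
  let K : Submodule ℝ (EuclideanSpace ℝ (Fin n)) :=
    Submodule.span ℝ (Set.range fun k => e.symm (v k))
  let B := stdOrthonormalBasis ℝ K
  have hn : ∀ x : EuclideanSpace ℝ (Fin n), ‖x‖ ^ 2 = sqnorm (e x) := by
    intro x
    rw [EuclideanSpace.norm_sq_eq]
    simp [sqnorm, e]
  have hi : ∀ x y : EuclideanSpace ℝ (Fin n), inner ℝ x y = e x ⬝ᵥ e y := by
    intro x y
    simp [PiLp.inner_apply, dotProduct, e, mul_comm]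
  refine ⟨Module.finrank ℝ K, ?_, fun k => e (B k : EuclideanSpace ℝ (Fin n)), ?_,
    e.toLinearMap ∘ₗ K.starProjection.toLinearMap ∘ₗ e.symm.toLinearMap, ?_, ?_, ?_, ?_⟩
  · have := finrank_range_le_card (R := ℝ) (fun k => e.symm (v k))
    rw [Fintype.card_fin] at this
    exact this
  · intro k
    rw [← hn]
    have : ‖B k‖ = 1 := B.orthonormal.1 k
    simp only [Submodule.coe_norm] at this
    rw [this]; norm_num
  · intro k
    have : K.starProjection (e.symm (v k)) = e.symm (v k) :=
      Submodule.starProjection_eq_self_iff.2 (Submodule.subset_span ⟨k, rfl⟩)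
    simp [this]
  · intro x y
    have := K.inner_starProjection_left_eq_right (e.symm x) (e.symm y)
    rw [hi, hi] at this
    simpa using this
  · intro x
    have h1 := Submodule.norm_sq_eq_add_norm_sq_starProjection (e.symm x) K
    rw [Submodule.starProjection_orthogonal_val, hn, hn, hn] at h1
    have h2 : 0 ≤ sqnorm (e (K.starProjection (e.symm x))) :=
      Finset.sum_nonneg fun i _ => sq_nonneg _
    simp only [map_sub, LinearEquiv.apply_symm_apply] at h1
    simp only [LinearMap.comp_apply, LinearEquiv.coe_coe, ContinuousLinearMap.coe_coe]
    linarith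
  · intro x
    have h1 := B.sum_sq_inner_right (K.orthogonalProjectionOnto (e.symm x))
    simp only [Submodule.inner_orthogonalProjectionOnto_eq_of_mem_left, hi,
      LinearEquiv.apply_symm_apply] at h1
    rw [h1, Submodule.coe_norm, ← Submodule.starProjection_apply, hn]
    simp

lemma gauss_exp (n : ℕ) (σ : ℝ) (a : Fin n → ℝ) :
    Integrable (fun ξ : Fin n → ℝ => Real.exp (a ⬝ᵥ ξ)) (gaussVec n σ) ∧
    ∫ ξ, Real.exp (a ⬝ᵥ ξ) ∂gaussVec n σ = Real.exp (σ ^ 2 * sqnorm a / 2) := by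
  have h : (fun ξ : Fin n → ℝ => Real.exp (a ⬝ᵥ ξ)) =
      fun ξ => ∏ i, Real.exp (a i * ξ i) := by
    funext ξ
    rw [← Real.exp_sum]
    rfl
  rw [h]
  unfold gaussVec
  constructor
  · exact Integrable.fintype_prod (f := fun i x => Real.exp (a i * x))
      fun i => integrable_exp_mul_gaussianReal (a i)
  · rw [integral_fintype_prod_eq_prod (fun i (x : ℝ) => Real.exp (a i * x))]
    have h2 : ∀ i, ∫ x, Real.exp (a i * x) ∂gaussianReal 0 (σ ^ 2).toNNReal =
        Real.exp (σ ^ 2 * a i ^ 2 / 2) := by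
      intro i
      have := mgf_gaussianReal (p := gaussianReal 0 (σ ^ 2).toNNReal) (X := id)
        (by simp : Measure.map id _ = gaussianReal 0 (σ ^ 2).toNNReal) (a i)
      rw [mgf] at this
      simpa [sq_nonneg] using this
    simp only [h2]
    rw [← Real.exp_sum, sqnorm, Finset.mul_sum, Finset.sum_div]

/-- symmetric exponential -/
def cosh2 {n : ℕ} (a ξ : Fin n → ℝ) : ℝ := Real.exp (a ⬝ᵥ ξ) + Real.exp (-(a ⬝ᵥ ξ))

lemma cosh2_pos {n : ℕ} (a ξ : Fin n → ℝ) : 0 < cosh2 a ξ := by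
  unfold cosh2; positivity

lemma gauss_cosh2 (n : ℕ) (σ : ℝ) (a : Fin n → ℝ) :
    Integrable (fun ξ : Fin n → ℝ => cosh2 a ξ) (gaussVec n σ) ∧
    ∫ ξ, cosh2 a ξ ∂gaussVec n σ = 2 * Real.exp (σ ^ 2 * sqnorm a / 2) := by
  have h1 := gauss_exp n σ a
  have h2 := gauss_exp n σ (-a)
  simp only [neg_dotProduct] at h2
  have h3 : sqnorm (-a) = sqnorm a := by simp [sqnorm]
  rw [h3] at h2
  unfold cosh2
  refine ⟨h1.1.add h2.1, ?_⟩
  rw [integral_add h1.1 h2.1, h1.2, h2.2]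
  ring

lemma pow_le_cosh2 {n : ℕ} (a ξ : Fin n → ℝ) :
    (a ⬝ᵥ ξ) ^ 2 ≤ 2 * cosh2 a ξ ∧ (a ⬝ᵥ ξ) ^ 4 ≤ 24 * cosh2 a ξ ∧
    Real.exp |a ⬝ᵥ ξ| ≤ cosh2 a ξ := by
  have h0 : Real.exp |a ⬝ᵥ ξ| ≤ cosh2 a ξ := by
    unfold cosh2
    rcases abs_choice (a ⬝ᵥ ξ) with h | h <;> rw [h] <;>
      linarith [Real.exp_pos (a ⬝ᵥ ξ), Real.exp_pos (-(a ⬝ᵥ ξ))]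
  have h2 := Real.pow_div_factorial_le_exp |a ⬝ᵥ ξ| (abs_nonneg _) 2
  have h4 := Real.pow_div_factorial_le_exp |a ⬝ᵥ ξ| (abs_nonneg _) 4
  rw [(by decide : Even 2).pow_abs] at h2
  rw [(by decide : Even 4).pow_abs] at h4
  norm_num [Nat.factorial] at h2 h4
  refine ⟨by linarith, by linarith, h0⟩

lemma dot_le {n : ℕ} (x y : Fin n → ℝ) : x ⬝ᵥ y ≤ sqnorm x + sqnorm y / 4 := by
  unfold dotProduct sqnorm
  rw [Finset.sum_div, ← Finset.sum_add_distrib]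
  refine Finset.sum_le_sum fun i _ => ?_
  nlinarith [sq_nonneg (x i - y i / 2)]

lemma basic_ineq {r n : ℕ} {σ lam : ℝ} {est : (Fin n → ℝ) → Fin n → ℝ}
    (hest : IsPenEst r σ lam est) (θs ξ : Fin n → ℝ) (hθ : ∀ t < n - r, DD r θs t = 0) :
    1 / 2 * sqnorm (est (θs + ξ) - θs) +
      σ * (n : ℝ) ^ ((r : ℤ) - 1) * lam *
        ∑ j ∈ Finset.range (n - r), |DD r (est (θs + ξ) - θs) j|
      ≤ ξ ⬝ᵥ (est (θs + ξ) - θs) := by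
  have h := hest (θs + ξ) θs
  have h1 : Dl1 r θs = 0 := by
    unfold Dl1
    refine Finset.sum_eq_zero fun t ht => ?_
    rw [hθ t (Finset.mem_range.1 ht), abs_zero]
  have h2 : Dl1 r (est (θs + ξ)) =
      ∑ j ∈ Finset.range (n - r), |DD r (est (θs + ξ) - θs) j| := by
    unfold Dl1
    refine Finset.sum_congr rfl fun t ht => ?_
    rw [DD_sub, hθ t (Finset.mem_range.1 ht), sub_zero]
  rw [h1, h2, add_sub_cancel_left, mul_zero, add_zero] at h
  have h3 : sqnorm (θs + ξ - est (θs + ξ)) = sqnorm ξ - 2 * (ξ ⬝ᵥ (est (θs + ξ) - θs))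
      + sqnorm (est (θs + ξ) - θs) := by
    unfold sqnorm dotProduct
    rw [Finset.mul_sum, ← Finset.sum_sub_distrib, ← Finset.sum_add_distrib]
    refine Finset.sum_congr rfl fun i _ => ?_
    simp only [Pi.add_apply, Pi.sub_apply]
    ring
  rw [h3] at h
  linarith

lemma pointwise_bound {r n m : ℕ} (hr : 1 ≤ r) (hn : 0 < n) {σ : ℝ} (hσ : 0 < σ)
    (b : Fin m → Fin n → ℝ) (P : (Fin n → ℝ) →ₗ[ℝ] (Fin n → ℝ))
    (hPv : ∀ k, P (polyv r n k) = polyv r n k) (hPs : ∀ x y, P x ⬝ᵥ y = x ⬝ᵥ P y)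
    (hPb : ∀ x, sqnorm (P x) = ∑ k, (b k ⬝ᵥ x) ^ 2)
    (Δ ξ : Fin n → ℝ) (c s : ℝ) (hc : 0 ≤ c) (hs : 0 ≤ s)
    (h : 1 / 2 * sqnorm Δ + c * ∑ j ∈ Finset.range (n - r), |DD r Δ j| ≤ ξ ⬝ᵥ Δ) :
    sqnorm Δ ≤ ∑ k, 8 * σ ^ 2 * cosh2 ((1 / σ) • b k) ξ
      + ∑ i, 48 * σ ^ 2 / n * cosh2 (Pi.single i (1 / σ)) ξ
      + ∑ j ∈ Finset.range (n - r), 2 * (n : ℝ) ^ 2 * σ ^ 2 * Real.exp (-(s * c)) *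
          cosh2 (s • (truncv r n j - P (truncv r n j))) ξ := by
  have hn' : (0 : ℝ) < n := by exact_mod_cast hn
  have n1 : 0 ≤ ∑ k, 8 * σ ^ 2 * cosh2 ((1 / σ) • b k) ξ :=
    Finset.sum_nonneg fun k _ => by have := cosh2_pos ((1 / σ) • b k) ξ; positivity
  have n2 : 0 ≤ ∑ i, 48 * σ ^ 2 / n * cosh2 (Pi.single i (1 / σ)) ξ :=
    Finset.sum_nonneg fun i _ => by have := cosh2_pos (Pi.single i (1 / σ)) ξ; positivity
  have n3 : ∀ j ∈ Finset.range (n - r), 0 ≤ 2 * (n : ℝ) ^ 2 * σ ^ 2 * Real.exp (-(s * c)) *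
      cosh2 (s • (truncv r n j - P (truncv r n j))) ξ := fun j _ => by
    have := cosh2_pos (s • (truncv r n j - P (truncv r n j))) ξ; positivity
  by_cases hg : ∀ j ∈ Finset.range (n - r), |(truncv r n j - P (truncv r n j)) ⬝ᵥ ξ| ≤ c
  · have h1 : ξ ⬝ᵥ Δ = P ξ ⬝ᵥ Δ + ξ ⬝ᵥ (Δ - P Δ) := by
      rw [hPs, dotProduct_sub]; ring
    have h2 : Δ - P Δ = ∑ j ∈ Finset.range (n - r),
        DD r Δ j • (truncv r n j - P (truncv r n j)) := by
      have ht := taylor_vec r hr Δ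
      have hP := congrArg P ht
      simp only [map_add, map_sum, map_smul, hPv] at hP
      rw [hP]
      nth_rw 1 [ht]
      rw [add_sub_add_left_eq_sub, ← Finset.sum_sub_distrib]
      exact Finset.sum_congr rfl fun j _ => (smul_sub _ _ _).symm
    have h3 : ξ ⬝ᵥ (Δ - P Δ) ≤ c * ∑ j ∈ Finset.range (n - r), |DD r Δ j| := by
      rw [h2, dotProduct_sum, Finset.mul_sum]
      refine Finset.sum_le_sum fun j hj => ?_
      rw [dotProduct_smul, smul_eq_mul, dotProduct_comm]
      calc _ ≤ |DD r Δ j * ((truncv r n j - P (truncv r n j)) ⬝ᵥ ξ)| := le_abs_self _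
        _ = |DD r Δ j| * |(truncv r n j - P (truncv r n j)) ⬝ᵥ ξ| := abs_mul _ _
        _ ≤ |DD r Δ j| * c := by gcongr; exact hg j hj
        _ = _ := mul_comm _ _
    have h4 := dot_le (P ξ) Δ
    have h5 : sqnorm (P ξ) * 4 ≤ ∑ k, 8 * σ ^ 2 * cosh2 ((1 / σ) • b k) ξ := by
      rw [hPb, Finset.sum_mul]
      refine Finset.sum_le_sum fun k _ => ?_
      have := (pow_le_cosh2 ((1 / σ) • b k) ξ).1
      rw [smul_dotProduct, smul_eq_mul, mul_pow, div_pow, one_pow, div_mul_eq_mul_div, one_mul,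
        div_le_iff₀ (by positivity)] at this
      linarith
    have n3' := Finset.sum_nonneg n3
    linarith
  · push Not at hg
    obtain ⟨j, hj, hjc⟩ := hg
    have h4 := dot_le ξ Δ
    have hD : 0 ≤ c * ∑ j ∈ Finset.range (n - r), |DD r Δ j| :=
      mul_nonneg hc (Finset.sum_nonneg fun _ _ => abs_nonneg _)
    have h6 : sqnorm ξ * 4 ≤ ∑ i, 48 * σ ^ 2 / n * cosh2 (Pi.single i (1 / σ)) ξ
        + 2 * (n : ℝ) ^ 2 * σ ^ 2 := by
      have h7 : ∀ i : Fin n, ξ i ^ 2 * 4 ≤ 48 * σ ^ 2 / n * cosh2 (Pi.single i (1 / σ)) ξ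
          + 2 * n * σ ^ 2 := by
        intro i
        have h8 := (pow_le_cosh2 (Pi.single i (1 / σ)) ξ).2.1
        rw [single_dotProduct] at h8
        have h9 : ξ i ^ 2 * 4 ≤ 2 * σ ^ 2 / n * (1 / σ * ξ i) ^ 4 + 2 * n * σ ^ 2 := by
          have : 2 * σ ^ 2 / n * (1 / σ * ξ i) ^ 4 + 2 * n * σ ^ 2 - ξ i ^ 2 * 4
              = 2 / (n * σ ^ 2) * (ξ i ^ 2 - n * σ ^ 2) ^ 2 := by
            field_simp
            ring
          have h10 : 0 ≤ 2 / (n * σ ^ 2) * (ξ i ^ 2 - n * σ ^ 2) ^ 2 := by positivity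
          linarith
        calc _ ≤ _ := h9
          _ ≤ 2 * σ ^ 2 / n * (24 * cosh2 (Pi.single i (1 / σ)) ξ) + 2 * n * σ ^ 2 := by gcongr
          _ = _ := by ring
      calc sqnorm ξ * 4 = ∑ i, ξ i ^ 2 * 4 := by rw [sqnorm, Finset.sum_mul]
        _ ≤ ∑ i, (48 * σ ^ 2 / n * cosh2 (Pi.single i (1 / σ)) ξ + 2 * n * σ ^ 2) :=
          Finset.sum_le_sum fun i _ => h7 i
        _ = _ := by
          rw [Finset.sum_add_distrib]
          simp
          ring
    have h11 : 2 * (n : ℝ) ^ 2 * σ ^ 2 ≤ ∑ j ∈ Finset.range (n - r),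
        2 * (n : ℝ) ^ 2 * σ ^ 2 * Real.exp (-(s * c)) *
          cosh2 (s • (truncv r n j - P (truncv r n j))) ξ := by
      refine le_trans ?_ (Finset.single_le_sum n3 hj)
      have h12 := (pow_le_cosh2 (s • (truncv r n j - P (truncv r n j))) ξ).2.2
      rw [smul_dotProduct, smul_eq_mul, abs_mul, abs_of_nonneg hs] at h12
      have h13 : Real.exp (s * c) ≤ cosh2 (s • (truncv r n j - P (truncv r n j))) ξ :=
        le_trans (Real.exp_le_exp.2 (by gcongr)) h12
      calc 2 * (n : ℝ) ^ 2 * σ ^ 2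
          = 2 * (n : ℝ) ^ 2 * σ ^ 2 * Real.exp (-(s * c)) * Real.exp (s * c) := by
            rw [mul_assoc _ (Real.exp _), ← Real.exp_add]; simp
        _ ≤ _ := by gcongr
    linarith

lemma exp_half_le : Real.exp (1 / 2) ≤ 2 := by
  have h1 : Real.exp (1 / 2) ^ 2 = Real.exp 1 := by
    rw [← Real.exp_nat_mul]; norm_num
  have h2 := Real.exp_one_lt_d9
  nlinarith [Real.exp_pos (1 / 2 : ℝ)]

lemma tail_bound {r n : ℕ} (hr : 1 ≤ r) (hn : 0 < n) {σ lam : ℝ} (hσ : 0 < σ)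
    (hlam : Real.sqrt (6 * (n : ℝ) * Real.log (Real.exp 1 * (n : ℝ))) ≤ lam)
    (c : ℝ) (hc : c = σ * (n : ℝ) ^ ((r : ℤ) - 1) * lam) (H : ℝ)
    (hH : H ≤ (n : ℝ) ^ (2 * r - 1)) :
    Real.exp (-(c / (σ ^ 2 * (n : ℝ) ^ (2 * r - 1)) * c)) *
      Real.exp (σ ^ 2 * ((c / (σ ^ 2 * (n : ℝ) ^ (2 * r - 1))) ^ 2 * H) / 2) * (n : ℝ) ^ 3 ≤ 1 := by
  have hn' : (0 : ℝ) < n := by exact_mod_cast hn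
  have hn1 : (1 : ℝ) ≤ n := by exact_mod_cast hn
  obtain ⟨q, rfl⟩ : ∃ q, r = q + 1 := ⟨r - 1, by omega⟩
  have e1 : 2 * (q + 1) - 1 = 2 * q + 1 := by omega
  have e2 : (n : ℝ) ^ (((q + 1 : ℕ) : ℤ) - 1) = (n : ℝ) ^ q := by
    push_cast
    rw [add_sub_cancel_right, zpow_natCast]
  rw [e1] at hH ⊢
  rw [e2] at hc
  set B : ℝ := (n : ℝ) ^ (2 * q + 1) with hB
  have hBpos : 0 < B := by positivity
  have hlog : Real.log (Real.exp 1 * n) = 1 + Real.log n := by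
    rw [Real.log_mul (Real.exp_pos 1).ne' hn'.ne', Real.log_exp]
  have hL0 : 0 ≤ Real.log n := Real.log_nonneg hn1
  have hlam2 : 6 * (n : ℝ) * (1 + Real.log n) ≤ lam ^ 2 := by
    rw [hlog] at hlam
    have := Real.sqrt_le_left (Real.sqrt_nonneg _ |>.trans hlam) |>.1 hlam
    exact this
  have hc2 : 6 * (1 + Real.log n) * (σ ^ 2 * B) ≤ c ^ 2 := by
    have : c ^ 2 = σ ^ 2 * (n : ℝ) ^ (2 * q) * lam ^ 2 := by
      rw [hc]; ring
    rw [this, hB, pow_succ (n : ℝ)]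
    calc _ = σ ^ 2 * (n : ℝ) ^ (2 * q) * (6 * (n : ℝ) * (1 + Real.log n)) := by ring
      _ ≤ _ := by gcongr
  have h3 : (n : ℝ) ^ 3 = Real.exp (3 * Real.log n) := by
    rw [mul_comm, Real.exp_mul, Real.exp_log hn']
    norm_cast
  rw [h3, ← Real.exp_add, ← Real.exp_add, Real.exp_le_one_iff]
  have h4 : σ ^ 2 * ((c / (σ ^ 2 * B)) ^ 2 * H) / 2 ≤ c ^ 2 / (σ ^ 2 * B) / 2 := by
    calc _ ≤ σ ^ 2 * ((c / (σ ^ 2 * B)) ^ 2 * B) / 2 := by gcongr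
      _ = _ := by field_simp
  have h5 : c / (σ ^ 2 * B) * c = c ^ 2 / (σ ^ 2 * B) := by ring
  have h6 : 6 * (1 + Real.log n) ≤ c ^ 2 / (σ ^ 2 * B) := by
    rwa [le_div_iff₀ (by positivity)]
  rw [h5]
  linarith

lemma sqnorm_smul {n : ℕ} (a : ℝ) (x : Fin n → ℝ) : sqnorm (a • x) = a ^ 2 * sqnorm x := by
  simp [sqnorm, mul_pow, Finset.mul_sum]

/-- Lemma: risk of the penalized estimator when `D^{(r)}θ* = 0`. -/
theorem stmt11 (r : ℕ) (hr : 1 ≤ r) :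
    ∃ C : ℝ, 0 < C ∧
      ∀ (n : ℕ), 2 * r ≤ n → ∀ σ : ℝ, 0 < σ → ∀ θstar : Fin n → ℝ,
        (∀ t < n - r, DD r θstar t = 0) →
        ∀ lam : ℝ, Real.sqrt (6 * (n : ℝ) * Real.log (Real.exp 1 * (n : ℝ))) ≤ lam →
        ∀ est : (Fin n → ℝ) → Fin n → ℝ, IsPenEst r σ lam est →
          risk σ est θstar ≤ C * σ ^ 2 / (n : ℝ) := by
  refine ⟨32 * r + 196, by positivity, ?_⟩
  intro n hrn σ hσ θs hθ lam hlam est hest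
  have hn : 0 < n := by omega
  have hn' : (0 : ℝ) < n := by exact_mod_cast hn
  obtain ⟨m, hm, b, hb, P, hPv, hPs, hPle, hPb⟩ := exists_proj r n (polyv r n)
  have hlam0 : 0 ≤ lam := (Real.sqrt_nonneg _).trans hlam
  obtain ⟨c, hc⟩ : ∃ c, c = σ * (n : ℝ) ^ ((r : ℤ) - 1) * lam := ⟨_, rfl⟩
  have hc0 : 0 ≤ c := by rw [hc]; positivity
  obtain ⟨s, hs⟩ : ∃ s, s = c / (σ ^ 2 * (n : ℝ) ^ (2 * r - 1)) := ⟨_, rfl⟩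
  have hs0 : 0 ≤ s := by rw [hs]; positivity
  have hpt : ∀ ξ, sqnorm (est (θs + ξ) - θs) ≤ _ := fun ξ =>
    pointwise_bound hr hn hσ b P hPv hPs hPb (est (θs + ξ) - θs) ξ c s hc0 hs0
      (by rw [hc]; exact basic_ineq hest θs ξ hθ)
  have i1 : Integrable (fun ξ : Fin n → ℝ => ∑ k, 8 * σ ^ 2 * cosh2 ((1 / σ) • b k) ξ)
      (gaussVec n σ) :=
    integrable_finsetSum _ fun k _ => (gauss_cosh2 n σ _).1.const_mul _
  have i2 : Integrable (fun ξ : Fin n → ℝ =>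
      ∑ i, 48 * σ ^ 2 / n * cosh2 (Pi.single i (1 / σ)) ξ) (gaussVec n σ) :=
    integrable_finsetSum _ fun k _ => (gauss_cosh2 n σ _).1.const_mul _
  have i3 : Integrable (fun ξ : Fin n → ℝ =>
      ∑ j ∈ Finset.range (n - r), 2 * (n : ℝ) ^ 2 * σ ^ 2 * Real.exp (-(s * c)) *
          cosh2 (s • (truncv r n j - P (truncv r n j))) ξ) (gaussVec n σ) :=
    integrable_finsetSum _ fun k _ => (gauss_cosh2 n σ _).1.const_mul _
  have hint := integral_mono_of_nonneg (μ := gaussVec n σ)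
    (Filter.Eventually.of_forall fun ξ =>
      (Finset.sum_nonneg fun i _ => sq_nonneg _ : 0 ≤ sqnorm (est (θs + ξ) - θs)))
    ((i1.add i2).add i3) (Filter.Eventually.of_forall hpt)
  have v1 : ∫ ξ, ∑ k, 8 * σ ^ 2 * cosh2 ((1 / σ) • b k) ξ ∂gaussVec n σ ≤ 32 * r * σ ^ 2 := by
    rw [integral_finsetSum _ fun k _ => (gauss_cosh2 n σ _).1.const_mul _]
    have : ∀ k, ∫ ξ, 8 * σ ^ 2 * cosh2 ((1 / σ) • b k) ξ ∂gaussVec n σ ≤ 32 * σ ^ 2 := by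
      intro k
      rw [integral_const_mul, (gauss_cosh2 n σ _).2, sqnorm_smul, hb]
      have e : σ ^ 2 * ((1 / σ) ^ 2 * 1) / 2 = 1 / 2 := by field_simp
      rw [e]
      nlinarith [exp_half_le, sq_nonneg σ]
    calc _ ≤ ∑ _k : Fin m, 32 * σ ^ 2 := Finset.sum_le_sum fun k _ => this k
      _ = 32 * m * σ ^ 2 := by simp; ring
      _ ≤ _ := by gcongr
  have v2 : ∫ ξ, ∑ i, 48 * σ ^ 2 / n * cosh2 (Pi.single i (1 / σ)) ξ ∂gaussVec n σ
      ≤ 192 * σ ^ 2 := by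
    rw [integral_finsetSum _ fun k _ => (gauss_cosh2 n σ _).1.const_mul _]
    have : ∀ i : Fin n, ∫ ξ, 48 * σ ^ 2 / n * cosh2 (Pi.single i (1 / σ)) ξ ∂gaussVec n σ
        ≤ 192 * σ ^ 2 / n := by
      intro i
      rw [integral_const_mul, (gauss_cosh2 n σ _).2]
      have e0 : sqnorm (Pi.single i (1 / σ) : Fin n → ℝ) = (1 / σ) ^ 2 := by
        unfold sqnorm
        rw [Finset.sum_eq_single i]
        · simp
        · intro j _ hj
          simp [hj]
        · simp
      have e : σ ^ 2 * ((1 / σ) ^ 2) / 2 = 1 / 2 := by field_simp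
      rw [e0, e]
      calc _ ≤ 48 * σ ^ 2 / n * (2 * 2) := by gcongr; exact exp_half_le
        _ = _ := by ring
    calc _ ≤ ∑ _i : Fin n, 192 * σ ^ 2 / n := Finset.sum_le_sum fun k _ => this k
      _ = _ := by simp; field_simp
  have v3 : ∫ ξ, ∑ j ∈ Finset.range (n - r), 2 * (n : ℝ) ^ 2 * σ ^ 2 * Real.exp (-(s * c)) *
          cosh2 (s • (truncv r n j - P (truncv r n j))) ξ ∂gaussVec n σ ≤ 4 * σ ^ 2 := by
    rw [integral_finsetSum _ fun k _ => (gauss_cosh2 n σ _).1.const_mul _]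
    have : ∀ j ∈ Finset.range (n - r), ∫ ξ, 2 * (n : ℝ) ^ 2 * σ ^ 2 * Real.exp (-(s * c)) *
          cosh2 (s • (truncv r n j - P (truncv r n j))) ξ ∂gaussVec n σ ≤ 4 * σ ^ 2 / n := by
      intro j _
      rw [integral_const_mul, (gauss_cosh2 n σ _).2, sqnorm_smul]
      have ht := tail_bound hr hn hσ hlam c hc _ ((hPle (truncv r n j)).trans (truncv_sq r hr j))
      rw [← hs] at ht
      rw [le_div_iff₀ hn']
      calc _ = 4 * σ ^ 2 * (Real.exp (-(s * c)) * Real.exp (σ ^ 2 *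
            (s ^ 2 * sqnorm (truncv r n j - P (truncv r n j))) / 2) * (n : ℝ) ^ 3) := by ring
        _ ≤ 4 * σ ^ 2 * 1 := by gcongr
        _ = _ := by ring
    calc _ ≤ ∑ _j ∈ Finset.range (n - r), 4 * σ ^ 2 / n := Finset.sum_le_sum this
      _ = (n - r : ℕ) * (4 * σ ^ 2 / n) := by simp
      _ ≤ n * (4 * σ ^ 2 / n) := by gcongr; omega
      _ = _ := by field_simp
  have hsum : ∫ ξ, sqnorm (est (θs + ξ) - θs) ∂gaussVec n σ ≤ (32 * r + 196) * σ ^ 2 := by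
    refine hint.trans ?_
    have e1 := integral_add (i1.add i2) i3
    have e2 := integral_add i1 i2
    simp only [Pi.add_apply] at e1 e2 ⊢
    rw [e1, e2]
    linarith
  unfold risk
  rw [one_div, inv_mul_eq_div]
  gcongr

end
end
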